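/- (Theorem 2.1) Let m > 2 be an integer and ν, η, ε > 0. Let (u, b, π) be a smooth solution of the 2½-dimensional Hall-MHD system on [0,T) × ℝ², Schwartz-class in the space variable for each t, with sup_{0≤t≤T'} (‖u(t)‖_{Hᵐ} + ‖b(t)‖_{Hᵐ}) < ∞ for every T' < T. Suppose there exist p ∈ (2,∞] and r ∈ [2,∞) with 2/p + 2/r ≤ 1 such that ∫₀ᵀ ‖∇b₃(t,·)‖_{Lᵖ(ℝ²)}^{r} dt < ∞, where ∇b₃ = (∂₁b₃, ∂₂b₃) (equivalently, the first two components (j₁, j₂) = (∂₂b₃, −∂₁b₃) of the current density satisfy ∑_{k=1}^{2} ∫₀ᵀ ‖jₖ(t,·)‖_{Lᵖ}^{r} dt < ∞). Then sup_{0≤t<T} (‖u(t)‖_{Hᵐ} + ‖b(t)‖_{Hᵐ}) < ∞. -/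

import Mathlib

open MeasureTheory
open scoped ENNReal

noncomputable section

/-- Partial derivative in the `i`-th coordinate direction of `ℝ²`. -/
def pd (i : Fin 2) (f : (Fin 2 → ℝ) → ℝ) (x : Fin 2 → ℝ) : ℝ :=
  fderiv ℝ f x (Pi.single i 1)

/-- The Laplacian `Δ = ∂₁² + ∂₂²` of a scalar function on `ℝ²`. -/
def lap (f : (Fin 2 → ℝ) → ℝ) (x : Fin 2 → ℝ) : ℝ :=
  pd 0 (pd 0 f) x + pd 1 (pd 1 f) x

/-- The 2½-dimensional curl `∇×F = (∂₂F₃, −∂₁F₃, ∂₁F₂ − ∂₂F₁)` of `F : ℝ² → ℝ³`. -/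
def curl (F : (Fin 2 → ℝ) → (Fin 3 → ℝ)) (x : Fin 2 → ℝ) : Fin 3 → ℝ :=
  ![pd 1 (fun y => F y 2) x, -(pd 0 (fun y => F y 2) x),
    pd 0 (fun y => F y 1) x - pd 1 (fun y => F y 0) x]

/-- The advection term `(f·∇)g = f₁∂₁g + f₂∂₂g` for `f, g : ℝ² → ℝ³`. -/
def advect (f g : (Fin 2 → ℝ) → (Fin 3 → ℝ)) (x : Fin 2 → ℝ) (i : Fin 3) : ℝ :=
  f x 0 * pd 0 (fun y => g y i) x + f x 1 * pd 1 (fun y => g y i) x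

/-- A function is Schwartz-class: it is smooth and all its iterated derivatives decay
faster than any polynomial. -/
def IsSchwartz {F : Type*} [NormedAddCommGroup F] [NormedSpace ℝ F]
    (f : (Fin 2 → ℝ) → F) : Prop :=
  ContDiff ℝ (⊤ : ℕ∞) f ∧
    ∀ k n : ℕ, ∃ C : ℝ, ∀ x, ‖x‖ ^ k * ‖iteratedFDeriv ℝ n f x‖ ≤ C

/-- A smooth solution of the 2½-dimensional Hall-MHD system on `S × ℝ²`, Schwartz-class in
the space variable for each time `t ∈ S`:
`∂ₜu + (u·∇)u + ∇π = νΔu + (b·∇)b`, `∂ₜb + (u·∇)b = ηΔb + (b·∇)u − ε∇×(j×b)`,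
`∂₁u₁ + ∂₂u₂ = 0`, `∂₁b₁ + ∂₂b₂ = 0`, where `j = ∇×b`. -/
structure IsHallMHDSolution (ν η ε : ℝ) (S : Set ℝ)
    (u b : ℝ → (Fin 2 → ℝ) → (Fin 3 → ℝ)) (π : ℝ → (Fin 2 → ℝ) → ℝ) : Prop where
  smooth_u : ContDiffOn ℝ (⊤ : ℕ∞) (fun p : ℝ × (Fin 2 → ℝ) => u p.1 p.2) (S ×ˢ Set.univ)
  smooth_b : ContDiffOn ℝ (⊤ : ℕ∞) (fun p : ℝ × (Fin 2 → ℝ) => b p.1 p.2) (S ×ˢ Set.univ)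
  smooth_pi : ContDiffOn ℝ (⊤ : ℕ∞) (fun p : ℝ × (Fin 2 → ℝ) => π p.1 p.2) (S ×ˢ Set.univ)
  schwartz_u : ∀ t ∈ S, IsSchwartz (u t)
  schwartz_b : ∀ t ∈ S, IsSchwartz (b t)
  schwartz_pi : ∀ t ∈ S, IsSchwartz (π t)
  div_u : ∀ t ∈ S, ∀ x, pd 0 (fun y => u t y 0) x + pd 1 (fun y => u t y 1) x = 0
  div_b : ∀ t ∈ S, ∀ x, pd 0 (fun y => b t y 0) x + pd 1 (fun y => b t y 1) x = 0
  momentum : ∀ t ∈ S, ∀ x, ∀ i : Fin 3,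
    deriv (fun s => u s x i) t + advect (u t) (u t) x i
        + ![pd 0 (π t) x, pd 1 (π t) x, 0] i
      = ν * lap (fun y => u t y i) x + advect (b t) (b t) x i
  induction : ∀ t ∈ S, ∀ x, ∀ i : Fin 3,
    deriv (fun s => b s x i) t + advect (u t) (b t) x i
      = η * lap (fun y => b t y i) x + advect (b t) (u t) x i
        - ε * curl (fun y => crossProduct (curl (b t) y) (b t y)) x i

/-- The `Hᵐ(ℝ²)` norm: `‖f‖_{Hᵐ} = (∑_{k=0}^{m} ∫ ‖Dᵏf(x)‖² dx)^{1/2}`. -/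
def hSobNorm (m : ℕ) (f : (Fin 2 → ℝ) → (Fin 3 → ℝ)) : ℝ :=
  Real.sqrt (∑ k ∈ Finset.range (m + 1), ∫ x, ‖iteratedFDeriv ℝ k f x‖ ^ 2)

end


set_option linter.unusedVariables false

section
/-- scalar Schwartz function, as a predicate -/
@[fun_prop]
def Sch (f : (Fin 2 → ℝ) → ℝ) : Prop := ∃ s : SchwartzMap (Fin 2 → ℝ) ℝ, ⇑s = f

namespace Sch
variable {f g : (Fin 2 → ℝ) → ℝ}

@[fun_prop]
theorem add (hf : Sch f) (hg : Sch g) : Sch (fun x => f x + g x) := by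
  obtain ⟨s, rfl⟩ := hf; obtain ⟨r, rfl⟩ := hg
  exact ⟨s + r, rfl⟩

@[fun_prop]
theorem sub (hf : Sch f) (hg : Sch g) : Sch (fun x => f x - g x) := by
  obtain ⟨s, rfl⟩ := hf; obtain ⟨r, rfl⟩ := hg
  exact ⟨s - r, rfl⟩

@[fun_prop]
theorem neg (hf : Sch f) : Sch (fun x => - f x) := by
  obtain ⟨s, rfl⟩ := hf
  exact ⟨-s, rfl⟩

@[fun_prop]
theorem const_mul (hf : Sch f) (c : ℝ) : Sch (fun x => c * f x) := by
  obtain ⟨s, rfl⟩ := hf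
  exact ⟨c • s, rfl⟩

theorem zero : Sch (fun _ => 0) := ⟨0, rfl⟩

@[fun_prop]
theorem mul (hf : Sch f) (hg : Sch g) : Sch (fun x => f x * g x) := by
  obtain ⟨s, rfl⟩ := hf; obtain ⟨r, rfl⟩ := hg
  exact ⟨SchwartzMap.pairing (ContinuousLinearMap.mul ℝ ℝ) s r, by ext x; simp⟩

@[fun_prop]
theorem pow_succ (hf : Sch f) (n : ℕ) : Sch (fun x => f x ^ (n + 1)) := by
  induction n with
  | zero => simpa using hf
  | succ n ih => simpa [_root_.pow_succ] using ih.mul hf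

theorem sq (hf : Sch f) : Sch (fun x => f x ^ 2) := hf.pow_succ 1

theorem sum {ι : Type*} (s : Finset ι) {F : ι → (Fin 2 → ℝ) → ℝ} (h : ∀ i ∈ s, Sch (F i)) :
    Sch (fun x => ∑ i ∈ s, F i x) := by
  classical
  induction s using Finset.induction_on with
  | empty => simpa using Sch.zero
  | insert a s ha ih =>
    simp only [Finset.sum_insert ha]
    exact (h a (by simp)).add (ih fun i hi => h i (by simp [hi]))

@[fun_prop]
theorem pd (hf : Sch f) (i : Fin 2) : Sch (pd i f) := by
  obtain ⟨s, rfl⟩ := hf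
  exact ⟨LineDeriv.lineDerivOp (Pi.single i 1 : Fin 2 → ℝ) s, by
    ext x; rw [SchwartzMap.lineDerivOp_apply_eq_fderiv]; rfl⟩

theorem contDiff (hf : Sch f) : ContDiff ℝ (⊤ : ℕ∞) f := by
  obtain ⟨s, rfl⟩ := hf; exact s.smooth ⊤

theorem differentiable (hf : Sch f) : Differentiable ℝ f :=
  hf.contDiff.differentiable (by simp)

theorem continuous (hf : Sch f) : Continuous f := hf.contDiff.continuous

theorem integrable (hf : Sch f) : Integrable f := by
  obtain ⟨s, rfl⟩ := hf; exact s.integrable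

theorem integral_pd (hf : Sch f) (i : Fin 2) : ∫ x, _root_.pd i f x = 0 := by
  have h := integral_bilinear_hasLineDerivAt_right_eq_neg_left_of_integrable
    (μ := (volume : Measure (Fin 2 → ℝ))) (f := f) (f' := _root_.pd i f)
    (g := fun _ => (1 : ℝ)) (g' := fun _ => (0 : ℝ)) (v := Pi.single i 1)
    (B := ContinuousLinearMap.mul ℝ ℝ)
    (by simpa using (hf.pd i).integrable) (by simp) (by simpa using hf.integrable)
    (fun x _ => (hf.differentiable x).hasFDerivAt.hasLineDerivAt _)
    (fun x _ => by
      have := (hasFDerivAt_const (𝕜 := ℝ) (1 : ℝ) x).hasLineDerivAt (Pi.single i (1 : ℝ))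
      simpa using this)
  simpa using h

theorem slice (hf : Sch f) (y : Fin 2 → ℝ) (i : Fin 2) :
    ∃ s : SchwartzMap ℝ ℝ, ∀ t, s t = f (Function.update y i t) := by
  obtain ⟨s, rfl⟩ := hf
  have hupd : ∀ t : ℝ, Function.update y i t =
      Function.update y i 0 + t • (Pi.single i 1 : Fin 2 → ℝ) := by
    intro t; ext j
    by_cases hj : j = i
    · subst hj; simp
    · simp [hj]
  have hg : Function.HasTemperateGrowth
      (fun t : ℝ => Function.update y i 0 + t • (Pi.single i 1 : Fin 2 → ℝ)) := by
    fun_prop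
  have hg' : AntilipschitzWith 1
      (fun t : ℝ => Function.update y i 0 + t • (Pi.single i 1 : Fin 2 → ℝ)) := by
    apply AntilipschitzWith.of_le_mul_dist
    intro a b
    have h1 : ‖(Pi.single i 1 : Fin 2 → ℝ)‖ = 1 := by rw [Pi.norm_single]; simp
    simp [dist_eq_norm, ← sub_smul, norm_smul, h1]
  refine ⟨SchwartzMap.compCLMOfAntilipschitz ℝ hg hg' s, fun t => ?_⟩
  exact congrArg s (hupd t).symm

theorem enorm_le_line (hf : Sch f) (y : Fin 2 → ℝ) (i : Fin 2) :
    ‖f y‖ₑ ≤ ∫⁻ t : ℝ, ‖_root_.pd i f (Function.update y i t)‖ₑ := by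
  obtain ⟨s, hs⟩ := hf.slice y i
  obtain ⟨s', hs'⟩ := (hf.pd i).slice y i
  have hd : ∀ t, HasDerivAt s (s' t) t := by
    intro t
    have h1 : HasDerivAt (fun t : ℝ => f (Function.update y i t)) (_root_.pd i f (Function.update y i t)) t := by
      have h2 := hasDerivAt_update y i t
      exact (hf.differentiable _).hasFDerivAt.comp_hasDerivAt t h2
    rw [hs']
    exact h1.congr_of_eventuallyEq (Filter.Eventually.of_forall hs)
  have hlim : Filter.Tendsto s Filter.atBot (nhds 0) := s.tendsto_cocompact.mono_left atBot_le_cocompact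
  have := integral_Iic_of_hasDerivAt_of_tendsto' (a := y i) (fun x _ => hd x) (s'.integrable.integrableOn) hlim
  have hy : f y = s (y i) := by rw [hs]; simp
  rw [hy, ← sub_zero (s (y i)), ← this]
  refine (enorm_integral_le_lintegral_enorm _).trans ?_
  refine (setLIntegral_le_lintegral _ _).trans ?_
  simp [hs']

/-- `‖F‖_{L²} ≤ ‖∇F‖_{L¹}` in two dimensions -/
theorem integral_sq_le (hf : Sch f) :
    ∫ x, f x ^ 2 ≤ (∫ x, (|_root_.pd 0 f x| + |_root_.pd 1 f x|)) ^ 2 := by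
  have hintg : Integrable (fun x => |_root_.pd 0 f x| + |_root_.pd 1 f x|) :=
    (hf.pd 0).integrable.abs.add (hf.pd 1).integrable.abs
  have h0 := lintegral_prod_lintegral_pow_le (fun _ : Fin 2 => (volume : Measure ℝ))
    (p := 2) (by simpa using Real.HolderConjugate.two_two)
    (f := fun x => ENNReal.ofReal (|_root_.pd 0 f x| + |_root_.pd 1 f x|))
    (by have := (hf.pd 0).continuous; have := (hf.pd 1).continuous; fun_prop)
  have h1 : ∫⁻ x, ENNReal.ofReal (f x ^ 2) ≤
      (∫⁻ x, ENNReal.ofReal (|_root_.pd 0 f x| + |_root_.pd 1 f x|)) ^ 2 := by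
    rw [← volume_pi] at h0
    have h0' := h0
    simp only [Fin.prod_univ_two, Fintype.card_fin] at h0'
    norm_num at h0'
    refine le_trans (lintegral_mono fun x => ?_) h0'
    have hx : ENNReal.ofReal (f x ^ 2) = ‖f x‖ₑ * ‖f x‖ₑ := by
      rw [← enorm_mul, Real.enorm_eq_ofReal_abs, ← _root_.sq, abs_of_nonneg (sq_nonneg _)]
    rw [hx]
    gcongr
    · refine (hf.enorm_le_line x 0).trans (lintegral_mono fun t => ?_)
      rw [Real.enorm_eq_ofReal_abs]
      apply ENNReal.ofReal_le_ofReal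
      linarith [abs_nonneg (_root_.pd 1 f (Function.update x 0 t))]
    · refine (hf.enorm_le_line x 1).trans (lintegral_mono fun t => ?_)
      rw [Real.enorm_eq_ofReal_abs]
      apply ENNReal.ofReal_le_ofReal
      linarith [abs_nonneg (_root_.pd 0 f (Function.update x 1 t))]
  rw [← ofReal_integral_eq_lintegral_ofReal hf.sq.integrable (Filter.Eventually.of_forall fun x => sq_nonneg _),
    ← ofReal_integral_eq_lintegral_ofReal hintg (Filter.Eventually.of_forall fun x => by positivity),
    ← ENNReal.ofReal_pow (integral_nonneg fun x => by positivity)] at h1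
  exact (ENNReal.ofReal_le_ofReal_iff (by positivity)).1 h1

/-- `‖f‖_∞ ≤ ‖∂₀∂₁ f‖_{L¹}` -/
theorem abs_le_integral (hf : Sch f) (y : Fin 2 → ℝ) :
    |f y| ≤ ∫ x, |_root_.pd 0 (_root_.pd 1 f) x| := by
  have hc := ((hf.pd 1).pd 0).continuous
  have h1 : ‖f y‖ₑ ≤ ∫⁻ x, ‖_root_.pd 0 (_root_.pd 1 f) x‖ₑ := by
    rw [← (volume_preserving_finTwoArrow ℝ).symm.lintegral_comp_emb
      (MeasurableEquiv.measurableEmbedding _), Measure.volume_eq_prod,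
      lintegral_prod_symm _ (by
        refine Measurable.aemeasurable ?_
        exact (hc.measurable.comp (MeasurableEquiv.measurable _)).enorm)]
    refine (hf.enorm_le_line y 1).trans (lintegral_mono fun t => ?_)
    refine ((hf.pd 1).enorm_le_line _ 0).trans (lintegral_mono fun s => ?_)
    apply le_of_eq
    congr 2
    ext j
    fin_cases j <;> simp [MeasurableEquiv.finTwoArrow]
  rw [Real.enorm_eq_ofReal_abs] at h1
  simp only [Real.enorm_eq_ofReal_abs] at h1
  rw [← ofReal_integral_eq_lintegral_ofReal ((hf.pd 1).pd 0).integrable.abs (Filter.Eventually.of_forall fun x => abs_nonneg _)] at h1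
  exact (ENNReal.ofReal_le_ofReal_iff (integral_nonneg fun x => abs_nonneg _)).1 h1

end Sch

section pdlemmas
variable {f g : (Fin 2 → ℝ) → ℝ}

theorem pd_add (hf : Sch f) (hg : Sch g) (i : Fin 2) :
    pd i (fun x => f x + g x) = fun x => pd i f x + pd i g x := by
  ext x; unfold pd
  rw [fderiv_fun_add (hf.differentiable x) (hg.differentiable x)]; rfl

theorem pd_sub (hf : Sch f) (hg : Sch g) (i : Fin 2) :
    pd i (fun x => f x - g x) = fun x => pd i f x - pd i g x := by
  ext x; unfold pd
  rw [fderiv_fun_sub (hf.differentiable x) (hg.differentiable x)]; rfl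

theorem pd_neg (i : Fin 2) :
    pd i (fun x => - f x) = fun x => - pd i f x := by
  ext x; unfold pd
  rw [fderiv_fun_neg]; rfl

theorem pd_const_mul (hf : Sch f) (c : ℝ) (i : Fin 2) :
    pd i (fun x => c * f x) = fun x => c * pd i f x := by
  ext x; unfold pd
  rw [fderiv_const_mul (hf.differentiable x)]; rfl

theorem pd_mul (hf : Sch f) (hg : Sch g) (i : Fin 2) :
    pd i (fun x => f x * g x) = fun x => pd i f x * g x + f x * pd i g x := by
  ext x; unfold pd
  rw [fderiv_fun_mul (hf.differentiable x) (hg.differentiable x)]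
  simp; ring

theorem pd_pow (hf : Sch f) (n : ℕ) (i : Fin 2) :
    pd i (fun x => f x ^ n) = fun x => n * f x ^ (n - 1) * pd i f x := by
  ext x; unfold pd
  rw [fderiv_fun_pow n (hf.differentiable x)]
  simp

theorem pd_comm (hf : Sch f) (i j : Fin 2) : pd i (pd j f) = pd j (pd i f) := by
  ext x
  have hs : IsSymmSndFDerivAt ℝ f x :=
    hf.contDiff.contDiffAt.isSymmSndFDerivAt (by simp; norm_cast)
  have hd : Differentiable ℝ (fderiv ℝ f) :=
    (hf.contDiff.fderiv_right (m := 1) (by norm_cast)).differentiable (by simp)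
  have key : ∀ i j : Fin 2, pd i (pd j f) x = fderiv ℝ (fderiv ℝ f) x (Pi.single i 1) (Pi.single j 1) := by
    intro i j
    unfold pd
    have : HasFDerivAt (fun x => fderiv ℝ f x (Pi.single j 1))
        ((fderiv ℝ (fderiv ℝ f) x).flip (Pi.single j 1)) x :=
      (hd x).hasFDerivAt.clm_apply (hasFDerivAt_const _ x) |>.congr_fderiv (by ext; simp)
    rw [this.fderiv]; rfl
  rw [key, key]
  exact hs _ _

end pdlemmas
end

section
theorem Sch.integrable_mul {f g : (Fin 2 → ℝ) → ℝ} (hf : Sch f) (hg : Sch g) :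
    Integrable (fun x => f x * g x) := (hf.mul hg).integrable

/-- squared L² norm -/
noncomputable def n2 (f : (Fin 2 → ℝ) → ℝ) : ℝ := ∫ x, f x ^ 2

theorem n2_nonneg (f : (Fin 2 → ℝ) → ℝ) : 0 ≤ n2 f := integral_nonneg fun _ => sq_nonneg _

/-- Cauchy-Schwarz with absolute values -/
theorem cs_abs {f g : (Fin 2 → ℝ) → ℝ} (hf : Sch f) (hg : Sch g) :
    ∫ x, |f x| * |g x| ≤ √(n2 f) * √(n2 g) := by
  have hpq : Real.HolderConjugate 2 2 := Real.HolderConjugate.two_two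
  have memf : MemLp (fun x => |f x|) (ENNReal.ofReal 2) := by
    have : MemLp f 2 := by obtain ⟨s, rfl⟩ := hf; exact s.memLp 2
    simp only [ENNReal.ofReal_ofNat]; exact this.abs
  have memg : MemLp (fun x => |g x|) (ENNReal.ofReal 2) := by
    have : MemLp g 2 := by obtain ⟨s, rfl⟩ := hg; exact s.memLp 2
    simp only [ENNReal.ofReal_ofNat]; exact this.abs
  have := integral_mul_le_Lp_mul_Lq_of_nonneg hpq
    (Filter.Eventually.of_forall fun x => abs_nonneg (f x))
    (Filter.Eventually.of_forall fun x => abs_nonneg (g x)) memf memg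
  simpa [n2, Real.sqrt_eq_rpow] using this

theorem cs_abs_mul {f g : (Fin 2 → ℝ) → ℝ} (hf : Sch f) (hg : Sch g) :
    ∫ x, |f x * g x| ≤ √(n2 f) * √(n2 g) := by
  simpa [abs_mul] using cs_abs hf hg

theorem cs_int {f g : (Fin 2 → ℝ) → ℝ} (hf : Sch f) (hg : Sch g) :
    |∫ x, f x * g x| ≤ √(n2 f) * √(n2 g) :=
  (abs_integral_le_integral_abs).trans (cs_abs_mul hf hg)

/-- squared L² norm of the gradient -/
noncomputable def g2 (f : (Fin 2 → ℝ) → ℝ) : ℝ := n2 (pd 0 f) + n2 (pd 1 f)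

theorem g2_nonneg (f : (Fin 2 → ℝ) → ℝ) : 0 ≤ g2 f := add_nonneg (n2_nonneg _) (n2_nonneg _)

theorem pow_step {f : (Fin 2 → ℝ) → ℝ} (hf : Sch f) (s : ℕ) :
    n2 (fun x => f x ^ (s + 2)) ≤ 2 * (s + 2) ^ 2 * n2 (fun x => f x ^ (s + 1)) * g2 f := by
  have hF : Sch (fun x => f x ^ (s + 2)) := hf.pow_succ (s + 1)
  have hF1 : Sch (fun x => f x ^ (s + 1)) := hf.pow_succ s
  have h := hF.integral_sq_le
  have hpt : ∀ i x, |pd i (fun x => f x ^ (s + 2)) x| = (s + 2) * |f x ^ (s + 1) * pd i f x| := by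
    intro i x
    rw [pd_pow hf]
    simp only [abs_mul]
    rw [abs_of_nonneg (by positivity : (0:ℝ) ≤ ((s + 2 : ℕ) : ℝ))]
    push_cast
    ring
  simp only [hpt] at h
  rw [integral_add ((hF1.mul (hf.pd 0)).integrable.abs.const_mul _)
    ((hF1.mul (hf.pd 1)).integrable.abs.const_mul _), integral_const_mul, integral_const_mul] at h
  have h0 := cs_abs_mul hF1 (hf.pd 0)
  have h1 := cs_abs_mul hF1 (hf.pd 1)
  set a := √(n2 fun x => f x ^ (s + 1)) with ha
  have ha2 : a ^ 2 = n2 fun x => f x ^ (s + 1) := Real.sq_sqrt (n2_nonneg _)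
  have hb2 : √(n2 (pd 0 f)) ^ 2 = n2 (pd 0 f) := Real.sq_sqrt (n2_nonneg _)
  have hc2 : √(n2 (pd 1 f)) ^ 2 = n2 (pd 1 f) := Real.sq_sqrt (n2_nonneg _)
  set b := √(n2 (pd 0 f))
  set c := √(n2 (pd 1 f))
  have e0 : 0 ≤ ∫ x, |f x ^ (s + 1) * pd 0 f x| := integral_nonneg fun x => abs_nonneg _
  have e1 : 0 ≤ ∫ x, |f x ^ (s + 1) * pd 1 f x| := integral_nonneg fun x => abs_nonneg _
  have ha0 : 0 ≤ a := Real.sqrt_nonneg _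
  have hb0 : 0 ≤ b := Real.sqrt_nonneg _
  have hc0 : 0 ≤ c := Real.sqrt_nonneg _
  calc n2 (fun x => f x ^ (s + 2)) ≤ _ := h
    _ ≤ (((s : ℝ) + 2) * (a * b) + (s + 2) * (a * c)) ^ 2 := by gcongr
    _ = (s + 2) ^ 2 * a ^ 2 * (b + c) ^ 2 := by ring
    _ ≤ (s + 2) ^ 2 * a ^ 2 * (2 * (b ^ 2 + c ^ 2)) := by
        gcongr; nlinarith [sq_nonneg (b - c)]
    _ = _ := by rw [ha2, hb2, hc2, g2]; ring

theorem pow_bound (s : ℕ) : ∃ K : ℝ, 0 ≤ K ∧ ∀ f, Sch f →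
    n2 (fun x => f x ^ (s + 1)) ≤ K * n2 f * g2 f ^ s := by
  induction s with
  | zero => exact ⟨1, by norm_num, fun f hf => by simp⟩
  | succ s ih =>
    obtain ⟨K, hK, h⟩ := ih
    refine ⟨2 * (s + 2) ^ 2 * K, by positivity, fun f hf => ?_⟩
    have h1 := pow_step hf s
    have h2 := h f hf
    have hg := g2_nonneg f
    calc _ ≤ _ := h1
      _ ≤ 2 * (s + 2) ^ 2 * (K * n2 f * g2 f ^ s) * g2 f := by gcongr
      _ = _ := by ring

/-- Ladyzhenskaya -/
theorem ladyzhenskaya {f : (Fin 2 → ℝ) → ℝ} (hf : Sch f) :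
    n2 (fun x => f x ^ 2) ≤ 8 * n2 f * g2 f := by
  have := pow_step hf 0
  norm_num at this
  exact this

theorem mul_l4 {f g : (Fin 2 → ℝ) → ℝ} (hf : Sch f) (hg : Sch g) :
    n2 (fun x => f x * g x) ≤ 8 * √(n2 f * g2 f) * √(n2 g * g2 g) := by
  have h1 := cs_int hf.sq hg.sq
  have h2 : n2 (fun x => f x * g x) = ∫ x, f x ^ 2 * g x ^ 2 := by
    simp [n2, mul_pow]
  rw [h2]
  refine (le_abs_self _).trans (h1.trans ?_)
  have := ladyzhenskaya hf
  have := ladyzhenskaya hg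
  calc _ ≤ √(8 * n2 f * g2 f) * √(8 * n2 g * g2 g) := by gcongr
    _ = (√8 * √8) * √(n2 f * g2 f) * √(n2 g * g2 g) := by
      rw [mul_assoc 8 (n2 f), mul_assoc 8 (n2 g), Real.sqrt_mul (by norm_num) (n2 f * g2 f),
        Real.sqrt_mul (by norm_num) (n2 g * g2 g)]; ring
    _ = _ := by rw [Real.mul_self_sqrt (by norm_num)]

theorem sup_bound {f : (Fin 2 → ℝ) → ℝ} (hf : Sch f) (y : Fin 2 → ℝ) :
    f y ^ 2 ≤ 2 * √(n2 (pd 0 f)) * √(n2 (pd 1 f)) + 2 * √(n2 f) * √(n2 (pd 0 (pd 1 f))) := by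
  have h := hf.sq.abs_le_integral y
  rw [abs_of_nonneg (sq_nonneg _)] at h
  refine h.trans ?_
  have e : ∀ x, |pd 0 (pd 1 fun x => f x ^ 2) x| ≤
      2 * |pd 0 f x * pd 1 f x| + 2 * |f x * pd 0 (pd 1 f) x| := by
    intro x
    rw [pd_pow hf]
    have : (fun x => ((2:ℕ):ℝ) * f x ^ (2 - 1) * pd 1 f x) = fun x => 2 * (f x * pd 1 f x) := by
      ext x; norm_num; ring
    rw [this, pd_const_mul (hf.mul (hf.pd 1)), pd_mul hf (hf.pd 1)]
    simp only [abs_mul (2 : ℝ), abs_two]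
    linarith [abs_add_le (pd 0 f x * pd 1 f x) (f x * pd 0 (pd 1 f) x)]
  have i1 := ((hf.pd 0).mul (hf.pd 1)).integrable.abs.const_mul 2
  have i2 := (hf.mul ((hf.pd 1).pd 0)).integrable.abs.const_mul 2
  refine (integral_mono ((hf.sq.pd 1).pd 0).integrable.abs (i1.add i2) e).trans ?_
  simp only [Pi.add_apply]
  rw [integral_add i1 i2, integral_const_mul, integral_const_mul]
  have h0 := cs_abs_mul (hf.pd 0) (hf.pd 1)
  have h1 := cs_abs_mul hf ((hf.pd 1).pd 0)
  linarith

/-- form bound for the critical weight -/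
theorem form_bound (p : ℝ≥0∞) (r : ℝ) (hp : 2 < p) (hr : 2 ≤ r)
    (hpr : 2 / p + 2 / ENNReal.ofReal r ≤ 1) (δ : ℝ) (hδ : 0 < δ) :
    ∃ C : ℝ, 0 ≤ C ∧ ∀ (W w g : (Fin 2 → ℝ) → ℝ), Sch w → Sch g → Continuous W →
      (∀ x, |w x| ≤ W x) → eLpNorm W p volume < ⊤ →
      n2 (fun x => w x * g x) ≤ δ * g2 g + C * (1 + (eLpNorm W p volume).toReal ^ r) * n2 g := by
  have hpowle : ∀ (A q : ℝ), 0 ≤ A → 0 ≤ q → q ≤ r → A ^ q ≤ 1 + A ^ r := by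
    intro A q hA hq hqr
    rcases le_total A 1 with h | h
    · have := Real.rpow_le_one hA h hq
      have := Real.rpow_nonneg hA r
      linarith
    · have := Real.rpow_le_rpow_of_exponent_le h hqr
      linarith
  by_cases hpt : p = ⊤
  · subst hpt
    refine ⟨1, zero_le_one, fun W w g hw hg hW hwW hfin => ?_⟩
    set A := (eLpNorm W ⊤ volume).toReal with hA
    have hA0 : 0 ≤ A := ENNReal.toReal_nonneg
    have hae : ∀ᵐ x, |w x| ≤ A := by
      have := ae_le_eLpNormEssSup (f := W) (μ := volume)
      filter_upwards [this] with x hx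
      rw [← eLpNorm_exponent_top] at hx
      have h2 := ENNReal.toReal_mono hfin.ne hx
      rw [toReal_enorm, Real.norm_eq_abs] at h2
      exact (hwW x).trans ((le_abs_self _).trans h2)
    have h1 : n2 (fun x => w x * g x) ≤ A ^ 2 * n2 g := by
      unfold n2
      rw [← integral_const_mul]
      refine integral_mono_ae (hw.mul hg).sq.integrable (hg.sq.integrable.const_mul _) ?_
      filter_upwards [hae] with x hx
      rw [mul_pow]
      have : w x ^ 2 ≤ A ^ 2 := by rw [← sq_abs]; gcongr
      gcongr
    have h2 := hpowle A 2 hA0 (by norm_num) hr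
    rw [Real.rpow_two] at h2
    have := mul_le_mul_of_nonneg_right h2 (n2_nonneg g)
    have := mul_nonneg hδ.le (g2_nonneg g)
    linarith
  -- finite exponent
  obtain ⟨P, rfl⟩ : ∃ P : ℝ, p = ENNReal.ofReal P := ⟨p.toReal, (ENNReal.ofReal_toReal hpt).symm⟩
  have hP2 : 2 < P := by
    have : (2 : ℝ≥0∞) = ENNReal.ofReal 2 := by simp
    rw [this] at hp
    exact (ENNReal.ofReal_lt_ofReal_iff_of_nonneg (by norm_num)).1 hp
  have hP0 : 0 < P := by linarith
  have hr0 : 0 < r := by linarith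
  set θ := 2 / P with hθ
  have hθ0 : 0 < θ := by positivity
  have hθr : θ + 2 / r ≤ 1 := by
    have e1 : (2 : ℝ≥0∞) = ENNReal.ofReal 2 := by simp
    rw [e1, ← ENNReal.ofReal_div_of_pos hP0, ← ENNReal.ofReal_div_of_pos hr0,
      ← ENNReal.ofReal_add (by positivity) (by positivity)] at hpr
    simpa using hpr
  have hθ1 : θ < 1 := by have : 0 < 2 / r := by positivity
                         linarith
  have h1θ : 0 < 1 - θ := by linarith
  obtain ⟨k, hk⟩ := exists_nat_ge (θ / (1 - θ))
  have hk0 : 0 < (k : ℝ) := lt_of_lt_of_le (by positivity) hk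
  obtain ⟨K, hK, hKb⟩ := pow_bound k
  set γ := θ / k with hγ
  have hγ0 : 0 < γ := by positivity
  set β := 1 - θ - γ with hβ
  have hβ0 : 0 ≤ β := by
    have : θ ≤ k * (1 - θ) := (div_le_iff₀ h1θ).1 hk
    have : γ ≤ 1 - θ := by rw [hγ, div_le_iff₀ hk0]; linarith
    linarith
  set q := 2 / (1 - θ) with hq
  have hqr : q ≤ r := by
    rw [hq, div_le_iff₀ h1θ]
    have : 2 / r ≤ 1 - θ := by linarith
    rw [div_le_iff₀ hr0] at this; linarith
  refine ⟨(K ^ γ * δ ^ (-θ)) ^ (1 / (1 - θ)), by positivity, fun W w g hw hg hW hwW hfin => ?_⟩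
  set A := (eLpNorm W (ENNReal.ofReal P) volume).toReal with hA
  have hA0 : 0 ≤ A := ENNReal.toReal_nonneg
  have hX := n2_nonneg g
  have hG := g2_nonneg g
  have hM := n2_nonneg (fun x => g x ^ (k + 1))
  -- Hoelder
  have hH : n2 (fun x => w x * g x) ≤ A ^ (2 : ℝ) * n2 g ^ β * n2 (fun x => g x ^ (k + 1)) ^ γ := by
    have key := ENNReal.lintegral_prod_norm_pow_le (μ := (volume : Measure (Fin 2 → ℝ))) (Finset.univ : Finset (Fin 3))
      (f := ![fun x => ‖W x‖ₑ ^ P, fun x => ENNReal.ofReal (g x ^ 2),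
        fun x => ENNReal.ofReal ((g x ^ (k + 1)) ^ 2)])
      (by
        have := hg.continuous
        intro i _
        fin_cases i
        · exact (hW.measurable.enorm.pow_const P).aemeasurable
        · exact (ENNReal.continuous_ofReal.comp (this.pow 2)).measurable.aemeasurable
        · exact (ENNReal.continuous_ofReal.comp ((this.pow (k + 1)).pow 2)).measurable.aemeasurable)
      (p := ![θ, β, γ]) (by simp [Fin.sum_univ_three, hβ]; ring) (by
        intro i _; fin_cases i <;> simp [hθ0.le, hβ0, hγ0.le])
    simp only [Fin.prod_univ_three, Matrix.cons_val_zero, Matrix.cons_val_one, Matrix.cons_val] at key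
    have e1 : (∫⁻ x, ‖W x‖ₑ ^ P) ^ θ = ENNReal.ofReal (A ^ (2 : ℝ)) := by
      have h1 := eLpNorm_eq_lintegral_rpow_enorm_toReal (μ := (volume : Measure (Fin 2 → ℝ))) (f := W) (p := ENNReal.ofReal P)
        (by simpa using hP0) (by simp)
      rw [ENNReal.toReal_ofReal hP0.le] at h1
      have h2 : (∫⁻ x, ‖W x‖ₑ ^ P) ^ θ = (eLpNorm W (ENNReal.ofReal P) volume) ^ (2 : ℝ) := by
        rw [h1, ← ENNReal.rpow_mul, hθ]; congr 1; ring
      rw [h2, hA, ENNReal.toReal_rpow, ENNReal.ofReal_toReal]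
      exact ENNReal.rpow_ne_top_of_nonneg (by norm_num) hfin.ne
    have e2 : (∫⁻ x, ENNReal.ofReal (g x ^ 2)) ^ β = ENNReal.ofReal (n2 g ^ β) := by
      rw [← ofReal_integral_eq_lintegral_ofReal hg.sq.integrable
        (Filter.Eventually.of_forall fun x => sq_nonneg _)]
      change ENNReal.ofReal (n2 g) ^ β = _
      rw [ENNReal.ofReal_rpow_of_nonneg hX hβ0]
    have e3 : (∫⁻ x, ENNReal.ofReal ((g x ^ (k + 1)) ^ 2)) ^ γ =
        ENNReal.ofReal (n2 (fun x => g x ^ (k + 1)) ^ γ) := by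
      rw [← ofReal_integral_eq_lintegral_ofReal (hg.pow_succ k).sq.integrable
        (Filter.Eventually.of_forall fun x => sq_nonneg _)]
      change ENNReal.ofReal (n2 (fun x => g x ^ (k + 1))) ^ γ = _
      rw [ENNReal.ofReal_rpow_of_nonneg hM hγ0.le]
    rw [e1, e2, e3, ← ENNReal.ofReal_mul (by positivity), ← ENNReal.ofReal_mul (by positivity)] at key
    have e4 : ENNReal.ofReal (n2 (fun x => w x * g x)) ≤
        ∫⁻ x, (‖W x‖ₑ ^ P) ^ θ * ENNReal.ofReal (g x ^ 2) ^ β *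
          ENNReal.ofReal ((g x ^ (k + 1)) ^ 2) ^ γ := by
      unfold n2
      rw [ofReal_integral_eq_lintegral_ofReal (hw.mul hg).sq.integrable
        (Filter.Eventually.of_forall fun x => sq_nonneg _)]
      refine lintegral_mono fun x => ?_
      have hWx : 0 ≤ W x := (abs_nonneg _).trans (hwW x)
      rw [Real.enorm_eq_ofReal_abs, ENNReal.ofReal_rpow_of_nonneg (abs_nonneg _) hP0.le,
        ENNReal.ofReal_rpow_of_nonneg (by positivity) hθ0.le,
        ENNReal.ofReal_rpow_of_nonneg (by positivity) hβ0,
        ENNReal.ofReal_rpow_of_nonneg (by positivity) hγ0.le,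
        ← ENNReal.ofReal_mul (by positivity), ← ENNReal.ofReal_mul (by positivity)]
      apply ENNReal.ofReal_le_ofReal
      have f1 : (|W x| ^ P) ^ θ = W x ^ 2 := by
        rw [← Real.rpow_mul (abs_nonneg _), hθ, mul_div_cancel₀ _ hP0.ne', Real.rpow_two, sq_abs]
      have f2 : (g x ^ 2) ^ β * ((g x ^ (k + 1)) ^ 2) ^ γ = g x ^ 2 := by
        have : (g x ^ (k + 1)) ^ 2 = (g x ^ 2) ^ ((k + 1 : ℕ) : ℝ) := by
          rw [Real.rpow_natCast]; ring
        rw [this, ← Real.rpow_mul (sq_nonneg _), ← Real.rpow_add_of_nonneg (sq_nonneg _) hβ0 (by positivity)]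
        have : β + ((k + 1 : ℕ) : ℝ) * γ = 1 := by
          rw [hβ, hγ]; push_cast; field_simp; ring
        rw [this, Real.rpow_one]
      rw [f1, mul_assoc, f2, mul_pow]
      have : w x ^ 2 ≤ W x ^ 2 := by rw [← sq_abs]; gcongr; exact hwW x
      gcongr
    exact (ENNReal.ofReal_le_ofReal_iff (by positivity)).1 (e4.trans key)
  have hM' : n2 (fun x => g x ^ (k + 1)) ^ γ ≤ K ^ γ * n2 g ^ γ * g2 g ^ θ := by
    calc _ ≤ (K * n2 g * g2 g ^ k) ^ γ := Real.rpow_le_rpow hM (hKb g hg) hγ0.le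
      _ = K ^ γ * n2 g ^ γ * g2 g ^ θ := by
        rw [Real.mul_rpow (by positivity) (by positivity), Real.mul_rpow hK hX,
          ← Real.rpow_natCast (g2 g) k, ← Real.rpow_mul hG]
        congr 2
        rw [hγ]; field_simp
  set a := (K ^ γ * δ ^ (-θ)) ^ (1 / (1 - θ)) with ha
  have ha0 : 0 ≤ a := by positivity
  have hfinal : A ^ (2 : ℝ) * n2 g ^ β * (K ^ γ * n2 g ^ γ * g2 g ^ θ) =
      (a * A ^ q * n2 g) ^ (1 - θ) * (δ * g2 g) ^ θ := by
    rw [Real.mul_rpow (by positivity) hX, Real.mul_rpow ha0 (by positivity), Real.mul_rpow hδ.le hG,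
      ha, ← Real.rpow_mul (by positivity), ← Real.rpow_mul hA0]
    have : 1 - θ = β + γ := by rw [hβ]; ring
    have e5 : n2 g ^ (1 - θ) = n2 g ^ β * n2 g ^ γ := by
      rw [this, Real.rpow_add_of_nonneg hX hβ0 hγ0.le]
    rw [e5, show 1 / (1 - θ) * (1 - θ) = 1 by field_simp, show q * (1 - θ) = 2 by rw [hq]; field_simp,
      Real.rpow_one, Real.rpow_neg hδ.le]
    have : δ ^ θ ≠ 0 := (Real.rpow_pos_of_pos hδ θ).ne'
    field_simp
  have hyoung := Real.geom_mean_le_arith_mean2_weighted h1θ.le hθ0.le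
    (show 0 ≤ a * A ^ q * n2 g by positivity) (show 0 ≤ δ * g2 g by positivity) (by ring)
  have hAq := hpowle A q hA0 (by positivity) hqr
  calc _ ≤ _ := hH
    _ ≤ A ^ (2 : ℝ) * n2 g ^ β * (K ^ γ * n2 g ^ γ * g2 g ^ θ) := by gcongr
    _ ≤ _ := hfinal.le.trans hyoung
    _ ≤ 1 * (a * A ^ q * n2 g) + 1 * (δ * g2 g) := by gcongr; linarith
    _ ≤ 1 * (a * (1 + A ^ r) * n2 g) + 1 * (δ * g2 g) := by gcongr
    _ = _ := by ring
end

section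
/-- iterated partial derivative along a word -/
noncomputable def pdl : List (Fin 2) → ((Fin 2 → ℝ) → ℝ) → (Fin 2 → ℝ) → ℝ
  | [], f => f
  | i :: l, f => pd i (pdl l f)

@[fun_prop]
theorem Sch.pdl {f : (Fin 2 → ℝ) → ℝ} (hf : Sch f) (l : List (Fin 2)) : Sch (pdl l f) := by
  induction l with
  | nil => exact hf
  | cons i l ih => exact ih.pd i

theorem pdl_append (l l' : List (Fin 2)) (f : (Fin 2 → ℝ) → ℝ) :
    pdl (l ++ l') f = pdl l (pdl l' f) := by
  induction l with
  | nil => rfl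
  | cons i l ih => simp [pdl, ih]

theorem pdl_concat (l : List (Fin 2)) (i : Fin 2) (f : (Fin 2 → ℝ) → ℝ) :
    pdl (l ++ [i]) f = pdl l (pd i f) := pdl_append l [i] f

section
variable {f g : (Fin 2 → ℝ) → ℝ}

theorem pdl_pd (hf : Sch f) (l : List (Fin 2)) (i : Fin 2) : pdl l (pd i f) = pd i (pdl l f) := by
  induction l with
  | nil => rfl
  | cons j l ih => simp only [pdl]; rw [ih, pd_comm (hf.pdl l)]

theorem pdl_add (hf : Sch f) (hg : Sch g) (l : List (Fin 2)) :
    pdl l (fun x => f x + g x) = fun x => pdl l f x + pdl l g x := by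
  induction l with
  | nil => rfl
  | cons j l ih => simp only [pdl]; rw [ih, pd_add (hf.pdl l) (hg.pdl l)]

theorem pdl_sub (hf : Sch f) (hg : Sch g) (l : List (Fin 2)) :
    pdl l (fun x => f x - g x) = fun x => pdl l f x - pdl l g x := by
  induction l with
  | nil => rfl
  | cons j l ih => simp only [pdl]; rw [ih, pd_sub (hf.pdl l) (hg.pdl l)]

theorem pdl_neg (l : List (Fin 2)) :
    pdl l (fun x => - f x) = fun x => - pdl l f x := by
  induction l with
  | nil => rfl
  | cons j l ih => simp only [pdl]; rw [ih, pd_neg]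

theorem pdl_const_mul (hf : Sch f) (c : ℝ) (l : List (Fin 2)) :
    pdl l (fun x => c * f x) = fun x => c * pdl l f x := by
  induction l with
  | nil => rfl
  | cons j l ih => simp only [pdl]; rw [ih, pd_const_mul (hf.pdl l)]

theorem n2_add_le (hf : Sch f) (hg : Sch g) :
    n2 (fun x => f x + g x) ≤ 2 * n2 f + 2 * n2 g := by
  unfold n2
  rw [← integral_const_mul, ← integral_const_mul,
    ← integral_add (hf.sq.integrable.const_mul _) (hg.sq.integrable.const_mul _)]
  refine integral_mono (hf.add hg).sq.integrable
    ((hf.sq.integrable.const_mul _).add (hg.sq.integrable.const_mul _)) fun x => ?_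
  nlinarith [sq_nonneg (f x - g x)]

theorem n2_neg : n2 (fun x => - f x) = n2 f := by simp [n2]

theorem n2_const_mul (c : ℝ) : n2 (fun x => c * f x) = c ^ 2 * n2 f := by
  simp only [n2, mul_pow, integral_const_mul]

theorem n2_sub_le (hf : Sch f) (hg : Sch g) :
    n2 (fun x => f x - g x) ≤ 2 * n2 f + 2 * n2 g := by
  have := n2_add_le hf hg.neg
  rw [n2_neg] at this
  simpa [sub_eq_add_neg] using this

end

theorem leib (l : List (Fin 2)) : ∀ (f g : (Fin 2 → ℝ) → ℝ) (B : ℝ), Sch f → Sch g →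
    (∀ β γ : List (Fin 2), β.length + γ.length = l.length →
      n2 (fun x => pdl β f x * pdl γ g x) ≤ B) →
    n2 (pdl l (fun x => f x * g x)) ≤ 4 ^ l.length * B := by
  induction l using List.reverseRecOn with
  | nil =>
    intro f g B hf hg h
    simpa [pdl] using h [] [] rfl
  | append_singleton l i ih =>
    intro f g B hf hg h
    rw [pdl_concat, pd_mul hf hg, pdl_add ((hf.pd i).mul hg) (hf.mul (hg.pd i))]
    refine (n2_add_le (((hf.pd i).mul hg).pdl l) ((hf.mul (hg.pd i)).pdl l)).trans ?_
    have h1 := ih (pd i f) g B (hf.pd i) hg (fun β γ hl => by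
      rw [← pdl_concat]; exact h _ _ (by simp; omega))
    have h2 := ih f (pd i g) B hf (hg.pd i) (fun β γ hl => by
      rw [← pdl_concat]; exact h _ _ (by simp; omega))
    simp only [List.length_append, List.length_cons, List.length_nil]
    rw [zero_add, pow_succ]; linarith

theorem leib_comm (l : List (Fin 2)) : ∀ (f g : (Fin 2 → ℝ) → ℝ) (B : ℝ), 0 ≤ B → Sch f → Sch g →
    (∀ β γ : List (Fin 2), β ≠ [] → β.length + γ.length = l.length →
      n2 (fun x => pdl β f x * pdl γ g x) ≤ B) →
    n2 (fun x => pdl l (fun x => f x * g x) x - f x * pdl l g x) ≤ 4 ^ l.length * B := by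
  induction l using List.reverseRecOn with
  | nil =>
    intro f g B hB hf hg h
    simpa [pdl, n2] using hB
  | append_singleton l i ih =>
    intro f g B hB hf hg h
    have e : (fun x => pdl (l ++ [i]) (fun x => f x * g x) x - f x * pdl (l ++ [i]) g x) =
      fun x => pdl l (fun x => pd i f x * g x) x +
        (pdl l (fun x => f x * pd i g x) x - f x * pdl l (pd i g) x) := by
      rw [pdl_concat, pdl_concat, pd_mul hf hg, pdl_add ((hf.pd i).mul hg) (hf.mul (hg.pd i))]
      ext x; ring
    rw [e]
    refine (n2_add_le (((hf.pd i).mul hg).pdl l)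
      (((hf.mul (hg.pd i)).pdl l).sub (hf.mul ((hg.pd i).pdl l)))).trans ?_
    have h1 := leib l (pd i f) g B (hf.pd i) hg (fun β γ hl => by
      rw [← pdl_concat]; exact h _ _ (by simp) (by simp; omega))
    have h2 := ih f (pd i g) B hB hf (hg.pd i) (fun β γ hβ hl => by
      rw [← pdl_concat]; exact h _ _ hβ (by simp; omega))
    simp only [List.length_append, List.length_cons, List.length_nil]
    rw [zero_add, pow_succ]; linarith

/-- all derivatives of order `k` have squared L² norm at most `e k` -/
structure Dom (f : (Fin 2 → ℝ) → ℝ) (e : ℕ → ℝ) : Prop where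
  sch : Sch f
  bd : ∀ l, n2 (pdl l f) ≤ e l.length

section
variable {f g : (Fin 2 → ℝ) → ℝ} {e : ℕ → ℝ}

theorem Dom.nonneg (h : Dom f e) (k : ℕ) : 0 ≤ e k := by
  have := h.bd (List.replicate k 0)
  rw [List.length_replicate] at this
  exact (n2_nonneg _).trans this

theorem Dom.g2_le (h : Dom f e) (l : List (Fin 2)) : g2 (pdl l f) ≤ 2 * e (l.length + 1) := by
  have h0 := h.bd (0 :: l)
  have h1 := h.bd (1 :: l)
  simp only [pdl, List.length_cons] at h0 h1
  unfold g2; linarith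

theorem prod_l4 (hf : Dom f e) (hg : Dom g e) (β γ : List (Fin 2)) :
    n2 (fun x => pdl β f x * pdl γ g x) ≤
      16 * √(e β.length * e (β.length + 1)) * √(e γ.length * e (γ.length + 1)) := by
  refine (mul_l4 (hf.sch.pdl β) (hg.sch.pdl γ)).trans ?_
  have aux : ∀ {f} (hf : Dom f e) (β : List (Fin 2)), √(n2 (pdl β f) * g2 (pdl β f)) ≤
      √2 * √(e β.length * e (β.length + 1)) := by
    intro f hf β
    rw [← Real.sqrt_mul (by norm_num)]
    apply Real.sqrt_le_sqrt
    have := mul_le_mul (hf.bd β) (hf.g2_le β) (g2_nonneg _) (hf.nonneg _)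
    linarith
  have h1 := aux hf β
  have h2 := aux hg γ
  have h3 := mul_le_mul h1 h2 (Real.sqrt_nonneg _) (by positivity)
  have : √2 * √2 = (2:ℝ) := Real.mul_self_sqrt (by norm_num)
  calc _ = 8 * (√(n2 (pdl β f) * g2 (pdl β f)) * √(n2 (pdl γ g) * g2 (pdl γ g))) := by ring
    _ ≤ 8 * (√2 * √(e β.length * e (β.length + 1)) * (√2 * √(e γ.length * e (γ.length + 1)))) := by
      gcongr
    _ = 8 * (√2 * √2) * √(e β.length * e (β.length + 1)) * √(e γ.length * e (γ.length + 1)) := by ring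
    _ = _ := by rw [this]; ring

theorem Dom.sup (h : Dom f e) (l : List (Fin 2)) (y : Fin 2 → ℝ) :
    pdl l f y ^ 2 ≤ 2 * e (l.length + 1) + 2 * √(e l.length * e (l.length + 2)) := by
  refine (sup_bound (h.sch.pdl l) y).trans ?_
  have h0 := Real.sqrt_le_sqrt (h.bd (0 :: l))
  have h1 := Real.sqrt_le_sqrt (h.bd (1 :: l))
  have h2 := Real.sqrt_le_sqrt (h.bd l)
  have h3 := Real.sqrt_le_sqrt (h.bd (0 :: 1 :: l))
  simp only [pdl, List.length_cons, add_assoc, Nat.reduceAdd] at h0 h1 h2 h3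
  have e1 := mul_le_mul h0 h1 (Real.sqrt_nonneg _) (Real.sqrt_nonneg _)
  have e2 := mul_le_mul h2 h3 (Real.sqrt_nonneg _) (Real.sqrt_nonneg _)
  rw [Real.mul_self_sqrt (h.nonneg _)] at e1
  rw [← Real.sqrt_mul (h.nonneg _)] at e2
  linarith

theorem n2_mul_le_sup {S : ℝ} (hf : Sch f) (hg : Sch g) (h : ∀ y, f y ^ 2 ≤ S) :
    n2 (fun x => f x * g x) ≤ S * n2 g := by
  unfold n2
  rw [← integral_const_mul]
  refine integral_mono (hf.mul hg).sq.integrable (hg.sq.integrable.const_mul _) fun x => ?_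
  simp only [mul_pow]
  exact mul_le_mul_of_nonneg_right (h x) (sq_nonneg _)

theorem prod_sup (hf : Dom f e) (hg : Dom g e) (β γ : List (Fin 2)) :
    n2 (fun x => pdl β f x * pdl γ g x) ≤
      (2 * e (β.length + 1) + 2 * √(e β.length * e (β.length + 2))) * e γ.length := by
  refine (n2_mul_le_sup (hf.sch.pdl β) (hg.sch.pdl γ) (hf.sup β)).trans ?_
  have := hf.nonneg (β.length + 1)
  exact mul_le_mul_of_nonneg_left (hg.bd γ) (by positivity)

theorem sqrt_mul_le {a b : ℝ} (ha : 0 ≤ a) (hb : 0 ≤ b) : 2 * √(a * b) ≤ a + b := by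
  have h := Real.sqrt_le_sqrt (show a * b ≤ ((a + b) / 2) ^ 2 by nlinarith [sq_nonneg (a - b)])
  rw [Real.sqrt_sq (by positivity)] at h
  linarith

theorem prod_high (hf : Dom f e) (hg : Dom g e) (k : ℕ) (hk : 3 ≤ k) (K : ℝ) (hK : 1 ≤ K)
    (he : ∀ j < k, e j ≤ K) (β γ : List (Fin 2)) (hβ : β.length ≤ k) (hγ : γ.length ≤ k)
    (hs : β.length + γ.length ≤ k + 1) :
    n2 (fun x => pdl β f x * pdl γ g x) ≤ 16 * K ^ 2 * (1 + e 3) * (1 + e k) := by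
  have he0 := hf.nonneg
  have hek : ∀ j ≤ k, e j ≤ K * (1 + e k) := by
    intro j hj
    have := he0 k
    rcases hj.lt_or_eq with h | rfl
    · have := he j h; nlinarith
    · nlinarith
  have key : ∀ i ≤ 1, ∀ j ≤ k, (2 * e (i + 1) + 2 * √(e i * e (i + 2))) * e j ≤
      16 * K ^ 2 * (1 + e 3) * (1 + e k) := by
    intro i hi j hj
    have h1 : 2 * e (i + 1) + 2 * √(e i * e (i + 2)) ≤ 16 * K * (1 + e 3) := by
      have h := sqrt_mul_le (he0 i) (he0 (i + 2))
      have := he0 3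
      interval_cases i
      · have := he 0 (by omega); have := he 1 (by omega); have := he 2 (by omega)
        simp only [zero_add] at *
        nlinarith
      · have := he 1 (by omega); have := he 2 (by omega)
        simp only [Nat.reduceAdd] at *
        nlinarith
    have := he0 3
    have := he0 k
    calc _ ≤ (16 * K * (1 + e 3)) * (K * (1 + e k)) :=
          mul_le_mul h1 (hek j hj) (he0 _) (by positivity)
      _ = _ := by ring
  by_cases h1 : β.length ≤ 1
  · exact (prod_sup hf hg β γ).trans (key _ h1 _ hγ)
  by_cases h2 : γ.length ≤ 1
  · have : (fun x => pdl β f x * pdl γ g x) = fun x => pdl γ g x * pdl β f x := by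
      ext x; ring
    rw [this]
    exact (prod_sup hg hf γ β).trans (key _ h2 _ hβ)
  · refine (prod_l4 hf hg β γ).trans ?_
    have a1 := he β.length (by omega)
    have a2 := hek (β.length + 1) (by omega)
    have a3 := he γ.length (by omega)
    have a4 := hek (γ.length + 1) (by omega)
    have b1 := Real.sqrt_le_sqrt (mul_le_mul a1 a2 (he0 _) (by linarith))
    have b2 := Real.sqrt_le_sqrt (mul_le_mul a3 a4 (he0 _) (by linarith))
    have b3 := mul_le_mul b1 b2 (Real.sqrt_nonneg _) (Real.sqrt_nonneg _)
    have := he0 3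
    have := he0 k
    rw [Real.mul_self_sqrt (by positivity)] at b3
    have : 0 ≤ 16 * (K * (K * (1 + e k))) * e 3 := by positivity
    nlinarith

theorem young_sqrt {δ a b : ℝ} (hδ : 0 < δ) (ha : 0 ≤ a) (hb : 0 ≤ b) :
    √(a * b) ≤ δ * b + a / δ := by
  have h := sqrt_mul_le (a := a / δ) (b := δ * b) (by positivity) (by positivity)
  have : a / δ * (δ * b) = a * b := by field_simp
  rw [this] at h
  have : 0 ≤ a / δ := by positivity
  have : 0 ≤ δ * b := by positivity
  linarith

theorem prod_one (hf : Dom f e) (hg : Dom g e) (K δ : ℝ) (hδ : 0 < δ)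
    (he : e 0 ≤ K) (β γ : List (Fin 2)) (hs : β.length + γ.length = 1) :
    n2 (fun x => pdl β f x * pdl γ g x) ≤ δ * e 2 + 256 * K / δ * e 1 ^ 2 := by
  have he0 := hf.nonneg
  have h : n2 (fun x => pdl β f x * pdl γ g x) ≤ 16 * √(e 0 * e 1) * √(e 1 * e 2) := by
    have := prod_l4 hf hg β γ
    obtain ⟨h1, h2⟩ | ⟨h1, h2⟩ : (β.length = 0 ∧ γ.length = 1) ∨ (β.length = 1 ∧ γ.length = 0) := by
      omega
    · rw [h1, h2] at this; exact this
    · rw [h1, h2] at this; refine this.trans (le_of_eq ?_); norm_num; ring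
  have e1 : 16 * √(e 0 * e 1) * √(e 1 * e 2) = √((256 * e 0 * e 1 ^ 2) * e 2) := by
    rw [mul_assoc, ← Real.sqrt_mul (mul_nonneg (he0 0) (he0 1)), show (16 : ℝ) = √(16 ^ 2) by norm_num,
      ← Real.sqrt_mul (by norm_num)]
    congr 1; ring
  rw [e1] at h
  refine h.trans ((young_sqrt hδ (by have := he0 0; positivity) (he0 2)).trans ?_)
  rw [div_mul_eq_mul_div]
  gcongr

theorem prod_two (hf : Dom f e) (hg : Dom g e) (K δ : ℝ) (hK : 1 ≤ K) (hδ : 0 < δ)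
    (he : e 0 ≤ K) (he1 : e 1 ≤ K) (β γ : List (Fin 2)) (hβ : β.length ≤ 2) (hγ : γ.length ≤ 2)
    (hs : β.length + γ.length = 2 ∨ β.length + γ.length = 3) :
    n2 (fun x => pdl β f x * pdl γ g x) ≤
      δ * e 3 + (256 * K ^ 2 / δ + 16 * K) * (1 + e 2) * e 2 := by
  have he0 := hf.nonneg
  have q0 := he0 0
  have q1 := he0 1
  have q2 := he0 2
  have q3 := he0 3
  have hKd : 0 ≤ 256 * K ^ 2 / δ := by positivity
  have c02 : 16 * √(e 0 * e 1) * √(e 2 * e 3) ≤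
      δ * e 3 + (256 * K ^ 2 / δ + 16 * K) * (1 + e 2) * e 2 := by
    have e1 : 16 * √(e 0 * e 1) * √(e 2 * e 3) = √((256 * e 0 * e 1 * e 2) * e 3) := by
      rw [mul_assoc, ← Real.sqrt_mul (mul_nonneg (he0 0) (he0 1)), show (16 : ℝ) = √(16 ^ 2) by norm_num,
        ← Real.sqrt_mul (by norm_num)]
      congr 1; ring
    rw [e1]
    refine (young_sqrt hδ (by positivity) q3).trans ?_
    have : 256 * e 0 * e 1 * e 2 / δ ≤ 256 * K ^ 2 / δ * e 2 := by
      rw [div_mul_eq_mul_div, mul_assoc 256, sq]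
      have : e 0 * e 1 ≤ K * K := by gcongr
      gcongr
    nlinarith [mul_nonneg hKd (mul_nonneg q2 q2), mul_nonneg (by linarith : 0 ≤ K) (mul_nonneg q2 q2), mul_nonneg (by linarith : 0 ≤ K) q2]
  have c12 : 16 * √(e 1 * e 2) * √(e 2 * e 3) ≤
      δ * e 3 + (256 * K ^ 2 / δ + 16 * K) * (1 + e 2) * e 2 := by
    have e1 : 16 * √(e 1 * e 2) * √(e 2 * e 3) = √((256 * e 1 * e 2 ^ 2) * e 3) := by
      rw [mul_assoc, ← Real.sqrt_mul (mul_nonneg (he0 1) (he0 2)), show (16 : ℝ) = √(16 ^ 2) by norm_num,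
        ← Real.sqrt_mul (by norm_num)]
      congr 1; ring
    rw [e1]
    refine (young_sqrt hδ (by positivity) q3).trans ?_
    have : 256 * e 1 * e 2 ^ 2 / δ ≤ 256 * K ^ 2 / δ * e 2 ^ 2 := by
      rw [div_mul_eq_mul_div]
      gcongr
      nlinarith
    nlinarith [mul_nonneg hKd q2, mul_nonneg (by linarith : 0 ≤ K) (mul_nonneg q2 q2), mul_nonneg (by linarith : 0 ≤ K) q2]
  have c11 : 16 * √(e 1 * e 2) * √(e 1 * e 2) ≤
      δ * e 3 + (256 * K ^ 2 / δ + 16 * K) * (1 + e 2) * e 2 := by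
    rw [mul_assoc, Real.mul_self_sqrt (by positivity)]
    nlinarith [mul_nonneg hKd q2, mul_nonneg hKd (mul_nonneg q2 q2), mul_nonneg (by linarith : 0 ≤ K) (mul_nonneg q2 q2), mul_nonneg hδ.le q3]
  have h := prod_l4 hf hg β γ
  obtain ⟨h1, h2⟩ | ⟨h1, h2⟩ | ⟨h1, h2⟩ | ⟨h1, h2⟩ | ⟨h1, h2⟩ :
      (β.length = 0 ∧ γ.length = 2) ∨ (β.length = 2 ∧ γ.length = 0) ∨
      (β.length = 1 ∧ γ.length = 1) ∨ (β.length = 1 ∧ γ.length = 2) ∨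
      (β.length = 2 ∧ γ.length = 1) := by omega
  all_goals rw [h1, h2] at h; norm_num at h; refine h.trans ?_
  · exact c02
  · rw [mul_right_comm]; exact c02
  · exact c11
  · exact c12
  · rw [mul_right_comm]; exact c12

end
end

section
attribute [fun_prop] Sch.sq


/-- cutoff functions -/
structure Cut (χ : (Fin 2 → ℝ) → ℝ) (κ : ℝ) : Prop where
  mul : ∀ f, Sch f → Sch (fun x => χ x * f x)
  dmul : ∀ f i, Sch f → Sch (fun x => pd i χ x * f x)
  diff : Differentiable ℝ χ
  le : ∀ x, χ x ^ 2 ≤ 1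
  dle : ∀ i x, |pd i χ x| ≤ κ

theorem Cut.one : Cut (fun _ => 1) 0 where
  mul f hf := by simpa using hf
  dmul f i hf := by
    have : (fun x => pd i (fun _ => (1 : ℝ)) x * f x) = fun _ => 0 := by
      ext x; simp [pd]
    rw [this]; exact Sch.zero
  diff := differentiable_const _
  le x := by norm_num
  dle i x := by simp [pd]

theorem Cut.of_sch {χ : (Fin 2 → ℝ) → ℝ} {κ : ℝ} (h : Sch χ) (le : ∀ x, χ x ^ 2 ≤ 1)
    (dle : ∀ i x, |pd i χ x| ≤ κ) : Cut χ κ where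
  mul _ hf := h.mul hf
  dmul _ i hf := (h.pd i).mul hf
  diff := h.differentiable
  le := le
  dle := dle

section
variable {χ : (Fin 2 → ℝ) → ℝ} {κ : ℝ} {f g : (Fin 2 → ℝ) → ℝ}

theorem Cut.kappa_nonneg (hc : Cut χ κ) : 0 ≤ κ := (abs_nonneg _).trans (hc.dle 0 0)

theorem Cut.mul2 (hc : Cut χ κ) (hf : Sch f) : Sch (fun x => χ x ^ 2 * f x) := by
  have := hc.mul _ (hc.mul _ hf)
  have e : (fun x => χ x ^ 2 * f x) = fun x => χ x * (χ x * f x) := by ext x; ring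
  rw [e]; exact this

theorem Cut.pd_mul (hc : Cut χ κ) (hf : Sch f) (i : Fin 2) :
    pd i (fun x => χ x * f x) = fun x => pd i χ x * f x + χ x * pd i f x := by
  ext x; unfold pd
  rw [fderiv_fun_mul (hc.diff x) (hf.differentiable x)]
  simp; ring

theorem Cut.pd_mul2 (hc : Cut χ κ) (hf : Sch f) (i : Fin 2) (x : Fin 2 → ℝ) :
    pd i (fun x => χ x ^ 2 * f x) x = 2 * χ x * pd i χ x * f x + χ x ^ 2 * pd i f x := by
  have e : (fun x => χ x ^ 2 * f x) = fun x => χ x * (χ x * f x) := by ext x; ring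
  rw [e, hc.pd_mul (hc.mul _ hf), hc.pd_mul hf]; ring

theorem Cut.int_le (hc : Cut χ κ) (hf : Sch f) (h0 : ∀ x, 0 ≤ f x) : ∫ x, χ x ^ 2 * f x ≤ ∫ x, f x := by
  refine integral_mono (hc.mul2 hf).integrable hf.integrable fun x => ?_
  have := hc.le x
  have := h0 x
  simp only
  nlinarith

end

theorem int_le_of_div {G R h0 h1 : (Fin 2 → ℝ) → ℝ} (hG : Integrable G) (hR : Integrable R)
    (hh0 : Sch h0) (hh1 : Sch h1) (h : ∀ x, G x ≤ pd 0 h0 x + pd 1 h1 x + R x) :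
    ∫ x, G x ≤ ∫ x, R x := by
  have i01 : Integrable (fun x => pd 0 h0 x + pd 1 h1 x) :=
    (hh0.pd 0).integrable.add (hh1.pd 1).integrable
  have := integral_mono hG (i01.add hR) h
  rw [integral_add' i01 hR, integral_add (hh0.pd 0).integrable (hh1.pd 1).integrable,
    hh0.integral_pd, hh1.integral_pd] at this
  linarith

theorem young_cut {χ κ f d q : ℝ} (hd : |d| ≤ κ) :
    -(2 * χ * d * (f * q)) ≤ κ * (f ^ 2 + χ ^ 2 * q ^ 2) := by
  have h1 : -(2 * χ * d * (f * q)) ≤ |d| * (2 * |f| * |χ * q|) := by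
    refine (neg_le_abs _).trans (le_of_eq ?_)
    simp only [abs_mul, abs_two]; ring
  have h2 : 2 * |f| * |χ * q| ≤ f ^ 2 + χ ^ 2 * q ^ 2 := by
    have := two_mul_le_add_sq |f| |χ * q|
    rw [sq_abs, sq_abs, mul_pow] at this
    exact this
  exact h1.trans (mul_le_mul hd h2 (by positivity) ((abs_nonneg _).trans hd))

theorem scal {χ : (Fin 2 → ℝ) → ℝ} {κ : ℝ} (hc : Cut χ κ) {f p q : (Fin 2 → ℝ) → ℝ}
    (hf : Sch f) (hp : Sch p) (hq : Sch q) (μ : ℝ) :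
    ∫ x, χ x ^ 2 * (f x * (μ * lap f x - pd 0 p x - pd 1 q x)) ≤
    ∫ x, (χ x ^ 2 * (- μ * (pd 0 f x ^ 2 + pd 1 f x ^ 2) + (pd 0 f x * p x + pd 1 f x * q x)
        + κ * (2 * μ ^ 2 * (pd 0 f x ^ 2 + pd 1 f x ^ 2) + 2 * (p x ^ 2 + q x ^ 2)))
      + κ * (2 * f x ^ 2)) := by
  have s0 : Sch (fun x => μ * pd 0 f x - p x) := by fun_prop
  have s1 : Sch (fun x => μ * pd 1 f x - q x) := by fun_prop
  have hl : Sch (lap f) := by unfold lap; fun_prop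
  refine int_le_of_div (hc.mul2 (by fun_prop)).integrable
    ((hc.mul2 (by fun_prop)).integrable.add (by fun_prop : Sch _).integrable)
    (hc.mul2 (hf.mul s0)) (hc.mul2 (hf.mul s1)) fun x => ?_
  rw [hc.pd_mul2 (hf.mul s0), hc.pd_mul2 (hf.mul s1), pd_mul hf s0, pd_mul hf s1,
    pd_sub (by fun_prop) hp, pd_sub (by fun_prop) hq, pd_const_mul (by fun_prop),
    pd_const_mul (by fun_prop)]
  have y0 := young_cut (χ := χ x) (f := f x) (q := μ * pd 0 f x - p x) (hc.dle 0 x)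
  have y1 := young_cut (χ := χ x) (f := f x) (q := μ * pd 1 f x - q x) (hc.dle 1 x)
  have hk := hc.kappa_nonneg
  have z0 : κ * (χ x ^ 2 * (μ * pd 0 f x - p x) ^ 2) ≤
      κ * (χ x ^ 2 * (2 * μ ^ 2 * pd 0 f x ^ 2 + 2 * p x ^ 2)) := by
    gcongr
    nlinarith [sq_nonneg (μ * pd 0 f x + p x)]
  have z1 : κ * (χ x ^ 2 * (μ * pd 1 f x - q x) ^ 2) ≤
      κ * (χ x ^ 2 * (2 * μ ^ 2 * pd 1 f x ^ 2 + 2 * q x ^ 2)) := by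
    gcongr
    nlinarith [sq_nonneg (μ * pd 1 f x + q x)]
  simp only [lap]
  linarith
end

section
noncomputable section

theorem Cut.int_add {χ : (Fin 2 → ℝ) → ℝ} {κ : ℝ} (hc : Cut χ κ) {f g : (Fin 2 → ℝ) → ℝ}
    (hf : Sch f) (hg : Sch g) :
    (∫ x, χ x ^ 2 * f x) + ∫ x, χ x ^ 2 * g x = ∫ x, χ x ^ 2 * (f x + g x) := by
  rw [← integral_add (hc.mul2 hf).integrable (hc.mul2 hg).integrable]
  simp only [mul_add]

def gr (f : (Fin 2 → ℝ) → ℝ) (x : Fin 2 → ℝ) : ℝ := pd 0 f x ^ 2 + pd 1 f x ^ 2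

theorem gr_nonneg (f : (Fin 2 → ℝ) → ℝ) (x : Fin 2 → ℝ) : 0 ≤ gr f x := by
  unfold gr; positivity

@[fun_prop]
theorem Sch.gr {f : (Fin 2 → ℝ) → ℝ} (hf : Sch f) : Sch (gr f) := by
  unfold _root_.gr; fun_prop

@[fun_prop]
theorem Sch.lap {f : (Fin 2 → ℝ) → ℝ} (hf : Sch f) : Sch (lap f) := by
  unfold _root_.lap; fun_prop

def Hu (u b : Fin 3 → (Fin 2 → ℝ) → ℝ) (i j : Fin 3) : (Fin 2 → ℝ) → ℝ :=
  fun x => u j x * u i x - b j x * b i x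

def Hb (u b : Fin 3 → (Fin 2 → ℝ) → ℝ) (i j : Fin 3) : (Fin 2 → ℝ) → ℝ :=
  fun x => u j x * b i x - b j x * u i x

def cu (b : Fin 3 → (Fin 2 → ℝ) → ℝ) : Fin 3 → (Fin 2 → ℝ) → ℝ :=
  ![pd 1 (b 2), fun x => - pd 0 (b 2) x, fun x => pd 0 (b 1) x - pd 1 (b 0) x]

def cr (a b : Fin 3 → (Fin 2 → ℝ) → ℝ) : Fin 3 → (Fin 2 → ℝ) → ℝ :=
  ![fun x => a 1 x * b 2 x - a 2 x * b 1 x, fun x => a 2 x * b 0 x - a 0 x * b 2 x,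
    fun x => a 0 x * b 1 x - a 1 x * b 0 x]

def gp (P : (Fin 2 → ℝ) → ℝ) : Fin 3 → (Fin 2 → ℝ) → ℝ := ![pd 0 P, pd 1 P, fun _ => 0]

theorem Sch.Hu {u b : Fin 3 → (Fin 2 → ℝ) → ℝ} (hu : ∀ i, Sch (u i)) (hb : ∀ i, Sch (b i))
    (i j : Fin 3) : Sch (Hu u b i j) := ((hu j).mul (hu i)).sub ((hb j).mul (hb i))

theorem Sch.Hb {u b : Fin 3 → (Fin 2 → ℝ) → ℝ} (hu : ∀ i, Sch (u i)) (hb : ∀ i, Sch (b i))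
    (i j : Fin 3) : Sch (Hb u b i j) := ((hu j).mul (hb i)).sub ((hb j).mul (hu i))

theorem Sch.cu {b : Fin 3 → (Fin 2 → ℝ) → ℝ} (hb : ∀ i, Sch (b i)) (i : Fin 3) :
    Sch (cu b i) := by
  fin_cases i
  · exact (hb 2).pd 1
  · exact ((hb 2).pd 0).neg
  · exact ((hb 1).pd 0).sub ((hb 0).pd 1)

theorem Sch.cr {a b : Fin 3 → (Fin 2 → ℝ) → ℝ} (ha : ∀ i, Sch (a i)) (hb : ∀ i, Sch (b i))
    (i : Fin 3) : Sch (cr a b i) := by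
  fin_cases i
  · exact ((ha 1).mul (hb 2)).sub ((ha 2).mul (hb 1))
  · exact ((ha 2).mul (hb 0)).sub ((ha 0).mul (hb 2))
  · exact ((ha 0).mul (hb 1)).sub ((ha 1).mul (hb 0))

theorem Sch.gp {P : (Fin 2 → ℝ) → ℝ} (hP : Sch P) (i : Fin 3) : Sch (gp P i) := by
  fin_cases i
  · exact hP.pd 0
  · exact hP.pd 1
  · exact Sch.zero

/-- the equations at a fixed time -/
structure Snap (ν η ε : ℝ) (u b : Fin 3 → (Fin 2 → ℝ) → ℝ) (P : (Fin 2 → ℝ) → ℝ)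
    (Ut Bt : Fin 3 → (Fin 2 → ℝ) → ℝ) : Prop where
  hu : ∀ i, Sch (u i)
  hb : ∀ i, Sch (b i)
  hP : Sch P
  du : ∀ x, pd 0 (u 0) x + pd 1 (u 1) x = 0
  db : ∀ x, pd 0 (b 0) x + pd 1 (b 1) x = 0
  eqU : ∀ i, Ut i = fun x => ν * lap (u i) x - pd 0 (Hu u b i 0) x - pd 1 (Hu u b i 1) x
    - gp P i x
  eqB : ∀ i, Bt i = fun x => η * lap (b i) x - pd 0 (Hb u b i 0) x - pd 1 (Hb u b i 1) x
    - ε * cu (cr (cu b) b) i x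
  dU : ∀ x, pd 0 (Ut 0) x + pd 1 (Ut 1) x = 0

theorem pdl_flux {f p q : (Fin 2 → ℝ) → ℝ} (hf : Sch f) (hp : Sch p) (hq : Sch q) (μ : ℝ)
    (α : List (Fin 2)) :
    pdl α (fun x => μ * lap f x - pd 0 p x - pd 1 q x) =
      fun x => μ * lap (pdl α f) x - pd 0 (pdl α p) x - pd 1 (pdl α q) x := by
  rw [pdl_sub (by fun_prop) (by fun_prop), pdl_sub (by fun_prop) (by fun_prop),
    pdl_const_mul (by fun_prop), pdl_pd hp, pdl_pd hq]
  have : pdl α (lap f) = lap (pdl α f) := by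
    have e : lap f = fun x => pd 0 (pd 0 f) x + pd 1 (pd 1 f) x := rfl
    rw [e, pdl_add (by fun_prop) (by fun_prop), pdl_pd (hf.pd 0), pdl_pd (hf.pd 1),
      pdl_pd hf, pdl_pd hf]
    rfl
  rw [this]

/-- Hall commutator -/
def Ka (b : Fin 3 → (Fin 2 → ℝ) → ℝ) (α : List (Fin 2)) (i : Fin 3) : (Fin 2 → ℝ) → ℝ :=
  fun x => pdl α (cr (cu b) b i) x - cr (cu (fun i => pdl α (b i))) b i x

theorem Sch.Ka {b : Fin 3 → (Fin 2 → ℝ) → ℝ} (hb : ∀ i, Sch (b i)) (α : List (Fin 2)) (i : Fin 3) :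
    Sch (Ka b α i) :=
  ((Sch.cr (Sch.cu hb) hb i).pdl α).sub (Sch.cr (Sch.cu fun i => (hb i).pdl α) hb i)

def RS (χ : (Fin 2 → ℝ) → ℝ) (κ μ : ℝ) (f p q : (Fin 2 → ℝ) → ℝ) (x : Fin 2 → ℝ) : ℝ :=
  χ x ^ 2 * (- μ * (pd 0 f x ^ 2 + pd 1 f x ^ 2) + (pd 0 f x * p x + pd 1 f x * q x)
        + κ * (2 * μ ^ 2 * (pd 0 f x ^ 2 + pd 1 f x ^ 2) + 2 * (p x ^ 2 + q x ^ 2)))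
      + κ * (2 * f x ^ 2)

theorem RS_int {χ : (Fin 2 → ℝ) → ℝ} {κ : ℝ} (hc : Cut χ κ) {f p q : (Fin 2 → ℝ) → ℝ}
    (hf : Sch f) (hp : Sch p) (hq : Sch q) (μ : ℝ) : Integrable (RS χ κ μ f p q) :=
  (hc.mul2 (by fun_prop)).integrable.add (by fun_prop : Sch _).integrable

section
variable {ν η ε : ℝ} {u b : Fin 3 → (Fin 2 → ℝ) → ℝ} {P : (Fin 2 → ℝ) → ℝ}
    {Ut Bt : Fin 3 → (Fin 2 → ℝ) → ℝ} {χ : (Fin 2 → ℝ) → ℝ} {κ : ℝ}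

/-- flux in the induction equation -/
def PhB (ε : ℝ) (u b : Fin 3 → (Fin 2 → ℝ) → ℝ) : Fin 3 → Fin 2 → (Fin 2 → ℝ) → ℝ :=
  ![![fun x => Hb u b 0 0 x, fun x => Hb u b 0 1 x + ε * cr (cu b) b 2 x],
    ![fun x => Hb u b 1 0 x - ε * cr (cu b) b 2 x, fun x => Hb u b 1 1 x],
    ![fun x => Hb u b 2 0 x + ε * cr (cu b) b 1 x, fun x => Hb u b 2 1 x - ε * cr (cu b) b 0 x]]

theorem Sch.PhB (hu : ∀ i, Sch (u i)) (hb : ∀ i, Sch (b i)) (ε : ℝ) (i : Fin 3) (j : Fin 2) :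
    Sch (PhB ε u b i j) := by
  have h1 := Sch.Hb hu hb
  have h2 := fun i => (Sch.cr (Sch.cu hb) hb i).const_mul ε
  fin_cases i <;> fin_cases j
  · exact h1 0 0
  · exact (h1 0 1).add (h2 2)
  · exact (h1 1 0).sub (h2 2)
  · exact h1 1 1
  · exact (h1 2 0).add (h2 1)
  · exact (h1 2 1).sub (h2 0)

theorem Snap.eqB' (h : Snap ν η ε u b P Ut Bt) (i : Fin 3) :
    Bt i = fun x => η * lap (b i) x - pd 0 (PhB ε u b i 0) x - pd 1 (PhB ε u b i 1) x := by
  have h1 := Sch.Hb h.hu h.hb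
  have h2 := Sch.cr (Sch.cu h.hb) h.hb
  rw [h.eqB i]
  ext x
  fin_cases i
  · have : pd 1 (PhB ε u b 0 1) = _ := pd_add (h1 0 1) ((h2 2).const_mul ε) 1
    rw [pd_const_mul (h2 2)] at this
    simp only [Fin.zero_eta, this]
    simp [cu, PhB]; ring
  · have : pd 0 (PhB ε u b 1 0) = _ := pd_sub (h1 1 0) ((h2 2).const_mul ε) 0
    rw [pd_const_mul (h2 2)] at this
    simp only [Fin.mk_one, this]
    simp [cu, PhB]; ring
  · have t1 : pd 0 (PhB ε u b 2 0) = _ := pd_add (h1 2 0) ((h2 1).const_mul ε) 0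
    have t2 : pd 1 (PhB ε u b 2 1) = _ := pd_sub (h1 2 1) ((h2 0).const_mul ε) 1
    rw [pd_const_mul (h2 _)] at t1 t2
    simp only [Fin.reduceFinMk, t1, t2]
    simp [cu]; ring

/-- the localized energy production at word `α` -/
def QQ (χ : (Fin 2 → ℝ) → ℝ) (u b Ut Bt : Fin 3 → (Fin 2 → ℝ) → ℝ) (α : List (Fin 2)) : ℝ :=
  ∑ i, (∫ x, χ x ^ 2 * (pdl α (u i) x * pdl α (Ut i) x)) +
  ∑ i, (∫ x, χ x ^ 2 * (pdl α (b i) x * pdl α (Bt i) x))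

def PR (χ : (Fin 2 → ℝ) → ℝ) (u : Fin 3 → (Fin 2 → ℝ) → ℝ) (P : (Fin 2 → ℝ) → ℝ)
    (α : List (Fin 2)) : ℝ :=
  ∫ x, χ x ^ 2 * (pdl α (u 0) x * pd 0 (pdl α P) x + pdl α (u 1) x * pd 1 (pdl α P) x)

theorem QQ_le (hc : Cut χ κ) (h : Snap ν η ε u b P Ut Bt) (α : List (Fin 2)) :
    QQ χ u b Ut Bt α + PR χ u P α ≤
      ∫ x, ∑ i, (RS χ κ ν (pdl α (u i)) (pdl α (Hu u b i 0)) (pdl α (Hu u b i 1)) x +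
        RS χ κ η (pdl α (b i)) (pdl α (PhB ε u b i 0)) (pdl α (PhB ε u b i 1)) x) := by
  have hu := h.hu
  have hb := h.hb
  have hH := Sch.Hu h.hu h.hb
  have hPh := Sch.PhB h.hu h.hb ε
  have hP := h.hP
  have sB : ∀ i, ∫ x, χ x ^ 2 * (pdl α (b i) x * pdl α (Bt i) x) ≤
      ∫ x, RS χ κ η (pdl α (b i)) (pdl α (PhB ε u b i 0)) (pdl α (PhB ε u b i 1)) x := by
    intro i
    rw [h.eqB' i, pdl_flux (hb i) (hPh i 0) (hPh i 1)]
    exact scal hc ((hb i).pdl α) ((hPh i 0).pdl α) ((hPh i 1).pdl α) η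
  have sU : ∀ i, (∫ x, χ x ^ 2 * (pdl α (u i) x * pdl α (Ut i) x)) +
      ∫ x, χ x ^ 2 * (pdl α (u i) x * pdl α (gp P i) x) ≤
      ∫ x, RS χ κ ν (pdl α (u i)) (pdl α (Hu u b i 0)) (pdl α (Hu u b i 1)) x := by
    intro i
    have hg := Sch.gp hP i
    have hi := hu i
    have h0 := hH i 0
    have h1 := hH i 1
    rw [h.eqU i, pdl_sub (by fun_prop) hg, pdl_flux hi h0 h1]
    refine le_trans (le_of_eq ?_) (scal hc ((hu i).pdl α) ((hH i 0).pdl α) ((hH i 1).pdl α) ν)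
    rw [hc.int_add (by fun_prop) (by fun_prop)]
    congr 1; ext x; ring
  have iU := fun i => RS_int hc ((hu i).pdl α) ((hH i 0).pdl α) ((hH i 1).pdl α) ν
  have iB := fun i => RS_int hc ((hb i).pdl α) ((hPh i 0).pdl α) ((hPh i 1).pdl α) η
  have iUB : ∀ i, Integrable fun x => (RS χ κ ν (pdl α (u i)) (pdl α (Hu u b i 0)) (pdl α (Hu u b i 1)) x +
        RS χ κ η (pdl α (b i)) (pdl α (PhB ε u b i 0)) (pdl α (PhB ε u b i 1)) x) :=
    fun i => (iU i).add (iB i)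
  rw [integral_finsetSum _ fun i _ => iUB i]
  have e : ∀ i, ∫ x, (RS χ κ ν (pdl α (u i)) (pdl α (Hu u b i 0)) (pdl α (Hu u b i 1)) x +
        RS χ κ η (pdl α (b i)) (pdl α (PhB ε u b i 0)) (pdl α (PhB ε u b i 1)) x) = _ :=
    fun i => integral_add (iU i) (iB i)
  simp only [e]
  rw [Finset.sum_add_distrib]
  have hPR : PR χ u P α = ∑ i, ∫ x, χ x ^ 2 * (pdl α (u i) x * pdl α (gp P i) x) := by
    have z : pdl α (fun _ => (0 : ℝ)) = fun _ => 0 := by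
      have := pdl_const_mul Sch.zero 0 α
      simpa using this
    have u0 := hu 0
    have u1 := hu 1
    rw [Fin.sum_univ_three]
    simp only [gp, Matrix.cons_val_zero, Matrix.cons_val_one, Matrix.cons_val, z, pdl_pd hP]
    simp only [mul_zero, integral_zero, add_zero]
    rw [hc.int_add (by fun_prop) (by fun_prop)]
    rfl
  rw [hPR, QQ]
  have := Finset.sum_le_sum fun i (_ : i ∈ Finset.univ) => sU i
  have := Finset.sum_le_sum fun i (_ : i ∈ Finset.univ) => sB i
  rw [Finset.sum_add_distrib] at *
  linarith

end
end
end

section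
noncomputable section

theorem ptU {μ X κ a0 a1 p q : ℝ} (hμ : 0 < μ) (hX0 : 0 ≤ X) (hX : X ≤ 1) (hκ0 : 0 ≤ κ) (hκ : κ ≤ 1) :
    X * (-μ * (a0 ^ 2 + a1 ^ 2) + (a0 * p + a1 * q) + κ * (2 * μ ^ 2 * (a0 ^ 2 + a1 ^ 2)
      + 2 * (p ^ 2 + q ^ 2))) ≤
    X * (-(μ / 2) * (a0 ^ 2 + a1 ^ 2)) + X * (κ * (2 * μ ^ 2) * (a0 ^ 2 + a1 ^ 2))
      + (1 / μ + 2) * (p ^ 2 + q ^ 2) := by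
  have y : ∀ a p : ℝ, a * p ≤ μ / 2 * a ^ 2 + 1 / μ * p ^ 2 := by
    intro a p
    have : 0 ≤ (μ * a - p) ^ 2 / (2 * μ) := by positivity
    have e : (μ * a - p) ^ 2 / (2 * μ) = μ / 2 * a ^ 2 + 1 / (2 * μ) * p ^ 2 - a * p := by
      field_simp; ring
    have : 0 ≤ 1 / (2 * μ) * p ^ 2 := by positivity
    have e2 : 1 / μ * p ^ 2 = 2 * (1 / (2 * μ) * p ^ 2) := by field_simp
    linarith
  have h1 := y a0 p
  have h2 := y a1 q
  have h3 : 0 ≤ 1 / μ * (p ^ 2 + q ^ 2) := by positivity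
  have h4 : κ * (2 * (p ^ 2 + q ^ 2)) ≤ 2 * (p ^ 2 + q ^ 2) := by
    have : 0 ≤ 2 * (p ^ 2 + q ^ 2) := by positivity
    nlinarith
  have h5 : X * ((1 / μ + 2) * (p ^ 2 + q ^ 2)) ≤ (1 / μ + 2) * (p ^ 2 + q ^ 2) := by
    have : 0 ≤ (1 / μ + 2) * (p ^ 2 + q ^ 2) := by positivity
    nlinarith
  have h6 : X * (-μ * (a0 ^ 2 + a1 ^ 2) + (a0 * p + a1 * q) + κ * (2 * μ ^ 2 * (a0 ^ 2 + a1 ^ 2)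
      + 2 * (p ^ 2 + q ^ 2))) ≤ X * (-(μ / 2) * (a0 ^ 2 + a1 ^ 2) + κ * (2 * μ ^ 2) * (a0 ^ 2 + a1 ^ 2)
      + (1 / μ + 2) * (p ^ 2 + q ^ 2)) := by
    apply mul_le_mul_of_nonneg_left _ hX0
    nlinarith
  linarith


theorem sq2_le (a p : ℝ) : (a + p) ^ 2 ≤ 2 * a ^ 2 + 2 * p ^ 2 := by
  nlinarith [sq_nonneg (a - p)]

theorem ptB_y {η : ℝ} (hη : 0 < η) (a p : ℝ) : a * p ≤ η / 4 * a ^ 2 + 1 / η * p ^ 2 := by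
  have : 0 ≤ (η / 2 * a - p) ^ 2 / η := by positivity
  have e : (η / 2 * a - p) ^ 2 / η = η / 4 * a ^ 2 + 1 / η * p ^ 2 - a * p := by
    field_simp; ring
  linarith

theorem ptB_y2 {η : ℝ} (hη : 0 < η) (ε a p : ℝ) :
    -(a * (ε * p)) ≤ η / 8 * a ^ 2 + 2 * ε ^ 2 / η * p ^ 2 := by
  have : 0 ≤ (η * a / 4 + ε * p) ^ 2 / (η / 2) := by positivity
  have e : (η * a / 4 + ε * p) ^ 2 / (η / 2) = η / 8 * a ^ 2 + 2 * ε ^ 2 / η * p ^ 2 + a * (ε * p) := by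
    field_simp; ring
  linarith

theorem ptB_lin {η ε : ℝ} {a00 a01 a10 a11 a20 a21 h00 h01 h10 h11 h20 h21 : ℝ}
    {F0 F1 F2 K0 K1 K2 b0 b1 b2 : ℝ} (hη : 0 < η)
    (hF0 : F0 = -a20 * b2 - (a10 - a01) * b1 + K0)
    (hF1 : F1 = (a10 - a01) * b0 - a21 * b2 + K1)
    (hF2 : F2 = a21 * b1 + a20 * b0 + K2) :
    (a00 * h00 + a01 * (h01 + ε * F2)) + (a10 * (h10 - ε * F2) + a11 * h11) +
      (a20 * (h20 + ε * F1) + a21 * (h21 - ε * F0)) ≤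
      3 * η / 4 * (a00 ^ 2 + a01 ^ 2 + a10 ^ 2 + a11 ^ 2 + a20 ^ 2 + a21 ^ 2) +
      1 / η * (h00 ^ 2 + h01 ^ 2 + h10 ^ 2 + h11 ^ 2 + h20 ^ 2 + h21 ^ 2)
      + 2 * ε ^ 2 / η * (K0 ^ 2 + K1 ^ 2 + K2 ^ 2) := by
  have e : (a00 * h00 + a01 * (h01 + ε * F2)) + (a10 * (h10 - ε * F2) + a11 * h11) +
      (a20 * (h20 + ε * F1) + a21 * (h21 - ε * F0)) =
      (a00 * h00 + a01 * h01 + a10 * h10 + a11 * h11 + a20 * h20 + a21 * h21)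
      + (-(a21 * (ε * K0)) + -((-a20) * (ε * K1)) + -((a10 - a01) * (ε * K2))) := by
    rw [hF0, hF1, hF2]; ring
  rw [e]
  have t : η / 8 * (a10 - a01) ^ 2 ≤ η / 8 * (2 * a10 ^ 2 + 2 * a01 ^ 2) := by
    have := sq2_le a10 (-a01)
    rw [neg_sq, ← sub_eq_add_neg] at this
    gcongr
  have p1 : 0 ≤ η * a00 ^ 2 := by positivity
  have p2 : 0 ≤ η * a11 ^ 2 := by positivity
  have p3 : 0 ≤ η * a20 ^ 2 := by positivity
  have p4 : 0 ≤ η * a21 ^ 2 := by positivity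
  have p5 : 0 ≤ η * a10 ^ 2 := by positivity
  have p6 : 0 ≤ η * a01 ^ 2 := by positivity
  have q2 := ptB_y2 hη ε (-a20) K1
  rw [neg_sq] at q2
  have q1 := ptB_y2 hη ε a21 K0
  have q3 := ptB_y2 hη ε (a10 - a01) K2
  have r1 := ptB_y hη a00 h00
  have r2 := ptB_y hη a01 h01
  have r3 := ptB_y hη a10 h10
  have r4 := ptB_y hη a11 h11
  have r5 := ptB_y hη a20 h20
  have r6 := ptB_y hη a21 h21
  clear e hF0 hF1 hF2
  generalize -(a21 * (ε * K0)) = z1 at *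
  generalize -((-a20) * (ε * K1)) = z2 at *
  generalize -((a10 - a01) * (ε * K2)) = z3 at *
  generalize 2 * ε ^ 2 / η = c2 at *
  generalize 1 / η = c1 at *
  generalize (a10 - a01) ^ 2 = y at *
  generalize a00 * h00 = w1 at *
  generalize a01 * h01 = w2 at *
  generalize a10 * h10 = w3 at *
  generalize a11 * h11 = w4 at *
  generalize a20 * h20 = w5 at *
  generalize a21 * h21 = w6 at *
  linarith

theorem ptB_F {S : ℝ} {a00 a01 a10 a11 a20 a21 : ℝ}
    {F0 F1 F2 K0 K1 K2 b0 b1 b2 : ℝ}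
    (hb0 : b0 ^ 2 ≤ S) (hb1 : b1 ^ 2 ≤ S) (hb2 : b2 ^ 2 ≤ S)
    (hF0 : F0 = -a20 * b2 - (a10 - a01) * b1 + K0)
    (hF1 : F1 = (a10 - a01) * b0 - a21 * b2 + K1)
    (hF2 : F2 = a21 * b1 + a20 * b0 + K2) :
    F0 ^ 2 + F1 ^ 2 + F2 ^ 2 ≤
      12 * S * (a00 ^ 2 + a01 ^ 2 + a10 ^ 2 + a11 ^ 2 + a20 ^ 2 + a21 ^ 2)
      + 2 * (K0 ^ 2 + K1 ^ 2 + K2 ^ 2) := by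
  have hS : 0 ≤ S := (sq_nonneg _).trans hb0
  have s0 := sq2_le (-a20 * b2 - (a10 - a01) * b1) K0
  have s1 := sq2_le ((a10 - a01) * b0 - a21 * b2) K1
  have s2 := sq2_le (a21 * b1 + a20 * b0) K2
  have cs : (-a20 * b2 - (a10 - a01) * b1) ^ 2 + ((a10 - a01) * b0 - a21 * b2) ^ 2
      + (a21 * b1 + a20 * b0) ^ 2 ≤ (a21 ^ 2 + a20 ^ 2 + (a10 - a01) ^ 2) * (b0 ^ 2 + b1 ^ 2 + b2 ^ 2) := by
    have e : (a21 ^ 2 + a20 ^ 2 + (a10 - a01) ^ 2) * (b0 ^ 2 + b1 ^ 2 + b2 ^ 2) -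
      ((-a20 * b2 - (a10 - a01) * b1) ^ 2 + ((a10 - a01) * b0 - a21 * b2) ^ 2
      + (a21 * b1 + a20 * b0) ^ 2) = (a21 * b0 - a20 * b1 + (a10 - a01) * b2) ^ 2 := by ring
    have := sq_nonneg (a21 * b0 - a20 * b1 + (a10 - a01) * b2)
    linarith
  have cs2 : (a21 ^ 2 + a20 ^ 2 + (a10 - a01) ^ 2) * (b0 ^ 2 + b1 ^ 2 + b2 ^ 2) ≤
      (2 * (a00 ^ 2 + a01 ^ 2 + a10 ^ 2 + a11 ^ 2 + a20 ^ 2 + a21 ^ 2)) * (3 * S) := by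
    apply mul_le_mul _ (by linarith) (by positivity) (by positivity)
    have := sq2_le a10 (-a01)
    rw [neg_sq, ← sub_eq_add_neg] at this
    linarith [sq_nonneg a00, sq_nonneg a11, sq_nonneg a20, sq_nonneg a21]
  rw [hF0, hF1, hF2]
  linarith

theorem ptB_q {ε M : ℝ} {h00 h01 h10 h11 h20 h21 F0 F1 F2 : ℝ} (hF : F0 ^ 2 + F1 ^ 2 + F2 ^ 2 ≤ M) :
    (h00 ^ 2 + (h01 + ε * F2) ^ 2) + ((h10 - ε * F2) ^ 2 + h11 ^ 2) +
      ((h20 + ε * F1) ^ 2 + (h21 - ε * F0) ^ 2) ≤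
      2 * (h00 ^ 2 + h01 ^ 2 + h10 ^ 2 + h11 ^ 2 + h20 ^ 2 + h21 ^ 2) + 4 * ε ^ 2 * M := by
  have s1 := sq2_le h01 (ε * F2)
  have s2 := sq2_le h10 (-(ε * F2))
  have s3 := sq2_le h20 (ε * F1)
  have s4 := sq2_le h21 (-(ε * F0))
  rw [neg_sq, ← sub_eq_add_neg] at s2 s4
  have t := mul_le_mul_of_nonneg_left hF (by positivity : 0 ≤ 4 * ε ^ 2)
  have p1 : 0 ≤ (ε * F0) ^ 2 := sq_nonneg _
  have p2 : 0 ≤ (ε * F1) ^ 2 := sq_nonneg _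
  have e : 4 * ε ^ 2 * (F0 ^ 2 + F1 ^ 2 + F2 ^ 2) = 4 * (ε * F0) ^ 2 + 4 * (ε * F1) ^ 2 + 4 * (ε * F2) ^ 2 := by
    ring
  rw [e] at t
  linarith [sq_nonneg h00, sq_nonneg h11]

theorem ptB_fin {η ε X κ S A H K a0 a1 a2 l0 l1 l2 q0 q1 q2 : ℝ} (hη : 0 < η) (hX0 : 0 ≤ X)
    (hX : X ≤ 1) (hκ0 : 0 ≤ κ) (hκ : κ ≤ 1) (hH : 0 ≤ H) (hK : 0 ≤ K)
    (ha : a0 + a1 + a2 = A) (hl : l0 + l1 + l2 ≤ 3 * η / 4 * A + 1 / η * H + 2 * ε ^ 2 / η * K)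
    (hq : q0 + q1 + q2 ≤ 2 * H + 4 * ε ^ 2 * (12 * S * A + 2 * K)) :
    X * (-η * a0 + l0 + κ * (2 * η ^ 2 * a0 + 2 * q0)) +
    X * (-η * a1 + l1 + κ * (2 * η ^ 2 * a1 + 2 * q1)) +
    X * (-η * a2 + l2 + κ * (2 * η ^ 2 * a2 + 2 * q2)) ≤
    X * (-(η / 4) * A) + X * (κ * (2 * η ^ 2 + 96 * ε ^ 2 * S) * A) + (1 / η + 4) * H +
    (2 * ε ^ 2 / η + 16 * ε ^ 2) * K := by
  have q2' := mul_le_mul_of_nonneg_left hq (by positivity : 0 ≤ 2 * κ)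
  have hk1 : κ * (4 * H + 16 * ε ^ 2 * K) ≤ 4 * H + 16 * ε ^ 2 * K :=
    mul_le_of_le_one_left (by positivity) hκ
  have tot : X * ((1 / η + 4) * H + (2 * ε ^ 2 / η + 16 * ε ^ 2) * K) ≤
      (1 / η + 4) * H + (2 * ε ^ 2 / η + 16 * ε ^ 2) * K :=
    mul_le_of_le_one_left (by positivity) hX
  have key : (-η * a0 + l0 + κ * (2 * η ^ 2 * a0 + 2 * q0)) +
    (-η * a1 + l1 + κ * (2 * η ^ 2 * a1 + 2 * q1)) +
    (-η * a2 + l2 + κ * (2 * η ^ 2 * a2 + 2 * q2)) ≤ -(η / 4) * A + κ * (2 * η ^ 2 + 96 * ε ^ 2 * S) * A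
    + ((1 / η + 4) * H + (2 * ε ^ 2 / η + 16 * ε ^ 2) * K) := by
    subst ha
    linarith
  have := mul_le_mul_of_nonneg_left key hX0
  linarith

/-- pointwise treatment of the induction equation -/
theorem ptB {η ε X κ S : ℝ} {a00 a01 a10 a11 a20 a21 h00 h01 h10 h11 h20 h21 : ℝ}
    {F0 F1 F2 K0 K1 K2 b0 b1 b2 : ℝ} (hη : 0 < η) (hX0 : 0 ≤ X) (hX : X ≤ 1) (hκ0 : 0 ≤ κ) (hκ : κ ≤ 1)
    (hb0 : b0 ^ 2 ≤ S) (hb1 : b1 ^ 2 ≤ S) (hb2 : b2 ^ 2 ≤ S)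
    (hF0 : F0 = -a20 * b2 - (a10 - a01) * b1 + K0)
    (hF1 : F1 = (a10 - a01) * b0 - a21 * b2 + K1)
    (hF2 : F2 = a21 * b1 + a20 * b0 + K2) :
    X * (-η * (a00 ^ 2 + a01 ^ 2) + (a00 * h00 + a01 * (h01 + ε * F2)) +
      κ * (2 * η ^ 2 * (a00 ^ 2 + a01 ^ 2) + 2 * (h00 ^ 2 + (h01 + ε * F2) ^ 2))) +
    X * (-η * (a10 ^ 2 + a11 ^ 2) + (a10 * (h10 - ε * F2) + a11 * h11) +
      κ * (2 * η ^ 2 * (a10 ^ 2 + a11 ^ 2) + 2 * ((h10 - ε * F2) ^ 2 + h11 ^ 2))) +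
    X * (-η * (a20 ^ 2 + a21 ^ 2) + (a20 * (h20 + ε * F1) + a21 * (h21 - ε * F0)) +
      κ * (2 * η ^ 2 * (a20 ^ 2 + a21 ^ 2) + 2 * ((h20 + ε * F1) ^ 2 + (h21 - ε * F0) ^ 2))) ≤
    X * (-(η / 4) * (a00 ^ 2 + a01 ^ 2 + a10 ^ 2 + a11 ^ 2 + a20 ^ 2 + a21 ^ 2)) +
    X * (κ * (2 * η ^ 2 + 96 * ε ^ 2 * S) * (a00 ^ 2 + a01 ^ 2 + a10 ^ 2 + a11 ^ 2 + a20 ^ 2 + a21 ^ 2))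
    + (1 / η + 4) * (h00 ^ 2 + h01 ^ 2 + h10 ^ 2 + h11 ^ 2 + h20 ^ 2 + h21 ^ 2) +
    (2 * ε ^ 2 / η + 16 * ε ^ 2) * (K0 ^ 2 + K1 ^ 2 + K2 ^ 2) := by
  refine ptB_fin hη hX0 hX hκ0 hκ (by positivity) (by positivity) (by ring)
    (ptB_lin hη hF0 hF1 hF2) (ptB_q (ptB_F hb0 hb1 hb2 hF0 hF1 hF2))

end
end

section
noncomputable section
variable {ν η ε : ℝ} {u b : Fin 3 → (Fin 2 → ℝ) → ℝ} {P : (Fin 2 → ℝ) → ℝ}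
    {Ut Bt : Fin 3 → (Fin 2 → ℝ) → ℝ} {χ : (Fin 2 → ℝ) → ℝ} {κ : ℝ}

def NN (u b : Fin 3 → (Fin 2 → ℝ) → ℝ) (α : List (Fin 2)) : ℝ :=
  ∑ i, (n2 (pdl α (Hu u b i 0)) + n2 (pdl α (Hu u b i 1)) + n2 (pdl α (Hb u b i 0))
    + n2 (pdl α (Hb u b i 1)) + n2 (Ka b α i))

def NNf (u b : Fin 3 → (Fin 2 → ℝ) → ℝ) (α : List (Fin 2)) (x : Fin 2 → ℝ) : ℝ :=
  ∑ i, (pdl α (Hu u b i 0) x ^ 2 + pdl α (Hu u b i 1) x ^ 2 + pdl α (Hb u b i 0) x ^ 2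
    + pdl α (Hb u b i 1) x ^ 2 + Ka b α i x ^ 2)

theorem NNf_int (hu : ∀ i, Sch (u i)) (hb : ∀ i, Sch (b i)) (α : List (Fin 2)) :
    Sch (NNf u b α) ∧ ∫ x, NNf u b α x = NN u b α := by
  have h0 := Sch.Hu hu hb
  have h1 := Sch.Hb hu hb
  have h2 := Sch.Ka hb α
  have s : ∀ i, Sch (fun x => pdl α (Hu u b i 0) x ^ 2 + pdl α (Hu u b i 1) x ^ 2 + pdl α (Hb u b i 0) x ^ 2
    + pdl α (Hb u b i 1) x ^ 2 + Ka b α i x ^ 2) := by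
    intro i
    have := h0 i 0
    have := h0 i 1
    have := h1 i 0
    have := h1 i 1
    have := h2 i
    fun_prop
  constructor
  · exact Sch.sum _ fun i _ => s i
  · unfold NNf NN
    rw [integral_finsetSum _ fun i _ => (s i).integrable]
    congr 1; ext i
    have e0 := ((h0 i 0).pdl α).sq
    have e1 := ((h0 i 1).pdl α).sq
    have e2 := ((h1 i 0).pdl α).sq
    have e3 := ((h1 i 1).pdl α).sq
    have e4 := (h2 i).sq
    rw [integral_add (by fun_prop : Sch _).integrable (by fun_prop : Sch _).integrable,
     integral_add (by fun_prop : Sch _).integrable (by fun_prop : Sch _).integrable,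
     integral_add (by fun_prop : Sch _).integrable (by fun_prop : Sch _).integrable,
     integral_add (by fun_prop : Sch _).integrable (by fun_prop : Sch _).integrable]
    rfl

def CN (ν η ε : ℝ) : ℝ := 1 / ν + 1 / η + 6 + 2 * ε ^ 2 / η + 16 * ε ^ 2

theorem CN_nonneg (hν : 0 < ν) (hη : 0 < η) : 0 ≤ CN ν η ε := by unfold CN; positivity

def GG (u b : Fin 3 → (Fin 2 → ℝ) → ℝ) (α : List (Fin 2)) (x : Fin 2 → ℝ) : ℝ :=
  ∑ i, (gr (pdl α (u i)) x + gr (pdl α (b i)) x)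

def SS (u b : Fin 3 → (Fin 2 → ℝ) → ℝ) (α : List (Fin 2)) (x : Fin 2 → ℝ) : ℝ :=
  ∑ i, (pdl α (u i) x ^ 2 + pdl α (b i) x ^ 2)

theorem pt_all (hκ0 : 0 ≤ κ) (hχ : ∀ x, χ x ^ 2 ≤ 1) (hν : 0 < ν) (hη : 0 < η) (hκ : κ ≤ 1)
    (hu : ∀ i, Sch (u i)) (hb : ∀ i, Sch (b i)) {S c : ℝ} (hS : ∀ i x, b i x ^ 2 ≤ S)
    (hc1 : c + κ * (2 * ν ^ 2) ≤ ν / 2) (hc2 : c + κ * (2 * η ^ 2 + 96 * ε ^ 2 * S) ≤ η / 4)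
    (α : List (Fin 2)) (x : Fin 2 → ℝ) :
    ∑ i, (RS χ κ ν (pdl α (u i)) (pdl α (Hu u b i 0)) (pdl α (Hu u b i 1)) x +
        RS χ κ η (pdl α (b i)) (pdl α (PhB ε u b i 0)) (pdl α (PhB ε u b i 1)) x) ≤
    -c * (χ x ^ 2 * GG u b α x) + CN ν η ε * NNf u b α x + κ * (2 * SS u b α x) := by
  have h1 := Sch.Hb hu hb
  have h2 := Sch.cr (Sch.cu hb) hb
  have p00 : pdl α (PhB ε u b 0 0) = pdl α (Hb u b 0 0) := rfl
  have p11 : pdl α (PhB ε u b 1 1) = pdl α (Hb u b 1 1) := rfl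
  have p01 : pdl α (PhB ε u b 0 1) = _ := pdl_add (h1 0 1) ((h2 2).const_mul ε) α
  have p10 : pdl α (PhB ε u b 1 0) = _ := pdl_sub (h1 1 0) ((h2 2).const_mul ε) α
  have p20 : pdl α (PhB ε u b 2 0) = _ := pdl_add (h1 2 0) ((h2 1).const_mul ε) α
  have p21 : pdl α (PhB ε u b 2 1) = _ := pdl_sub (h1 2 1) ((h2 0).const_mul ε) α
  rw [pdl_const_mul (h2 _)] at p01 p10 p20 p21
  have X0 := sq_nonneg (χ x)
  have X1 := hχ x
  have U := fun i => ptU (a0 := pd 0 (pdl α (u i)) x) (a1 := pd 1 (pdl α (u i)) x)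
    (p := pdl α (Hu u b i 0) x) (q := pdl α (Hu u b i 1) x) hν X0 X1 hκ0 hκ
  have U0 := U 0
  have U1 := U 1
  have U2 := U 2
  have B := ptB (ε := ε) (a00 := pd 0 (pdl α (b 0)) x) (a01 := pd 1 (pdl α (b 0)) x)
    (a10 := pd 0 (pdl α (b 1)) x) (a11 := pd 1 (pdl α (b 1)) x)
    (a20 := pd 0 (pdl α (b 2)) x) (a21 := pd 1 (pdl α (b 2)) x)
    (h00 := pdl α (Hb u b 0 0) x) (h01 := pdl α (Hb u b 0 1) x)
    (h10 := pdl α (Hb u b 1 0) x) (h11 := pdl α (Hb u b 1 1) x)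
    (h20 := pdl α (Hb u b 2 0) x) (h21 := pdl α (Hb u b 2 1) x)
    (F0 := pdl α (cr (cu b) b 0) x) (F1 := pdl α (cr (cu b) b 1) x) (F2 := pdl α (cr (cu b) b 2) x)
    (K0 := Ka b α 0 x) (K1 := Ka b α 1 x) (K2 := Ka b α 2 x)
    hη X0 X1 hκ0 hκ (hS 0 x) (hS 1 x) (hS 2 x)
    (by simp [Ka, cr, cu]) (by simp [Ka, cr, cu]) (by simp [Ka, cr, cu])
  clear U
  rw [Fin.sum_univ_three, GG, NNf, SS, Fin.sum_univ_three, Fin.sum_univ_three, Fin.sum_univ_three]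
  simp only [RS, p00, p11, p01, p10, p20, p21, gr]
  clear p00 p11 p01 p10 p20 p21 h1 h2
  generalize pdl α (Hb u b 0 0) x = h00 at *
  generalize pdl α (Hb u b 0 1) x = h01 at *
  generalize pdl α (Hb u b 1 0) x = h10 at *
  generalize pdl α (Hb u b 1 1) x = h11 at *
  generalize pdl α (Hb u b 2 0) x = h20 at *
  generalize pdl α (Hb u b 2 1) x = h21 at *
  generalize pdl α (Hu u b 0 0) x = m00 at *
  generalize pdl α (Hu u b 0 1) x = m01 at *
  generalize pdl α (Hu u b 1 0) x = m10 at *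
  generalize pdl α (Hu u b 1 1) x = m11 at *
  generalize pdl α (Hu u b 2 0) x = m20 at *
  generalize pdl α (Hu u b 2 1) x = m21 at *
  generalize pdl α (cr (cu b) b 0) x = F0 at *
  generalize pdl α (cr (cu b) b 1) x = F1 at *
  generalize pdl α (cr (cu b) b 2) x = F2 at *
  generalize Ka b α 0 x = K0 at *
  generalize Ka b α 1 x = K1 at *
  generalize Ka b α 2 x = K2 at *
  generalize pd 0 (pdl α (b 0)) x = a00 at *
  generalize pd 1 (pdl α (b 0)) x = a01 at *
  generalize pd 0 (pdl α (b 1)) x = a10 at *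
  generalize pd 1 (pdl α (b 1)) x = a11 at *
  generalize pd 0 (pdl α (b 2)) x = a20 at *
  generalize pd 1 (pdl α (b 2)) x = a21 at *
  generalize pd 0 (pdl α (u 0)) x = d00 at *
  generalize pd 1 (pdl α (u 0)) x = d01 at *
  generalize pd 0 (pdl α (u 1)) x = d10 at *
  generalize pd 1 (pdl α (u 1)) x = d11 at *
  generalize pd 0 (pdl α (u 2)) x = d20 at *
  generalize pd 1 (pdl α (u 2)) x = d21 at *
  generalize pdl α (u 0) x = f0
  generalize pdl α (u 1) x = f1
  generalize pdl α (u 2) x = f2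
  generalize pdl α (b 0) x = g0
  generalize pdl α (b 1) x = g1
  generalize pdl α (b 2) x = g2
  generalize χ x ^ 2 = X at *
  have C1 : (1 / ν + 2) * (m00 ^ 2 + m01 ^ 2 + (m10 ^ 2 + m11 ^ 2) + (m20 ^ 2 + m21 ^ 2)) ≤
     CN ν η ε * (m00 ^ 2 + m01 ^ 2 + (m10 ^ 2 + m11 ^ 2) + (m20 ^ 2 + m21 ^ 2)) := by
    gcongr
    have : 0 ≤ 1 / η + 4 + 2 * ε ^ 2 / η + 16 * ε ^ 2 := by positivity
    unfold CN; linarith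
  have C2 : (1 / η + 4) * (h00 ^ 2 + h01 ^ 2 + h10 ^ 2 + h11 ^ 2 + h20 ^ 2 + h21 ^ 2) ≤
     CN ν η ε * (h00 ^ 2 + h01 ^ 2 + h10 ^ 2 + h11 ^ 2 + h20 ^ 2 + h21 ^ 2) := by
    gcongr
    have : 0 ≤ 1 / ν + 2 + 2 * ε ^ 2 / η + 16 * ε ^ 2 := by positivity
    unfold CN; linarith
  have C3 : (2 * ε ^ 2 / η + 16 * ε ^ 2) * (K0 ^ 2 + K1 ^ 2 + K2 ^ 2) ≤
     CN ν η ε * (K0 ^ 2 + K1 ^ 2 + K2 ^ 2) := by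
    gcongr
    have : 0 ≤ 1 / ν + 1 / η + 6 := by positivity
    unfold CN; linarith
  have C4 : (c + κ * (2 * ν ^ 2)) * (X * (d00 ^ 2 + d01 ^ 2 + (d10 ^ 2 + d11 ^ 2) + (d20 ^ 2 + d21 ^ 2))) ≤
    ν / 2 * (X * (d00 ^ 2 + d01 ^ 2 + (d10 ^ 2 + d11 ^ 2) + (d20 ^ 2 + d21 ^ 2))) := by
    gcongr
  have C5 : (c + κ * (2 * η ^ 2 + 96 * ε ^ 2 * S)) * (X * (a00 ^ 2 + a01 ^ 2 + a10 ^ 2 + a11 ^ 2 + a20 ^ 2 + a21 ^ 2)) ≤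
    η / 4 * (X * (a00 ^ 2 + a01 ^ 2 + a10 ^ 2 + a11 ^ 2 + a20 ^ 2 + a21 ^ 2)) := by
    gcongr
  generalize CN ν η ε = N at *
  clear hc1 hc2 hS X0 X1 hχ
  linear_combination U0 + U1 + U2 + B + C1 + C2 + C3 + C4 + C5

theorem QQ_main (hc : Cut χ κ) (h : Snap ν η ε u b P Ut Bt) (hν : 0 < ν) (hη : 0 < η) (hκ : κ ≤ 1)
    {S c : ℝ} (hS : ∀ i x, b i x ^ 2 ≤ S)
    (hc1 : c + κ * (2 * ν ^ 2) ≤ ν / 2) (hc2 : c + κ * (2 * η ^ 2 + 96 * ε ^ 2 * S) ≤ η / 4)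
    (α : List (Fin 2)) :
    QQ χ u b Ut Bt α + PR χ u P α ≤ -c * (∫ x, χ x ^ 2 * GG u b α x) + CN ν η ε * NN u b α
      + κ * (2 * ∑ i, (n2 (pdl α (u i)) + n2 (pdl α (b i)))) := by
  have hu := h.hu
  have hb := h.hb
  refine (QQ_le hc h α).trans ?_
  have sG : Sch (GG u b α) := by
    refine Sch.sum _ fun i _ => ?_
    have := hu i
    have := hb i
    fun_prop
  have sS' : ∀ i, Sch (fun x => pdl α (u i) x ^ 2 + pdl α (b i) x ^ 2) := by
    intro i
    have := hu i
    have := hb i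
    fun_prop
  have sS : Sch (SS u b α) := Sch.sum _ fun i _ => sS' i
  obtain ⟨sN, eN⟩ := NNf_int hu hb α
  have eS : ∫ x, SS u b α x = ∑ i, (n2 (pdl α (u i)) + n2 (pdl α (b i))) := by
    unfold SS
    rw [integral_finsetSum _ fun i _ => (sS' i).integrable]
    congr 1; ext i
    exact integral_add ((hu i).pdl α).sq.integrable ((hb i).pdl α).sq.integrable
  have I1 : Integrable fun x => -c * (χ x ^ 2 * GG u b α x) := (hc.mul2 sG).integrable.const_mul _
  have I2 : Integrable fun x => CN ν η ε * NNf u b α x := sN.integrable.const_mul _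
  have I3 : Integrable fun x => κ * (2 * SS u b α x) := (sS.integrable.const_mul _).const_mul _
  have e : ∫ x, (-c * (χ x ^ 2 * GG u b α x) + CN ν η ε * NNf u b α x + κ * (2 * SS u b α x)) =
      -c * (∫ x, χ x ^ 2 * GG u b α x) + CN ν η ε * NN u b α
      + κ * (2 * ∑ i, (n2 (pdl α (u i)) + n2 (pdl α (b i)))) := by
    have I12 : Integrable fun x => -c * (χ x ^ 2 * GG u b α x) + CN ν η ε * NNf u b α x := I1.add I2
    rw [integral_add I12 I3, integral_add I1 I2, integral_const_mul, integral_const_mul,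
      integral_const_mul, integral_const_mul, eN, eS]
  rw [← e]
  have hH := Sch.Hu hu hb
  have hPh := Sch.PhB hu hb ε
  refine integral_mono (integrable_finsetSum _ fun i _ => ?_) ((I1.add I2).add I3) fun x =>
    pt_all hc.kappa_nonneg hc.le hν hη hκ hu hb hS hc1 hc2 α x
  exact (RS_int hc ((hu i).pdl α) ((hH i 0).pdl α) ((hH i 1).pdl α) ν).add
    (RS_int hc ((hb i).pdl α) ((hPh i 0).pdl α) ((hPh i 1).pdl α) η)
end
end

section
noncomputable section
variable {ν η ε : ℝ} {u b : Fin 3 → (Fin 2 → ℝ) → ℝ} {P : (Fin 2 → ℝ) → ℝ}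
    {Ut Bt : Fin 3 → (Fin 2 → ℝ) → ℝ} {χ : (Fin 2 → ℝ) → ℝ} {κ : ℝ}

/-- the family of all components -/
def Fam (u b : Fin 3 → (Fin 2 → ℝ) → ℝ) (w : (Fin 2 → ℝ) → ℝ) : Prop :=
  (∃ i, w = u i) ∨ ∃ i, w = b i

theorem Fam.ofU (i : Fin 3) : Fam u b (u i) := Or.inl ⟨i, rfl⟩
theorem Fam.ofB (i : Fin 3) : Fam u b (b i) := Or.inr ⟨i, rfl⟩

def PH (u b : Fin 3 → (Fin 2 → ℝ) → ℝ) (k : ℕ) (B : ℝ) : Prop :=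
  ∀ f g, Fam u b f → Fam u b g → ∀ β γ : List (Fin 2), β.length + γ.length = k →
    n2 (fun x => pdl β f x * pdl γ g x) ≤ B

def PK (u b : Fin 3 → (Fin 2 → ℝ) → ℝ) (k : ℕ) (B : ℝ) : Prop :=
  ∀ f g, Fam u b f → Fam u b g → ∀ β γ : List (Fin 2), β ≠ [] → γ ≠ [] →
    β.length + γ.length = k + 1 → n2 (fun x => pdl β f x * pdl γ g x) ≤ B

theorem PK.nonneg {k : ℕ} {B : ℝ} (hk : k ≠ 0) (h : PK u b k B) : 0 ≤ B := by
  refine (n2_nonneg _).trans (h (u 0) (u 0) (Fam.ofU 0) (Fam.ofU 0) [0] (List.replicate k 0) (by simp) (by simpa using hk) (by simp; omega))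

theorem PH.nonneg {k : ℕ} {B : ℝ} (h : PH u b k B) : 0 ≤ B :=
  (n2_nonneg _).trans (h (u 0) (u 0) (Fam.ofU 0) (Fam.ofU 0) [] (List.replicate k 0) (by simp))

theorem PH.momFlux (hu : ∀ i, Sch (u i)) (hb : ∀ i, Sch (b i)) {α : List (Fin 2)} {B : ℝ}
    (h : PH u b α.length B) (i j : Fin 3) : n2 (pdl α (Hu u b i j)) ≤ 4 * (4 ^ α.length * B) := by
  have e : pdl α (_root_.Hu u b i j) = _ := pdl_sub ((hu j).mul (hu i)) ((hb j).mul (hb i)) α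
  rw [e]
  refine (n2_sub_le (((hu j).mul (hu i)).pdl α) (((hb j).mul (hb i)).pdl α)).trans ?_
  have h1 := leib α (u j) (u i) B (hu j) (hu i) (h _ _ (Fam.ofU _) (Fam.ofU _))
  have h2 := leib α (b j) (b i) B (hb j) (hb i) (h _ _ (Fam.ofB _) (Fam.ofB _))
  linarith

theorem PH.indFlux (hu : ∀ i, Sch (u i)) (hb : ∀ i, Sch (b i)) {α : List (Fin 2)} {B : ℝ}
    (h : PH u b α.length B) (i j : Fin 3) : n2 (pdl α (Hb u b i j)) ≤ 4 * (4 ^ α.length * B) := by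
  have e : pdl α (_root_.Hb u b i j) = _ := pdl_sub ((hu j).mul (hb i)) ((hb j).mul (hu i)) α
  rw [e]
  refine (n2_sub_le (((hu j).mul (hb i)).pdl α) (((hb j).mul (hu i)).pdl α)).trans ?_
  have h1 := leib α (u j) (b i) B (hu j) (hb i) (h _ _ (Fam.ofU _) (Fam.ofB _))
  have h2 := leib α (b j) (u i) B (hb j) (hu i) (h _ _ (Fam.ofB _) (Fam.ofU _))
  linarith

theorem cu_pdl (hb : ∀ i, Sch (b i)) (α : List (Fin 2)) (i : Fin 3) :
    cu (fun i => pdl α (b i)) i = pdl α (cu b i) := by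
  fin_cases i
  · exact (pdl_pd (hb 2) α 1).symm
  · have := pdl_neg (f := pd 0 (b 2)) α
    rw [pdl_pd (hb 2)] at this
    exact this.symm
  · have := pdl_sub ((hb 1).pd 0) ((hb 0).pd 1) α
    rw [pdl_pd (hb 1), pdl_pd (hb 0)] at this
    exact this.symm

theorem PK.curl (hb : ∀ i, Sch (b i)) {k : ℕ} {B : ℝ} (hB : 0 ≤ B)
    (h : PK u b k B) (i j : Fin 3) (β γ : List (Fin 2)) (hβ : β ≠ []) (hl : β.length + γ.length = k) :
    n2 (fun x => pdl β (b i) x * pdl γ (cu b j) x) ≤ 4 * B := by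
  have hh : ∀ (c : Fin 3) (l : Fin 2), n2 (fun x => pdl β (b i) x * pdl γ (pd l (b c)) x) ≤ B := by
    intro c l
    rw [← pdl_concat]
    exact h _ _ (Fam.ofB _) (Fam.ofB _) β (γ ++ [l]) hβ (by simp) (by simp; omega)
  fin_cases j
  · have := hh 2 1
    exact this.trans (by linarith)
  · have := hh 2 0
    have e : pdl γ (_root_.cu b 1) = _ := pdl_neg γ
    simp only [Fin.mk_one, e]
    have e2 : (fun x => pdl β (b i) x * -pdl γ (pd 0 (b 2)) x) = fun x => -(pdl β (b i) x * pdl γ (pd 0 (b 2)) x) := by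
      ext x; ring
    rw [e2, n2_neg]
    linarith
  · have e : pdl γ (_root_.cu b 2) = _ := pdl_sub ((hb 1).pd 0) ((hb 0).pd 1) γ
    simp only [Fin.reduceFinMk, e, mul_sub]
    have := hb i
    have := hb 1
    have := hb 0
    refine (n2_sub_le (by fun_prop) (by fun_prop)).trans ?_
    linarith [hh 1 0, hh 0 1]

theorem PK.comm (hb : ∀ i, Sch (b i)) {α : List (Fin 2)} {B : ℝ} (hB : 0 ≤ B)
    (h : PK u b α.length B) (i : Fin 3) : n2 (Ka b α i) ≤ 16 * (4 ^ α.length * B) := by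
  have hc := Sch.cu hb
  have key : ∀ a c a' c' : Fin 3, n2 (fun x => pdl α (fun x => cu b a x * b c x - cu b a' x * b c' x) x
      - (pdl α (cu b a) x * b c x - pdl α (cu b a') x * b c' x)) ≤ 16 * (4 ^ α.length * B) := by
    intro a c a' c'
    have h1 := leib_comm α (b c) (cu b a) (4 * B) (by linarith) (hb c) (hc a)
      (fun β γ hβ hl => h.curl hb hB c a β γ hβ hl)
    have h2 := leib_comm α (b c') (cu b a') (4 * B) (by linarith) (hb c') (hc a')
      (fun β γ hβ hl => h.curl hb hB c' a' β γ hβ hl)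
    have A1 := hc a
    have A2 := hc a'
    have A3 := hb c
    have A4 := hb c'
    have e : (fun x => pdl α (fun x => cu b a x * b c x - cu b a' x * b c' x) x
      - (pdl α (cu b a) x * b c x - pdl α (cu b a') x * b c' x)) = fun x =>
      (pdl α (fun x => b c x * cu b a x) x - b c x * pdl α (cu b a) x) -
      (pdl α (fun x => b c' x * cu b a' x) x - b c' x * pdl α (cu b a') x) := by
      rw [pdl_sub (by fun_prop) (by fun_prop)]
      simp only [mul_comm (cu b _ _) (b _ _)]
      ext x; ring
    rw [e]
    refine (n2_sub_le (by fun_prop) (by fun_prop)).trans ?_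
    linarith
  have e := cu_pdl hb α
  fin_cases i
  · have := key 1 2 2 1
    simp only [← e] at this
    exact this
  · have := key 2 0 0 2
    simp only [← e] at this
    exact this
  · have := key 0 1 1 0
    simp only [← e] at this
    exact this

theorem NN_le (hu : ∀ i, Sch (u i)) (hb : ∀ i, Sch (b i)) {α : List (Fin 2)} {B B' : ℝ} (hB : 0 ≤ B')
    (h : PH u b α.length B) (h' : PK u b α.length B') : NN u b α ≤ 48 * (4 ^ α.length * (B + B')) := by
  unfold NN
  calc _ ≤ ∑ i : Fin 3, 16 * (4 ^ α.length * (B + B')) := by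
        refine Finset.sum_le_sum fun i _ => ?_
        have := h.momFlux hu hb i 0
        have := h.momFlux hu hb i 1
        have := h.indFlux hu hb i 0
        have := h.indFlux hu hb i 1
        have := h'.comm hb hB i
        linarith
    _ = _ := by simp; ring

end
end

section
noncomputable section
variable {ν η ε : ℝ} {u b : Fin 3 → (Fin 2 → ℝ) → ℝ} {P : (Fin 2 → ℝ) → ℝ}
    {Ut Bt : Fin 3 → (Fin 2 → ℝ) → ℝ} {χ : (Fin 2 → ℝ) → ℝ} {κ : ℝ}

theorem div_pdl {v w : (Fin 2 → ℝ) → ℝ} (hv : Sch v) (hw : Sch w) (h : ∀ x, pd 0 v x + pd 1 w x = 0)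
    (α : List (Fin 2)) (x : Fin 2 → ℝ) : pd 0 (pdl α v) x + pd 1 (pdl α w) x = 0 := by
  have e : (fun x => pd 0 v x + pd 1 w x) = fun x => 0 * v x := by ext x; rw [h]; ring
  have e2 := congrArg (pdl α) e
  rw [pdl_add (hv.pd 0) (hw.pd 1), pdl_const_mul hv, pdl_pd hv, pdl_pd hw] at e2
  have := congrFun e2 x
  simpa using this

theorem PR_ge (hc : Cut χ κ) (hu : ∀ i, Sch (u i)) (hP : Sch P)
    (du : ∀ x, pd 0 (u 0) x + pd 1 (u 1) x = 0) (α : List (Fin 2)) :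
    - PR χ u P α ≤ κ * (n2 (pdl α (u 0)) + n2 (pdl α (u 1)) + 2 * n2 (pdl α P)) := by
  have d := div_pdl (hu 0) (hu 1) du α
  have s0 := (hu 0).pdl α
  have s1 := (hu 1).pdl α
  have sP := hP.pdl α
  unfold PR
  generalize pdl α (u 0) = f0 at *
  generalize pdl α (u 1) = f1 at *
  generalize pdl α P = q at *
  have hR : Sch (fun x => κ * (f0 x ^ 2 + f1 x ^ 2 + 2 * q x ^ 2)) := by fun_prop
  have hG : Sch (fun x => f0 x * pd 0 q x + f1 x * pd 1 q x) := by fun_prop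
  have eR : ∫ x, κ * (f0 x ^ 2 + f1 x ^ 2 + 2 * q x ^ 2) = κ * (n2 f0 + n2 f1 + 2 * n2 q) := by
    rw [integral_const_mul, integral_add (by fun_prop : Sch _).integrable (by fun_prop : Sch _).integrable,
      integral_add (by fun_prop : Sch _).integrable (by fun_prop : Sch _).integrable, integral_const_mul]
    rfl
  rw [← eR, ← integral_neg]
  have m0 : Sch (fun x => -(f0 x * q x)) := by fun_prop
  have m1 : Sch (fun x => -(f1 x * q x)) := by fun_prop
  refine int_le_of_div (hc.mul2 hG).integrable.neg hR.integrable (hc.mul2 m0) (hc.mul2 m1) fun x => ?_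
  rw [hc.pd_mul2 m0, hc.pd_mul2 m1, pd_neg, pd_neg, pd_mul s0 sP, pd_mul s1 sP]
  have Y0 := young_cut (χ := χ x) (f := f0 x) (q := q x) (by rw [abs_neg]; exact hc.dle 0 x : |-(pd 0 χ x)| ≤ κ)
  have Y1 := young_cut (χ := χ x) (f := f1 x) (q := q x) (by rw [abs_neg]; exact hc.dle 1 x : |-(pd 1 χ x)| ≤ κ)
  have hq : χ x ^ 2 * q x ^ 2 ≤ q x ^ 2 := mul_le_of_le_one_left (sq_nonneg _) (hc.le x)
  have hq' := mul_le_mul_of_nonneg_left hq hc.kappa_nonneg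
  have dx := congrArg (fun z => χ x ^ 2 * q x * z) (d x)
  simp only [mul_zero] at dx
  linarith

theorem elliptic {Q G0 G1 : (Fin 2 → ℝ) → ℝ} (hQ : Sch Q) (h0 : Sch G0) (h1 : Sch G1)
    (h : ∀ x, lap Q x = -(pd 0 G0 x + pd 1 G1 x)) : g2 Q ≤ n2 G0 + n2 G1 := by
  have hG : Sch (fun x => 1 / 2 * (pd 0 Q x ^ 2 + pd 1 Q x ^ 2)) := by fun_prop
  have hR : Sch (fun x => 1 / 2 * (G0 x ^ 2 + G1 x ^ 2)) := by fun_prop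
  have m0 : Sch (fun x => Q x * (pd 0 Q x + G0 x)) := by fun_prop
  have m1 : Sch (fun x => Q x * (pd 1 Q x + G1 x)) := by fun_prop
  have := int_le_of_div hG.integrable hR.integrable m0 m1 fun x => by
    rw [pd_mul hQ (by fun_prop), pd_mul hQ (by fun_prop), pd_add (by fun_prop) h0, pd_add (by fun_prop) h1]
    have hx := congrArg (fun z => Q x * z) (h x)
    simp only [lap] at hx
    have := sq_nonneg (pd 0 Q x + G0 x)
    have := sq_nonneg (pd 1 Q x + G1 x)
    simp only
    linarith
  rw [integral_const_mul, integral_const_mul, integral_add (by fun_prop : Sch _).integrable (by fun_prop : Sch _).integrable,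
    integral_add (by fun_prop : Sch _).integrable (by fun_prop : Sch _).integrable] at this
  unfold g2 n2
  linarith

theorem press_eq (h : Snap ν η ε u b P Ut Bt) (x : Fin 2 → ℝ) :
    lap P x = -(pd 0 (fun x => pd 0 (Hu u b 0 0) x + pd 1 (Hu u b 0 1) x) x +
      pd 1 (fun x => pd 0 (Hu u b 1 0) x + pd 1 (Hu u b 1 1) x) x) := by
  have hd := h.dU x
  have hP := h.hP
  have u0 := h.hu 0
  have u1 := h.hu 1
  have hH := Sch.Hu h.hu h.hb
  have h00 := hH 0 0
  have h01 := hH 0 1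
  have h10 := hH 1 0
  have h11 := hH 1 1
  rw [h.eqU 0, h.eqU 1] at hd
  have e0 : gp P 0 = pd 0 P := rfl
  have e1 : gp P 1 = pd 1 P := rfl
  simp only [e0, e1] at hd
  rw [pd_sub (by fun_prop) (by fun_prop), pd_sub (by fun_prop) (by fun_prop), pd_sub (by fun_prop) (by fun_prop),
    pd_sub (by fun_prop) (by fun_prop), pd_sub (by fun_prop) (by fun_prop), pd_sub (by fun_prop) (by fun_prop),
    pd_const_mul (by fun_prop), pd_const_mul (by fun_prop)] at hd
  rw [pd_add (by fun_prop) (by fun_prop), pd_add (by fun_prop) (by fun_prop)]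
  have l0 : pd 0 (lap (u 0)) x + pd 1 (lap (u 1)) x = 0 := by
    have a := div_pdl u0 u1 h.du [0, 0] x
    have c := div_pdl u0 u1 h.du [1, 1] x
    simp only [pdl] at a c
    have e : ∀ i : Fin 3, lap (u i) = fun x => pd 0 (pd 0 (u i)) x + pd 1 (pd 1 (u i)) x := fun i => rfl
    rw [e, e, pd_add (by fun_prop) (by fun_prop), pd_add (by fun_prop) (by fun_prop)]
    linarith
  have l1 := congrArg (fun z => ν * z) l0
  simp only [mul_zero] at l1
  simp only [lap] at *
  linarith

theorem press_bound (h : Snap ν η ε u b P Ut Bt) (α : List (Fin 2)) {B : ℝ}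
    (hB : PH u b (α.length + 1) B) : g2 (pdl α P) ≤ 32 * (4 ^ (α.length + 1) * B) := by
  have hH := Sch.Hu h.hu h.hb
  have h00 := hH 0 0
  have h01 := hH 0 1
  have h10 := hH 1 0
  have h11 := hH 1 1
  have hP := h.hP
  have hP0 := hP.pd 0
  have hP1 := hP.pd 1
  have e : lap P = fun x => -(pd 0 (fun x => pd 0 (Hu u b 0 0) x + pd 1 (Hu u b 0 1) x) x +
      pd 1 (fun x => pd 0 (Hu u b 1 0) x + pd 1 (Hu u b 1 1) x) x) := by
    ext x; exact press_eq h x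
  have s0 : Sch (fun x => pd 0 (Hu u b 0 0) x + pd 1 (Hu u b 0 1) x) := by fun_prop
  have s1 : Sch (fun x => pd 0 (Hu u b 1 0) x + pd 1 (Hu u b 1 1) x) := by fun_prop
  have e2 := congrArg (pdl α) e
  have e3 : pdl α (lap P) = lap (pdl α P) := by
    have e : lap P = fun x => pd 0 (pd 0 P) x + pd 1 (pd 1 P) x := rfl
    rw [e, pdl_add (by fun_prop) (by fun_prop), pdl_pd hP0, pdl_pd hP1, pdl_pd hP, pdl_pd hP]
    rfl
  rw [e3, pdl_neg, pdl_add (s0.pd 0) (s1.pd 1), pdl_pd s0, pdl_pd s1] at e2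
  refine (elliptic (hP.pdl α) (s0.pdl α) (s1.pdl α) fun x => congrFun e2 x).trans ?_
  have key : ∀ i, n2 (pdl α (fun x => pd 0 (Hu u b i 0) x + pd 1 (Hu u b i 1) x)) ≤
      16 * (4 ^ (α.length + 1) * B) := by
    intro i
    have i0 := hH i 0
    have i1 := hH i 1
    rw [pdl_add (by fun_prop) (by fun_prop)]
    refine (n2_add_le (by fun_prop) (by fun_prop)).trans ?_
    have l : ∀ j : Fin 2, (α ++ [j]).length = α.length + 1 := by simp
    have k0 := PH.momFlux h.hu h.hb (α := α ++ [0]) (B := B) (by rw [l]; exact hB) i 0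
    have k1 := PH.momFlux h.hu h.hb (α := α ++ [1]) (B := B) (by rw [l]; exact hB) i 1
    rw [l, pdl_concat] at k0 k1
    linarith
  linarith [key 0, key 1]

/-- sum of squares at word `α` -/
def eW (u b : Fin 3 → (Fin 2 → ℝ) → ℝ) (α : List (Fin 2)) : ℝ :=
  ∑ i, (n2 (pdl α (u i)) + n2 (pdl α (b i)))

theorem eW_ge (α : List (Fin 2)) : n2 (pdl α (u 0)) + n2 (pdl α (u 1)) ≤ eW u b α := by
  unfold eW
  rw [Fin.sum_univ_three]
  have := n2_nonneg (pdl α (u 2))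
  have := n2_nonneg (pdl α (b 0))
  have := n2_nonneg (pdl α (b 1))
  have := n2_nonneg (pdl α (b 2))
  linarith

theorem eW_nonneg (α : List (Fin 2)) : 0 ≤ eW u b α :=
  Finset.sum_nonneg fun i _ => add_nonneg (n2_nonneg _) (n2_nonneg _)

/-- crude bound with cutoff -/
theorem QQ_crude (hc : Cut χ κ) (h : Snap ν η ε u b P Ut Bt) (hν : 0 < ν) (hη : 0 < η) (hκ : κ ≤ 1)
    {S : ℝ} (hS : ∀ i x, b i x ^ 2 ≤ S)
    (hc1 : κ * (2 * ν ^ 2) ≤ ν / 2) (hc2 : κ * (2 * η ^ 2 + 96 * ε ^ 2 * S) ≤ η / 4)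
    (α : List (Fin 2)) {B : ℝ} (h1 : PH u b α.length B) (h2 : PK u b α.length B)
    (h3 : PH u b 1 B) :
    QQ χ u b Ut Bt α ≤ (96 * CN ν η ε + 256) * 4 ^ α.length * B + 4 * eW u b α := by
  have hu := h.hu
  have hB := h1.nonneg
  have m := QQ_main (c := 0) hc h hν hη hκ hS (by linarith) (by linarith) α
  have k0 := hc.kappa_nonneg
  have n := NN_le hu h.hb hB h1 h2
  have n' := mul_le_mul_of_nonneg_left n (CN_nonneg (ε := ε) hν hη)
  have e0 := eW_nonneg (u := u) (b := b) α
  have e1 : κ * (2 * eW u b α) ≤ 2 * eW u b α := mul_le_of_le_one_left (by linarith) hκ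
  have p4 : (0 : ℝ) ≤ 4 ^ α.length * B := by positivity
  have pr : - PR χ u P α ≤ 2 * eW u b α + 256 * (4 ^ α.length * B) := by
    cases α with
    | nil =>
      have hP := h.hP
      have u0 := hu 0
      have u1 := hu 1
      have g := press_bound h [] (B := B) h3
      have ge := eW_ge (u := u) (b := b) []
      simp only [pdl, List.length_nil] at *
      unfold PR
      simp only [pdl]
      have hG : Sch (fun x => u 0 x * pd 0 P x + u 1 x * pd 1 P x) := by fun_prop
      have hR : Sch (fun x => u 0 x ^ 2 + u 1 x ^ 2 + (pd 0 P x ^ 2 + pd 1 P x ^ 2)) := by fun_prop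
      rw [← integral_neg]
      have := integral_mono (hc.mul2 hG).integrable.neg hR.integrable fun x => by
        have c1 : χ x ^ 2 * (u 0 x ^ 2 + u 1 x ^ 2 + (pd 0 P x ^ 2 + pd 1 P x ^ 2)) ≤
          (u 0 x ^ 2 + u 1 x ^ 2 + (pd 0 P x ^ 2 + pd 1 P x ^ 2)) :=
          mul_le_of_le_one_left (by positivity) (hc.le x)
        have c2 : χ x ^ 2 * -(u 0 x * pd 0 P x + u 1 x * pd 1 P x) ≤
          χ x ^ 2 * (u 0 x ^ 2 + u 1 x ^ 2 + (pd 0 P x ^ 2 + pd 1 P x ^ 2)) := by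
          apply mul_le_mul_of_nonneg_left _ (sq_nonneg _)
          linarith [sq_nonneg (u 0 x + pd 0 P x), sq_nonneg (u 1 x + pd 1 P x), sq_nonneg (u 0 x),
            sq_nonneg (u 1 x), sq_nonneg (pd 0 P x), sq_nonneg (pd 1 P x)]
        simp only [Pi.neg_apply]
        linarith
      rw [integral_add (by fun_prop : Sch _).integrable (by fun_prop : Sch _).integrable,
        integral_add (by fun_prop : Sch _).integrable (by fun_prop : Sch _).integrable,
        integral_add (by fun_prop : Sch _).integrable (by fun_prop : Sch _).integrable] at this
      simp only [Pi.neg_apply] at this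
      unfold g2 n2 at *
      simp only [zero_add, pow_one, pow_zero, one_mul] at g ⊢
      linarith
    | cons i α =>
      have g := press_bound h α (B := B) h1
      have ge := eW_ge (u := u) (b := b) (i :: α)
      have p := PR_ge hc hu h.hP h.du (i :: α)
      have hi : n2 (pdl (i :: α) P) ≤ g2 (pdl α P) := by
        have := n2_nonneg (pd 0 (pdl α P))
        have := n2_nonneg (pd 1 (pdl α P))
        simp only [pdl, g2]
        fin_cases i <;> simp <;> linarith
      have p0 : 0 ≤ n2 (pdl (i :: α) (u 0)) + n2 (pdl (i :: α) (u 1)) + 2 * n2 (pdl (i :: α) P) := by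
        have := n2_nonneg (pdl (i :: α) (u 0))
        have := n2_nonneg (pdl (i :: α) (u 1))
        have := n2_nonneg (pdl (i :: α) P)
        linarith
      have := mul_le_of_le_one_left p0 hκ
      simp only [List.length_cons] at *
      linarith
  change _ ≤ _ + κ * (2 * eW u b α) at m
  linarith

/-- energy bound without cutoff -/
theorem QQ_full (h : Snap ν η ε u b P Ut Bt) (hν : 0 < ν) (hη : 0 < η) {c : ℝ} (hc1 : c ≤ ν / 2)
    (hc2 : c ≤ η / 4) (α : List (Fin 2)) {B : ℝ} (hB : 0 ≤ B) (h1 : PH u b α.length B)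
    (h2 : PK u b α.length B) :
    QQ (fun _ => 1) u b Ut Bt α ≤ -c * (∫ x, GG u b α x) + (96 * CN ν η ε) * 4 ^ α.length * B := by
  have hu := h.hu
  obtain ⟨S, hS⟩ : ∃ S, ∀ i x, b i x ^ 2 ≤ S := by
    have : ∀ i, ∃ S, ∀ x, b i x ^ 2 ≤ S := fun i => ⟨_, fun x => sup_bound (h.hb i) x⟩
    choose s hs using this
    have s0 : ∀ i, 0 ≤ s i := fun i => (sq_nonneg _).trans (hs i 0)
    exact ⟨∑ i, s i, fun i x => (hs i x).trans (Finset.single_le_sum (fun i _ => s0 i) (Finset.mem_univ i))⟩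
  have m := QQ_main (c := c) Cut.one h hν hη zero_le_one hS (by linarith) (by linarith) α
  have n := NN_le hu h.hb hB h1 h2
  have n' := mul_le_mul_of_nonneg_left n (CN_nonneg (ε := ε) hν hη)
  have p := PR_ge Cut.one hu h.hP h.du α
  simp only [one_pow, one_mul, zero_mul] at m p
  linarith

theorem GG_int (hu : ∀ i, Sch (u i)) (hb : ∀ i, Sch (b i)) (α : List (Fin 2)) :
    ∫ x, GG u b α x = eW u b (0 :: α) + eW u b (1 :: α) := by
  unfold GG eW
  rw [integral_finsetSum, ← Finset.sum_add_distrib]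
  · congr 1; ext i
    have := hu i
    have := hb i
    unfold gr
    rw [integral_add (by fun_prop : Sch _).integrable (by fun_prop : Sch _).integrable,
        integral_add (by fun_prop : Sch _).integrable (by fun_prop : Sch _).integrable,
        integral_add (by fun_prop : Sch _).integrable (by fun_prop : Sch _).integrable]
    simp only [n2, pdl]
    ring
  · intro i _
    have := hu i
    have := hb i
    exact (by fun_prop : Sch _).integrable

end
end

section
noncomputable section
variable {ν η ε : ℝ} {u b : Fin 3 → (Fin 2 → ℝ) → ℝ} {P : (Fin 2 → ℝ) → ℝ}
    {Ut Bt : Fin 3 → (Fin 2 → ℝ) → ℝ} {χ : (Fin 2 → ℝ) → ℝ} {κ : ℝ}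

theorem Sch.GG (hu : ∀ i, Sch (u i)) (hb : ∀ i, Sch (b i)) (α : List (Fin 2)) : Sch (GG u b α) := by
  refine Sch.sum _ fun i _ => ?_
  have := hu i
  have := hb i
  fun_prop

theorem RS_sum_int (hc : Cut χ κ) (hu : ∀ i, Sch (u i)) (hb : ∀ i, Sch (b i)) (α : List (Fin 2)) :
    Integrable fun x => ∑ i, (RS χ κ ν (pdl α (u i)) (pdl α (Hu u b i 0)) (pdl α (Hu u b i 1)) x +
        RS χ κ η (pdl α (b i)) (pdl α (PhB ε u b i 0)) (pdl α (PhB ε u b i 1)) x) := by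
  have hH := Sch.Hu hu hb
  have hPh := Sch.PhB hu hb ε
  refine integrable_finsetSum _ fun i _ => ?_
  exact (RS_int hc ((hu i).pdl α) ((hH i 0).pdl α) ((hH i 1).pdl α) ν).add
    (RS_int hc ((hb i).pdl α) ((hPh i 0).pdl α) ((hPh i 1).pdl α) η)

theorem QQ_zero (h : Snap ν η ε u b P Ut Bt) {c : ℝ} (hc1 : c ≤ ν) (hc2 : c ≤ η) :
    QQ (fun _ => 1) u b Ut Bt [] ≤ -c * (∫ x, GG u b [] x) := by
  have hu := h.hu
  have hb := h.hb
  have p := PR_ge Cut.one hu h.hP h.du []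
  have m := QQ_le Cut.one h []
  have u0 := hu 0
  have u1 := hu 1
  have u2 := hu 2
  have b0 := hb 0
  have b1 := hb 1
  have b2 := hb 2
  have t : (∫ x, ∑ i, (RS (fun _ => 1) 0 ν (pdl [] (u i)) (pdl [] (Hu u b i 0)) (pdl [] (Hu u b i 1)) x +
        RS (fun _ => 1) 0 η (pdl [] (b i)) (pdl [] (PhB ε u b i 0)) (pdl [] (PhB ε u b i 1)) x)) ≤
      ∫ x, -c * GG u b [] x := by
    refine int_le_of_div (RS_sum_int Cut.one hu hb []) ((Sch.GG hu hb []).integrable.const_mul _)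
      (h0 := fun x => 1 / 2 * (u 0 x * (u 0 x * u 0 x + u 1 x * u 1 x + u 2 x * u 2 x + b 0 x * b 0 x + b 1 x * b 1 x + b 2 x * b 2 x))
        - b 0 x * (u 0 x * b 0 x + u 1 x * b 1 x + u 2 x * b 2 x))
      (h1 := fun x => 1 / 2 * (u 1 x * (u 0 x * u 0 x + u 1 x * u 1 x + u 2 x * u 2 x + b 0 x * b 0 x + b 1 x * b 1 x + b 2 x * b 2 x))
        - b 1 x * (u 0 x * b 0 x + u 1 x * b 1 x + u 2 x * b 2 x)) (by fun_prop) (by fun_prop) fun x => ?_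
    simp (disch := fun_prop) only [pd_sub, pd_const_mul, pd_add, pd_mul]
    have dx := h.du x
    have dbx := h.db x
    simp only [Fin.sum_univ_three, GG, RS, pdl, PhB, Hu, Hb, cr, cu, Matrix.cons_val_zero, Matrix.cons_val_one, Matrix.cons_val, gr]
    have E1 : pd 1 (u 1) x = - pd 0 (u 0) x := by linarith
    have E2 : pd 1 (b 1) x = - pd 0 (b 0) x := by linarith
    rw [E1, E2]
    have G1 : c * (pd 0 (u 0) x ^ 2 + pd 1 (u 0) x ^ 2 + (pd 0 (u 1) x ^ 2 + pd 0 (u 0) x ^ 2) +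
      (pd 0 (u 2) x ^ 2 + pd 1 (u 2) x ^ 2)) ≤ ν * (pd 0 (u 0) x ^ 2 + pd 1 (u 0) x ^ 2 + (pd 0 (u 1) x ^ 2 + pd 0 (u 0) x ^ 2) +
      (pd 0 (u 2) x ^ 2 + pd 1 (u 2) x ^ 2)) := mul_le_mul_of_nonneg_right hc1 (by positivity)
    have G2 : c * (pd 0 (b 0) x ^ 2 + pd 1 (b 0) x ^ 2 + (pd 0 (b 1) x ^ 2 + pd 0 (b 0) x ^ 2) +
      (pd 0 (b 2) x ^ 2 + pd 1 (b 2) x ^ 2)) ≤ η * (pd 0 (b 0) x ^ 2 + pd 1 (b 0) x ^ 2 + (pd 0 (b 1) x ^ 2 + pd 0 (b 0) x ^ 2) +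
      (pd 0 (b 2) x ^ 2 + pd 1 (b 2) x ^ 2)) := mul_le_mul_of_nonneg_right hc2 (by positivity)
    linear_combination G1 + G2
  rw [integral_const_mul] at t
  simp only [zero_mul] at p
  linarith

theorem Ka_one (hb : ∀ i, Sch (b i)) (l : Fin 2) (m : Fin 3) :
    Ka b [l] m = cr (cu b) (fun i => pd l (b i)) m := by
  have hc := Sch.cu hb
  have e : ∀ i, cu (fun i => pd l (b i)) i = pd l (cu b i) := cu_pdl hb [l]
  have key : ∀ a c a' c' : Fin 3, pd l (fun x => cu b a x * b c x - cu b a' x * b c' x) = fun x =>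
      pd l (cu b a) x * b c x + cu b a x * pd l (b c) x - (pd l (cu b a') x * b c' x + cu b a' x * pd l (b c') x) := by
    intro a c a' c'
    rw [pd_sub ((hc a).mul (hb c)) ((hc a').mul (hb c')), pd_mul (hc a) (hb c), pd_mul (hc a') (hb c')]
  ext x
  fin_cases m
  · have := congrFun (key 1 2 2 1) x
    simp only [Ka, cr, pdl, Fin.zero_eta, Matrix.cons_val_zero, e, this]
    ring
  · have := congrFun (key 2 0 0 2) x
    simp only [Ka, cr, pdl, Fin.mk_one, Matrix.cons_val_one, Matrix.cons_val_zero, e, this]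
    ring
  · have := congrFun (key 0 1 1 0) x
    simp only [Ka, cr, pdl, Fin.reduceFinMk, Matrix.cons_val, e, this]
    ring

theorem young_d {δ : ℝ} (hδ : 0 < δ) (ε a p : ℝ) : -(ε * (a * p)) ≤ δ * a ^ 2 + ε ^ 2 / (4 * δ) * p ^ 2 := by
  have : 0 ≤ (2 * δ * a + ε * p) ^ 2 / (4 * δ) := by positivity
  have e : (2 * δ * a + ε * p) ^ 2 / (4 * δ) = δ * a ^ 2 + ε ^ 2 / (4 * δ) * p ^ 2 + ε * (a * p) := by
    field_simp; ring
  linarith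

/-- terms of the quadratic remainder at level one -/
def R1 (u b : Fin 3 → (Fin 2 → ℝ) → ℝ) (l : Fin 2) (x : Fin 2 → ℝ) : ℝ :=
  ∑ i, (pdl [l] (Hu u b i 0) x ^ 2 + pdl [l] (Hu u b i 1) x ^ 2 + pdl [l] (Hb u b i 0) x ^ 2
    + pdl [l] (Hb u b i 1) x ^ 2)

def R2 (b : Fin 3 → (Fin 2 → ℝ) → ℝ) (l : Fin 2) (x : Fin 2 → ℝ) : ℝ :=
  pd 1 (pd l (b 2)) x ^ 2 + pd 0 (pd l (b 2)) x ^ 2 + 2 * (pd 0 (pd l (b 1)) x - pd 1 (pd l (b 0)) x) ^ 2 +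
    pd 0 (cu b 2) x ^ 2 + pd 1 (cu b 2) x ^ 2

def R3 (b : Fin 3 → (Fin 2 → ℝ) → ℝ) (l : Fin 2) (x : Fin 2 → ℝ) : ℝ :=
  (pd 0 (b 2) x * pd l (b 2) x) ^ 2 + (pd 1 (b 2) x * pd l (b 2) x) ^ 2 + (pd 1 (b 2) x * pd l (b 1) x) ^ 2
   + (pd 0 (b 2) x * pd l (b 0) x) ^ 2 + (pd l (b 2) x * pd l (b 0) x) ^ 2 + (pd l (b 2) x * pd l (b 1) x) ^ 2

theorem QQ_one_aux (h : Snap ν η ε u b P Ut Bt) (hν : 0 < ν) (hη : 0 < η) {c : ℝ} (hc1 : c ≤ ν / 2)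
    (hc2 : c ≤ η / 4) (l : Fin 2) {δ : ℝ} (hδ : 0 < δ) :
    QQ (fun _ => 1) u b Ut Bt [l] ≤
      ∫ x, (-c * GG u b [l] x + CN ν η ε * R1 u b l x + δ * R2 b l x + ε ^ 2 / (4 * δ) * R3 b l x) := by
  have hu := h.hu
  have hb := h.hb
  have p := PR_ge Cut.one hu h.hP h.du [l]
  have m := QQ_le Cut.one h [l]
  simp only [zero_mul] at p
  have u0 := hu 0
  have u1 := hu 1
  have u2 := hu 2
  have b0 := hb 0
  have b1 := hb 1
  have b2 := hb 2
  have h0 := Sch.Hu hu hb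
  have h1 := Sch.Hb hu hb
  have h2 := Sch.cr (Sch.cu hb) hb
  have hJ := Sch.cu hb 2
  have sG := Sch.GG hu hb [l]
  have sR1 : Sch (R1 u b l) := by
    refine Sch.sum _ fun i _ => ?_
    have := h0 i 0
    have := h0 i 1
    have := h1 i 0
    have := h1 i 1
    fun_prop
  have sR2 : Sch (R2 b l) := by unfold R2; fun_prop
  have sR3 : Sch (R3 b l) := by unfold R3; fun_prop
  refine le_trans (by linarith : _ ≤ _) (int_le_of_div (RS_sum_int (ν := ν) (η := η) (ε := ε) Cut.one hu hb [l]) (by fun_prop : Sch _).integrable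
    (h0 := fun x => ε * (cu b 2 x * (pd l (b 2) x * pd l (b 0) x)))
    (h1 := fun x => ε * (cu b 2 x * (pd l (b 2) x * pd l (b 1) x))) (by fun_prop) (by fun_prop) fun x => ?_)
  simp (disch := fun_prop) only [pd_const_mul, pd_mul]
  have dbx : pd 0 (pd l (b 0)) x + pd 1 (pd l (b 1)) x = 0 := div_pdl b0 b1 h.db [l] x
  have p00 : pdl [l] (PhB ε u b 0 0) = pdl [l] (Hb u b 0 0) := rfl
  have p11 : pdl [l] (PhB ε u b 1 1) = pdl [l] (Hb u b 1 1) := rfl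
  have p01 : pdl [l] (PhB ε u b 0 1) = _ := pdl_add (h1 0 1) ((h2 2).const_mul ε) [l]
  have p10 : pdl [l] (PhB ε u b 1 0) = _ := pdl_sub (h1 1 0) ((h2 2).const_mul ε) [l]
  have p20 : pdl [l] (PhB ε u b 2 0) = _ := pdl_add (h1 2 0) ((h2 1).const_mul ε) [l]
  have p21 : pdl [l] (PhB ε u b 2 1) = _ := pdl_sub (h1 2 1) ((h2 0).const_mul ε) [l]
  rw [pdl_const_mul (h2 _)] at p01 p10 p20 p21
  have F : ∀ i, pdl [l] (cr (cu b) b i) x = cr (cu (fun i => pd l (b i))) b i x + cr (cu b) (fun i => pd l (b i)) i x := by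
    intro i
    rw [← Ka_one hb]
    simp [Ka, pdl]
  have F0 := F 0
  have F1 := F 1
  have F2 := F 2
  simp only [cr, Matrix.cons_val_zero, Matrix.cons_val_one, Matrix.cons_val] at F0 F1 F2
  have c0 : cu b 0 x = pd 1 (b 2) x := rfl
  have c1 : cu b 1 x = - pd 0 (b 2) x := rfl
  have c0' : cu (fun i => pd l (b i)) 0 x = pd 1 (pd l (b 2)) x := rfl
  have c1' : cu (fun i => pd l (b i)) 1 x = - pd 0 (pd l (b 2)) x := rfl
  have c2' : cu (fun i => pd l (b i)) 2 x = pd 0 (pd l (b 1)) x - pd 1 (pd l (b 0)) x := rfl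
  rw [c1', c2', c1] at F0
  rw [c0', c2', c0] at F1
  rw [c0', c1', c0, c1] at F2
  have z : ∀ f : (Fin 2 → ℝ) → ℝ, pdl [l] f = pd l f := fun _ => rfl
  simp only [RS, p00, p11, p01, p10, p20, p21, gr, GG, R1, R2, R3, Fin.sum_univ_three]
  simp only [cr, Matrix.cons_val_zero, Matrix.cons_val_one, Matrix.cons_val] 
  simp only [F0, F1, F2]
  simp only [z]
  clear p00 p11 p01 p10 p20 p21 F F0 F1 F2 c0 c1 c0' c1' c2' z sR1 sR2 sR3 sG hJ h2
  have E : pd 1 (pd l (b 1)) x = - pd 0 (pd l (b 0)) x := by linarith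
  have YU : ∀ a p : ℝ, a * p ≤ ν / 2 * a ^ 2 + CN ν η ε * p ^ 2 := by
    intro a p
    have := ptB_y hν a p
    have : ν / 4 * a ^ 2 ≤ ν / 2 * a ^ 2 := by gcongr; norm_num
    have : 1 / ν * p ^ 2 ≤ CN ν η ε * p ^ 2 := by
      gcongr
      have : 0 ≤ 1 / η + 6 + 2 * ε ^ 2 / η + 16 * ε ^ 2 := by positivity
      unfold CN; linarith
    linarith
  have YB : ∀ a p : ℝ, a * p ≤ 3 * η / 4 * a ^ 2 + CN ν η ε * p ^ 2 := by
    intro a p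
    have := ptB_y hη a p
    have : η / 4 * a ^ 2 ≤ 3 * η / 4 * a ^ 2 := by gcongr; linarith
    have : 1 / η * p ^ 2 ≤ CN ν η ε * p ^ 2 := by
      gcongr
      have : 0 ≤ 1 / ν + 6 + 2 * ε ^ 2 / η + 16 * ε ^ 2 := by positivity
      unfold CN; linarith
    linarith
  have DU : ∀ a : ℝ, c * a ^ 2 ≤ ν / 2 * a ^ 2 := fun a => by gcongr
  have DB : ∀ a : ℝ, c * a ^ 2 ≤ η / 4 * a ^ 2 := fun a => by gcongr
  have yd := young_d hδ ε
  have w1 := YU (pd 0 (pd l (u 0)) x) (pd l (Hu u b 0 0) x)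
  have w2 := YU (pd 1 (pd l (u 0)) x) (pd l (Hu u b 0 1) x)
  have w3 := YU (pd 0 (pd l (u 1)) x) (pd l (Hu u b 1 0) x)
  have w4 := YU (pd 1 (pd l (u 1)) x) (pd l (Hu u b 1 1) x)
  have w5 := YU (pd 0 (pd l (u 2)) x) (pd l (Hu u b 2 0) x)
  have w6 := YU (pd 1 (pd l (u 2)) x) (pd l (Hu u b 2 1) x)
  have w7 := DU (pd 0 (pd l (u 0)) x)
  have w8 := DU (pd 1 (pd l (u 0)) x)
  have w9 := DU (pd 0 (pd l (u 1)) x)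
  have w10 := DU (pd 1 (pd l (u 1)) x)
  have w11 := DU (pd 0 (pd l (u 2)) x)
  have w12 := DU (pd 1 (pd l (u 2)) x)
  have w13 := YB (pd 0 (pd l (b 0)) x) (pd l (Hb u b 0 0) x)
  have w14 := YB (pd 1 (pd l (b 0)) x) (pd l (Hb u b 0 1) x)
  have w15 := YB (pd 0 (pd l (b 1)) x) (pd l (Hb u b 1 0) x)
  have w16 := YB (pd 1 (pd l (b 1)) x) (pd l (Hb u b 1 1) x)
  have w17 := YB (pd 0 (pd l (b 2)) x) (pd l (Hb u b 2 0) x)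
  have w18 := YB (pd 1 (pd l (b 2)) x) (pd l (Hb u b 2 1) x)
  have w19 := DB (pd 0 (pd l (b 0)) x)
  have w20 := DB (pd 1 (pd l (b 0)) x)
  have w21 := DB (pd 0 (pd l (b 1)) x)
  have w22 := DB (pd 1 (pd l (b 1)) x)
  have w23 := DB (pd 0 (pd l (b 2)) x)
  have w24 := DB (pd 1 (pd l (b 2)) x)
  have w25 := yd (pd 1 (pd l (b 2)) x) (-(pd 0 (b 2) x * pd l (b 2) x))
  have w26 := yd (pd 0 (pd l (b 2)) x) (pd 1 (b 2) x * pd l (b 2) x)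
  have w27 := yd (pd 0 (pd l (b 1)) x - pd 1 (pd l (b 0)) x) (pd 1 (b 2) x * pd l (b 1) x)
  have w28 := yd (pd 0 (pd l (b 1)) x - pd 1 (pd l (b 0)) x) (pd 0 (b 2) x * pd l (b 0) x)
  have w29 := yd (pd 0 (cu b 2) x) (pd l (b 2) x * pd l (b 0) x)
  have w30 := yd (pd 1 (cu b 2) x) (pd l (b 2) x * pd l (b 1) x)
  clear YU YB DU DB yd E
  linear_combination w1 + w2 + w3 + w4 + w5 + w6 + w7 + w8 + w9 + w10 + w11 + w12 + w13 + w14 + w15 + w16 + w17 + w18 + w19 + w20 + w21 + w22 + w23 + w24 + w25 + w26 + w27 + w28 + w29 + w30 - ε * cu b 2 x * pd l (b 2) x * dbx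

theorem QQ_one (h : Snap ν η ε u b P Ut Bt) (hν : 0 < ν) (hη : 0 < η) {c : ℝ} (hc1 : c ≤ ν / 2)
    (hc2 : c ≤ η / 4) (l : Fin 2) {δ : ℝ} (hδ : 0 < δ) {B BF e2 : ℝ} (hB : PH u b 1 B)
    (hBF : ∀ j l c, n2 (fun x => pd j (b 2) x * pd l (b c) x) ≤ BF)
    (he : ∀ j l c, n2 (pd j (pd l (b c))) ≤ e2) :
    QQ (fun _ => 1) u b Ut Bt [l] ≤
      -c * (∫ x, GG u b [l] x) + 192 * CN ν η ε * B + 18 * δ * e2 + ε ^ 2 / (4 * δ) * (6 * BF) := by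
  refine (QQ_one_aux h hν hη hc1 hc2 l hδ).trans ?_
  have hu := h.hu
  have hb := h.hb
  have u0 := hu 0
  have u1 := hu 1
  have u2 := hu 2
  have b0 := hb 0
  have b1 := hb 1
  have b2 := hb 2
  have h0 := Sch.Hu hu hb
  have h1 := Sch.Hb hu hb
  have hJ := Sch.cu hb 2
  have sG := Sch.GG hu hb [l]
  have sR1' : ∀ i, Sch (fun x => pdl [l] (Hu u b i 0) x ^ 2 + pdl [l] (Hu u b i 1) x ^ 2 + pdl [l] (Hb u b i 0) x ^ 2
    + pdl [l] (Hb u b i 1) x ^ 2) := by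
    intro i
    have := h0 i 0
    have := h0 i 1
    have := h1 i 0
    have := h1 i 1
    fun_prop
  have sR1 : Sch (R1 u b l) := Sch.sum _ fun i _ => sR1' i
  have sR2 : Sch (R2 b l) := by unfold R2; fun_prop
  have sR3 : Sch (R3 b l) := by unfold R3; fun_prop
  have I1 : ∫ x, R1 u b l x ≤ 192 * B := by
    unfold R1
    rw [integral_finsetSum _ fun i _ => (sR1' i).integrable]
    calc _ ≤ ∑ i : Fin 3, 64 * B := by
          refine Finset.sum_le_sum fun i _ => ?_
          have e0 := ((h0 i 0).pdl [l]).sq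
          have e1 := ((h0 i 1).pdl [l]).sq
          have e2 := ((h1 i 0).pdl [l]).sq
          have e3 := ((h1 i 1).pdl [l]).sq
          rw [integral_add (by fun_prop : Sch _).integrable (by fun_prop : Sch _).integrable,
           integral_add (by fun_prop : Sch _).integrable (by fun_prop : Sch _).integrable,
           integral_add (by fun_prop : Sch _).integrable (by fun_prop : Sch _).integrable]
          have k1 := PH.momFlux hu hb (α := [l]) hB i 0
          have k2 := PH.momFlux hu hb (α := [l]) hB i 1
          have k3 := PH.indFlux hu hb (α := [l]) hB i 0
          have k4 := PH.indFlux hu hb (α := [l]) hB i 1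
          simp only [List.length_singleton, pow_one, n2] at k1 k2 k3 k4
          linarith
      _ = _ := by simp; ring
  have I2 : ∫ x, R2 b l x ≤ 18 * e2 := by
    unfold R2
    rw [integral_add (by fun_prop : Sch _).integrable (by fun_prop : Sch _).integrable,
           integral_add (by fun_prop : Sch _).integrable (by fun_prop : Sch _).integrable,
           integral_add (by fun_prop : Sch _).integrable (by fun_prop : Sch _).integrable,
           integral_add (by fun_prop : Sch _).integrable (by fun_prop : Sch _).integrable, integral_const_mul]
    have hj : ∀ j : Fin 2, n2 (pd j (cu b 2)) ≤ 4 * e2 := by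
      intro j
      have e : pd j (cu b 2) = _ := pd_sub (b1.pd 0) (b0.pd 1) j
      rw [e]
      refine (n2_sub_le (by fun_prop) (by fun_prop)).trans ?_
      linarith [he j 0 1, he j 1 0]
    have hw : n2 (fun x => pd 0 (pd l (b 1)) x - pd 1 (pd l (b 0)) x) ≤ 4 * e2 := by
      refine (n2_sub_le (by fun_prop) (by fun_prop)).trans ?_
      linarith [he 0 l 1, he 1 l 0]
    have k1 := hj 0
    have k2 := hj 1
    have k3 := he 0 l 2
    have k4 := he 1 l 2
    unfold n2 at k1 k2 k3 k4 hw
    linarith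
  have I3 : ∫ x, R3 b l x ≤ 6 * BF := by
    unfold R3
    rw [integral_add (by fun_prop : Sch _).integrable (by fun_prop : Sch _).integrable,
           integral_add (by fun_prop : Sch _).integrable (by fun_prop : Sch _).integrable,
           integral_add (by fun_prop : Sch _).integrable (by fun_prop : Sch _).integrable,
           integral_add (by fun_prop : Sch _).integrable (by fun_prop : Sch _).integrable,
           integral_add (by fun_prop : Sch _).integrable (by fun_prop : Sch _).integrable]
    have k1 := hBF 0 l 2
    have k2 := hBF 1 l 2
    have k3 := hBF 1 l 1
    have k4 := hBF 0 l 0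
    have k5 := hBF l l 0
    have k6 := hBF l l 1
    unfold n2 at k1 k2 k3 k4 k5 k6
    linarith
  rw [integral_add (by fun_prop : Sch _).integrable (by fun_prop : Sch _).integrable,
           integral_add (by fun_prop : Sch _).integrable (by fun_prop : Sch _).integrable,
           integral_add (by fun_prop : Sch _).integrable (by fun_prop : Sch _).integrable,
           integral_const_mul, integral_const_mul, integral_const_mul, integral_const_mul]
  have J1 := mul_le_mul_of_nonneg_left I1 (CN_nonneg (ε := ε) hν hη)
  have J2 := mul_le_mul_of_nonneg_left I2 hδ.le
  have J3 := mul_le_mul_of_nonneg_left I3 (by positivity : 0 ≤ ε ^ 2 / (4 * δ))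
  linarith

end
end

section
noncomputable section
variable {ν η ε : ℝ} {u b : Fin 3 → (Fin 2 → ℝ) → ℝ} {P : (Fin 2 → ℝ) → ℝ}
    {Ut Bt : Fin 3 → (Fin 2 → ℝ) → ℝ} {χ : (Fin 2 → ℝ) → ℝ} {κ : ℝ}

/-- order-`k` energy -/
def En (u b : Fin 3 → (Fin 2 → ℝ) → ℝ) (k : ℕ) : ℝ :=
  ∑ α : Fin k → Fin 2, eW u b (List.ofFn α)

/-- order-`k` energy production -/
def QE (χ : (Fin 2 → ℝ) → ℝ) (u b Ut Bt : Fin 3 → (Fin 2 → ℝ) → ℝ) (k : ℕ) : ℝ :=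
  ∑ α : Fin k → Fin 2, QQ χ u b Ut Bt (List.ofFn α)

theorem sum_words_succ (F : List (Fin 2) → ℝ) (k : ℕ) :
    ∑ α : Fin (k + 1) → Fin 2, F (List.ofFn α)
      = ∑ α : Fin k → Fin 2, (F (0 :: List.ofFn α) + F (1 :: List.ofFn α)) := by
  rw [← (Fin.consEquiv (fun _ : Fin (k + 1) => Fin 2)).sum_comp, Fintype.sum_prod_type,
    Fin.sum_univ_two, ← Finset.sum_add_distrib]
  refine Finset.sum_congr rfl fun α _ => ?_
  simp [Fin.consEquiv]

theorem sum_words_const (k : ℕ) (a : ℝ) : ∑ _α : Fin k → Fin 2, a = 2 ^ k * a := by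
  simp

theorem En_nonneg (k : ℕ) : 0 ≤ En u b k := Finset.sum_nonneg fun _ _ => eW_nonneg _

theorem En_succ (hu : ∀ i, Sch (u i)) (hb : ∀ i, Sch (b i)) (k : ℕ) :
    ∑ α : Fin k → Fin 2, ∫ x, GG u b (List.ofFn α) x = En u b (k + 1) := by
  unfold En
  rw [sum_words_succ]
  exact Finset.sum_congr rfl fun α _ => GG_int hu hb _

theorem eW_le_En (l : List (Fin 2)) : eW u b l ≤ En u b l.length := by
  have := Finset.single_le_sum (f := fun α : Fin l.length → Fin 2 => eW u b (List.ofFn α))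
    (fun _ _ => eW_nonneg _) (Finset.mem_univ l.get)
  simpa [List.ofFn_get, En] using this

theorem Fam.sch (hu : ∀ i, Sch (u i)) (hb : ∀ i, Sch (b i)) {w : (Fin 2 → ℝ) → ℝ} (h : Fam u b w) :
    Sch w := by
  rcases h with ⟨i, rfl⟩ | ⟨i, rfl⟩
  · exact hu i
  · exact hb i

theorem Fam.le {w : (Fin 2 → ℝ) → ℝ} (h : Fam u b w) (l : List (Fin 2)) :
    n2 (pdl l w) ≤ eW u b l := by
  have key : ∀ i, n2 (pdl l (u i)) + n2 (pdl l (b i)) ≤ eW u b l := fun i =>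
    Finset.single_le_sum (f := fun i => n2 (pdl l (u i)) + n2 (pdl l (b i)))
      (fun _ _ => add_nonneg (n2_nonneg _) (n2_nonneg _)) (Finset.mem_univ i)
  rcases h with ⟨i, rfl⟩ | ⟨i, rfl⟩
  · linarith [key i, n2_nonneg (pdl l (b i))]
  · linarith [key i, n2_nonneg (pdl l (u i))]

theorem Fam.dom (hu : ∀ i, Sch (u i)) (hb : ∀ i, Sch (b i)) {w : (Fin 2 → ℝ) → ℝ} (h : Fam u b w) :
    Dom w (En u b) := ⟨h.sch hu hb, fun l => (h.le l).trans (eW_le_En l)⟩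

/-- (A) crude bound with cutoff -/
theorem QE_crude (hν : 0 < ν) (hη : 0 < η) (m : ℕ) (hm : 3 ≤ m) (K : ℝ) (hK : 1 ≤ K) :
    ∃ M κ0 : ℝ, 0 < κ0 ∧ ∀ (u b : Fin 3 → (Fin 2 → ℝ) → ℝ) (P : (Fin 2 → ℝ) → ℝ)
      (Ut Bt : Fin 3 → (Fin 2 → ℝ) → ℝ) (χ : (Fin 2 → ℝ) → ℝ) (κ : ℝ) (k : ℕ), k ≤ m →
      Snap ν η ε u b P Ut Bt → (∀ j ≤ m, En u b j ≤ K) → Cut χ κ → κ ≤ κ0 →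
      QE χ u b Ut Bt k ≤ 2 ^ k * M := by
  set B : ℝ := 16 * K ^ 2 * (1 + K) * (1 + K) with hB
  have hB0 : 0 ≤ B := by positivity
  have hK0 : (0 : ℝ) < K := by linarith
  refine ⟨(96 * CN ν η ε + 256) * 4 ^ m * B + 4 * K,
    min 1 (min (ν / 2 / (2 * ν ^ 2)) (η / 4 / (2 * η ^ 2 + 96 * ε ^ 2 * (4 * K)))), by positivity, ?_⟩
  intro u b P Ut Bt χ κ k hk h hE hc hκ
  unfold QE
  rw [← sum_words_const]
  refine Finset.sum_le_sum fun α _ => ?_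
  have hp : ∀ f g, Fam u b f → Fam u b g → ∀ β γ : List (Fin 2), β.length ≤ m → γ.length ≤ m →
      β.length + γ.length ≤ m + 1 → n2 (fun x => pdl β f x * pdl γ g x) ≤ B := by
    intro f g hf hg β γ h1 h2 h3
    refine (prod_high (hf.dom h.hu h.hb) (hg.dom h.hu h.hb) m hm K hK (fun j hj => hE j hj.le) β γ h1 h2 h3).trans ?_
    have := hE 3 hm
    have := hE m le_rfl
    have := En_nonneg (u := u) (b := b) m
    have := En_nonneg (u := u) (b := b) 3
    rw [hB]
    gcongr
  have hS : ∀ i x, b i x ^ 2 ≤ 4 * K := by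
    intro i x
    have s := ((Fam.ofB (u := u) i).dom h.hu h.hb).sup [] x
    simp only [List.length_nil, zero_add] at s
    have e0 := hE 0 (by omega)
    have e1 := hE 1 (by omega)
    have e2 := hE 2 (by omega)
    have : √(En u b 0 * En u b 2) ≤ K := by
      rw [Real.sqrt_le_left hK0.le, sq]
      exact mul_le_mul e0 e2 (En_nonneg _) hK0.le
    change b i x ^ 2 ≤ _ at s
    linarith
  have hl : (List.ofFn α).length = k := by simp
  have main := QQ_crude hc h hν hη (hκ.trans (min_le_left _ _)) hS
    (by
      have : κ ≤ ν / 2 / (2 * ν ^ 2) := hκ.trans ((min_le_right _ _).trans (min_le_left _ _))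
      rwa [le_div_iff₀ (by positivity)] at this)
    (by
      have : κ ≤ η / 4 / (2 * η ^ 2 + 96 * ε ^ 2 * (4 * K)) :=
        hκ.trans ((min_le_right _ _).trans (min_le_right _ _))
      rwa [le_div_iff₀ (by positivity)] at this)
    (List.ofFn α) (B := B)
    (fun f g hf hg β γ hs => hp f g hf hg β γ (by omega) (by omega) (by omega))
    (fun f g hf hg β γ hb1 hb2 hs => by
      have := List.length_pos_of_ne_nil hb1
      have := List.length_pos_of_ne_nil hb2
      exact hp f g hf hg β γ (by omega) (by omega) (by omega))
    (fun f g hf hg β γ hs => hp f g hf hg β γ (by omega) (by omega) (by omega))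
  refine main.trans ?_
  have e1 : eW u b (List.ofFn α) ≤ K := (eW_le_En _).trans (hE _ (by omega))
  have c1 := CN_nonneg (ε := ε) hν hη
  rw [hl]
  have : (4 : ℝ) ^ k ≤ 4 ^ m := pow_le_pow_right₀ (by norm_num) hk
  gcongr

/-- (B) -/
theorem QE_zero (h : Snap ν η ε u b P Ut Bt) {c : ℝ} (h1 : c ≤ ν) (h2 : c ≤ η) :
    QE (fun _ => 1) u b Ut Bt 0 ≤ -c * En u b 1 := by
  rw [← En_succ h.hu h.hb, Finset.mul_sum]
  unfold QE
  refine Finset.sum_le_sum fun α _ => ?_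
  have : List.ofFn α = [] := by simp
  rw [this]
  exact QQ_zero h h1 h2

theorem QE_le_of (h : Snap ν η ε u b P Ut Bt) {c R : ℝ} (k : ℕ)
    (hq : ∀ α : Fin k → Fin 2, QQ (fun _ => 1) u b Ut Bt (List.ofFn α)
      ≤ -c * (∫ x, GG u b (List.ofFn α) x) + R) :
    QE (fun _ => 1) u b Ut Bt k ≤ -c * En u b (k + 1) + 2 ^ k * R := by
  rw [← En_succ h.hu h.hb, Finset.mul_sum, ← sum_words_const, ← Finset.sum_add_distrib]
  unfold QE
  exact Finset.sum_le_sum fun α _ => hq α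

/-- (C) -/
theorem QE_one (hν : 0 < ν) (hη : 0 < η) {c : ℝ} (hc : 0 < c) (hc1 : c ≤ ν / 2) (hc2 : c ≤ η / 4)
    (p : ℝ≥0∞) (r : ℝ) (hp : 2 < p) (hr : 2 ≤ r) (hpr : 2 / p + 2 / ENNReal.ofReal r ≤ 1)
    (K : ℝ) (hK : 0 ≤ K) :
    ∃ C : ℝ, 0 ≤ C ∧ ∀ (u b : Fin 3 → (Fin 2 → ℝ) → ℝ) (P : (Fin 2 → ℝ) → ℝ)
      (Ut Bt : Fin 3 → (Fin 2 → ℝ) → ℝ), Snap ν η ε u b P Ut Bt → En u b 0 ≤ K →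
      eLpNorm (fun x => √(pd 0 (b 2) x ^ 2 + pd 1 (b 2) x ^ 2)) p volume < ⊤ →
      QE (fun _ => 1) u b Ut Bt 1 ≤ -(c / 2) * En u b 2
        + C * (1 + (eLpNorm (fun x => √(pd 0 (b 2) x ^ 2 + pd 1 (b 2) x ^ 2)) p volume).toReal ^ r
          + En u b 1) * En u b 1 := by
  have cn := CN_nonneg (ε := ε) hν hη
  set δ : ℝ := c / 6 / 36 with hδ
  have hδ0 : 0 < δ := by positivity
  set δ1 : ℝ := c / 6 / (384 * (CN ν η ε + 1)) with hδ1
  have hδ10 : 0 < δ1 := by positivity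
  set q : ℝ := ε ^ 2 / (4 * δ) with hq
  have hq0 : 0 ≤ q := by positivity
  set δ2 : ℝ := c / 6 / (24 * (q + 1)) with hδ2
  have hδ20 : 0 < δ2 := by positivity
  obtain ⟨C2, hC2, hfb⟩ := form_bound p r hp hr hpr δ2 hδ20
  refine ⟨384 * CN ν η ε * (256 * K / δ1) + 12 * q * C2, by positivity, ?_⟩
  intro u b P Ut Bt h hE hA
  set A := (eLpNorm (fun x => √(pd 0 (b 2) x ^ 2 + pd 1 (b 2) x ^ 2)) p volume).toReal with hAdef
  have hAr : 0 ≤ A ^ r := Real.rpow_nonneg ENNReal.toReal_nonneg r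
  have E1 := En_nonneg (u := u) (b := b) 1
  have E2 := En_nonneg (u := u) (b := b) 2
  have hB : PH u b 1 (δ1 * En u b 2 + 256 * K / δ1 * En u b 1 ^ 2) := fun f g hf hg β γ hs =>
    prod_one (hf.dom h.hu h.hb) (hg.dom h.hu h.hb) K δ1 hδ10 hE β γ hs
  have hb2 := h.hb 2
  have hBF : ∀ (j l : Fin 2) (i : Fin 3), n2 (fun x => pd j (b 2) x * pd l (b i) x)
      ≤ 2 * δ2 * En u b 2 + C2 * (1 + A ^ r) * En u b 1 := by
    intro j l i
    have hd := (Fam.ofB (u := u) (b := b) i).dom h.hu h.hb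
    have := hfb (fun x => √(pd 0 (b 2) x ^ 2 + pd 1 (b 2) x ^ 2)) (pd j (b 2)) (pd l (b i))
      (hb2.pd j) ((h.hb i).pd l)
      (((((hb2.pd 0).continuous).pow 2).add (((hb2.pd 1).continuous).pow 2)).sqrt)
      (fun x => by
        rw [← Real.sqrt_sq_eq_abs]
        refine Real.sqrt_le_sqrt ?_
        fin_cases j
        · simp; positivity
        · simp; positivity) hA
    refine this.trans ?_
    have g := hd.g2_le [l]
    have n := hd.bd [l]
    change g2 (pd l (b i)) ≤ 2 * En u b 2 at g
    change n2 (pd l (b i)) ≤ En u b 1 at n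
    have k1 := mul_le_mul_of_nonneg_left g hδ20.le
    have k2 := mul_le_mul_of_nonneg_left n (by positivity : 0 ≤ C2 * (1 + A ^ r))
    change _ + C2 * (1 + A ^ r) * _ ≤ _
    linarith
  have he : ∀ (j l : Fin 2) (i : Fin 3), n2 (pd j (pd l (b i))) ≤ En u b 2 := fun j l i =>
    ((Fam.ofB (u := u) (b := b) i).dom h.hu h.hb).bd [j, l]
  have main := QE_le_of h (c := c) 1 (R := _) (fun α => by
    have e : List.ofFn α = [α 0] := by simp
    rw [e]
    have := QQ_one h hν hη hc1 hc2 (α 0) hδ0 hB hBF he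
    rw [add_assoc, add_assoc] at this
    exact this)
  refine main.trans ?_
  rw [← hq]
  have s1 : 384 * CN ν η ε * δ1 ≤ c / 6 := by
    rw [hδ1, mul_div_assoc', div_le_iff₀ (by positivity)]
    nlinarith
  have s2 : 24 * q * δ2 ≤ c / 6 := by
    rw [hδ2, mul_div_assoc', div_le_iff₀ (by positivity)]
    nlinarith
  have s3 : 36 * δ = c / 6 := by rw [hδ]; ring
  have t1 := mul_le_mul_of_nonneg_right s1 E2
  have t2 := mul_le_mul_of_nonneg_right s2 E2
  have t3 : 36 * δ * En u b 2 = c / 6 * En u b 2 := by rw [s3]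
  have w1 : 0 ≤ 384 * CN ν η ε * (256 * K / δ1) * ((1 + A ^ r) * En u b 1) := by positivity
  have w2 : 0 ≤ 12 * q * C2 * En u b 1 ^ 2 := by positivity
  generalize 256 * K / δ1 = X at *
  linarith

/-- (D) -/
theorem QE_two (hν : 0 < ν) (hη : 0 < η) {c : ℝ} (hc : 0 < c) (hc1 : c ≤ ν / 2) (hc2 : c ≤ η / 4)
    (K : ℝ) (hK : 1 ≤ K) :
    ∃ C : ℝ, 0 ≤ C ∧ ∀ (u b : Fin 3 → (Fin 2 → ℝ) → ℝ) (P : (Fin 2 → ℝ) → ℝ)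
      (Ut Bt : Fin 3 → (Fin 2 → ℝ) → ℝ), Snap ν η ε u b P Ut Bt → En u b 0 ≤ K → En u b 1 ≤ K →
      QE (fun _ => 1) u b Ut Bt 2 ≤ -(c / 2) * En u b 3 + C * (1 + En u b 2) * En u b 2 := by
  have cn := CN_nonneg (ε := ε) hν hη
  set δ : ℝ := c / 2 / (6144 * (CN ν η ε + 1)) with hδ
  have hδ0 : 0 < δ := by positivity
  have hK0 : 0 ≤ K := by linarith
  refine ⟨6144 * CN ν η ε * (256 * K ^ 2 / δ + 16 * K), by positivity, ?_⟩
  intro u b P Ut Bt h hE0 hE1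
  have E2 := En_nonneg (u := u) (b := b) 2
  have E3 := En_nonneg (u := u) (b := b) 3
  have hB := fun f g hf hg β γ h1 h2 h3 =>
    prod_two (Fam.dom (u := u) (b := b) (w := f) h.hu h.hb hf)
      (Fam.dom (u := u) (b := b) (w := g) h.hu h.hb hg) K δ hK hδ0 hE0 hE1 β γ h1 h2 h3
  have main := QE_le_of h (c := c) 2 (fun α => by
    have hl : (List.ofFn α).length = 2 := by simp
    have := QQ_full h hν hη hc1 hc2 (List.ofFn α)
      (B := δ * En u b 3 + (256 * K ^ 2 / δ + 16 * K) * (1 + En u b 2) * En u b 2) (by positivity)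
      (fun f g hf hg β γ hs => hB f g hf hg β γ (by omega) (by omega) (by omega))
      (fun f g hf hg β γ hb1 hb2 hs => by
        have := List.length_pos_of_ne_nil hb1
        have := List.length_pos_of_ne_nil hb2
        exact hB f g hf hg β γ (by omega) (by omega) (by omega))
    rw [hl] at this
    exact this)
  refine main.trans ?_
  have s1 : 6144 * CN ν η ε * δ ≤ c / 2 := by
    rw [hδ, mul_div_assoc', div_le_iff₀ (by positivity)]
    nlinarith
  have t1 := mul_le_mul_of_nonneg_right s1 E3
  generalize 256 * K ^ 2 / δ + 16 * K = X at *
  linarith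

/-- (E) -/
theorem QE_high (hν : 0 < ν) (hη : 0 < η) (k : ℕ) (hk : 3 ≤ k) (K : ℝ) (hK : 1 ≤ K) :
    ∃ C : ℝ, 0 ≤ C ∧ ∀ (u b : Fin 3 → (Fin 2 → ℝ) → ℝ) (P : (Fin 2 → ℝ) → ℝ)
      (Ut Bt : Fin 3 → (Fin 2 → ℝ) → ℝ), Snap ν η ε u b P Ut Bt → (∀ j < k, En u b j ≤ K) →
      QE (fun _ => 1) u b Ut Bt k ≤ C * (1 + En u b 3) * (1 + En u b k) := by
  have cn := CN_nonneg (ε := ε) hν hη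
  have hK0 : 0 ≤ K := by linarith
  refine ⟨2 ^ k * ((96 * CN ν η ε) * 4 ^ k * (16 * K ^ 2)), by positivity, ?_⟩
  intro u b P Ut Bt h hE
  have Ek := En_nonneg (u := u) (b := b) k
  have Ek1 := En_nonneg (u := u) (b := b) (k + 1)
  have E3 := En_nonneg (u := u) (b := b) 3
  have hB := fun f g hf hg β γ h1 h2 h3 =>
    prod_high (Fam.dom (u := u) (b := b) (w := f) h.hu h.hb hf)
      (Fam.dom (u := u) (b := b) (w := g) h.hu h.hb hg) k hk K hK hE β γ h1 h2 h3
  have main := QE_le_of h (c := min (ν / 2) (η / 4)) k (fun α => by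
    have hl : (List.ofFn α).length = k := by simp
    have := QQ_full h hν hη (min_le_left _ _) (min_le_right _ _) (List.ofFn α)
      (B := 16 * K ^ 2 * (1 + En u b 3) * (1 + En u b k)) (by positivity)
      (fun f g hf hg β γ hs => hB f g hf hg β γ (by omega) (by omega) (by omega))
      (fun f g hf hg β γ hb1 hb2 hs => by
        have := List.length_pos_of_ne_nil hb1
        have := List.length_pos_of_ne_nil hb2
        exact hB f g hf hg β γ (by omega) (by omega) (by omega))
    rw [hl] at this
    exact this)
  refine main.trans ?_
  have : 0 ≤ min (ν / 2) (η / 4) * En u b (k + 1) := by positivity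
  linarith

end
end

section
noncomputable section

/-- jointly smooth on `(0,T) × ℝ²` -/
def JS (T : ℝ) (F : ℝ → (Fin 2 → ℝ) → ℝ) : Prop :=
  ContDiffOn ℝ (⊤ : ℕ∞) (fun p : ℝ × (Fin 2 → ℝ) => F p.1 p.2) (Set.Ioo 0 T ×ˢ Set.univ)

/-- time derivative -/
def dt (F : ℝ → (Fin 2 → ℝ) → ℝ) (t : ℝ) (x : Fin 2 → ℝ) : ℝ := deriv (fun s => F s x) t

variable {T : ℝ} {F G : ℝ → (Fin 2 → ℝ) → ℝ}

theorem isOpen_slab (T : ℝ) : IsOpen (Set.Ioo 0 T ×ˢ (Set.univ : Set (Fin 2 → ℝ))) :=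
  isOpen_Ioo.prod isOpen_univ

theorem mem_slab {t : ℝ} (ht : t ∈ Set.Ioo 0 T) (x : Fin 2 → ℝ) :
    (t, x) ∈ Set.Ioo 0 T ×ˢ (Set.univ : Set (Fin 2 → ℝ)) := ⟨ht, trivial⟩

theorem JS.at (h : JS T F) {t : ℝ} (ht : t ∈ Set.Ioo 0 T) (x : Fin 2 → ℝ) :
    ContDiffAt ℝ (⊤ : ℕ∞) (fun p : ℝ × (Fin 2 → ℝ) => F p.1 p.2) (t, x) :=
  ContDiffOn.contDiffAt h ((isOpen_slab T).mem_nhds (mem_slab ht x))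

theorem JS.diffAt (h : JS T F) {t : ℝ} (ht : t ∈ Set.Ioo 0 T) (x : Fin 2 → ℝ) :
    DifferentiableAt ℝ (fun p : ℝ × (Fin 2 → ℝ) => F p.1 p.2) (t, x) :=
  (h.at ht x).differentiableAt (by simp)

theorem JS.hasDerivAt' (h : JS T F) {t : ℝ} (ht : t ∈ Set.Ioo 0 T) (x : Fin 2 → ℝ) :
    HasDerivAt (fun s => F s x)
      (fderiv ℝ (fun p : ℝ × (Fin 2 → ℝ) => F p.1 p.2) (t, x) (1, 0)) t := by
  have h1 := (h.diffAt ht x).hasFDerivAt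
  have h2 : HasDerivAt (fun s : ℝ => (s, x)) ((1 : ℝ), (0 : Fin 2 → ℝ)) t :=
    (hasDerivAt_id t).prodMk (hasDerivAt_const t x)
  exact h1.comp_hasDerivAt t h2

theorem JS.dt_eq (h : JS T F) {t : ℝ} (ht : t ∈ Set.Ioo 0 T) (x : Fin 2 → ℝ) :
    dt F t x = fderiv ℝ (fun p : ℝ × (Fin 2 → ℝ) => F p.1 p.2) (t, x) (1, 0) :=
  (h.hasDerivAt' ht x).deriv

theorem JS.hasDerivAt (h : JS T F) {t : ℝ} (ht : t ∈ Set.Ioo 0 T) (x : Fin 2 → ℝ) :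
    HasDerivAt (fun s => F s x) (dt F t x) t := by
  rw [h.dt_eq ht]; exact h.hasDerivAt' ht x

theorem JS.pd_eq (h : JS T F) (i : Fin 2) {t : ℝ} (ht : t ∈ Set.Ioo 0 T) (x : Fin 2 → ℝ) :
    pd i (F t) x
      = fderiv ℝ (fun p : ℝ × (Fin 2 → ℝ) => F p.1 p.2) (t, x) (0, Pi.single i 1) := by
  have h1 := (h.diffAt ht x).hasFDerivAt
  have h2 : HasFDerivAt (fun y : Fin 2 → ℝ => (t, y))
      (ContinuousLinearMap.inr ℝ ℝ (Fin 2 → ℝ)) x := hasFDerivAt_prodMk_right t x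
  have h3 := h1.comp x h2
  unfold pd
  have e : fderiv ℝ (F t) x = _ := h3.fderiv
  rw [e]
  simp

theorem JS.dir (h : JS T F) (v : ℝ × (Fin 2 → ℝ)) :
    JS T (fun t x => fderiv ℝ (fun p : ℝ × (Fin 2 → ℝ) => F p.1 p.2) (t, x) v) := by
  have := ContDiffOn.fderiv_of_isOpen (m := ((⊤ : ℕ∞) : WithTop ℕ∞)) h (isOpen_slab T) (by simp)
  exact this.clm_apply contDiffOn_const

theorem JS.congr (h : JS T F) (e : ∀ t ∈ Set.Ioo 0 T, ∀ x, G t x = F t x) : JS T G :=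
  ContDiffOn.congr h fun p hp => e p.1 hp.1 p.2

theorem JS.dt (h : JS T F) : JS T (dt F) := (h.dir _).congr fun t ht x => h.dt_eq ht x

theorem JS.dx (h : JS T F) (i : Fin 2) : JS T (fun t => pd i (F t)) :=
  (h.dir _).congr fun t ht x => h.pd_eq i ht x

theorem JS.comm (h : JS T F) (i : Fin 2) {t : ℝ} (ht : t ∈ Set.Ioo 0 T) :
    _root_.dt (fun t => pd i (F t)) t = pd i (_root_.dt F t) := by
  funext x
  have hs := (h.at ht x).isSymmSndFDerivAt (by simp only [minSmoothness_of_isRCLikeNormedField]; exact WithTop.coe_le_coe.2 (le_top : (2 : ℕ∞) ≤ ⊤))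
  set Φ := fun p : ℝ × (Fin 2 → ℝ) => F p.1 p.2
  have hd : DifferentiableAt ℝ (fderiv ℝ Φ) (t, x) :=
    ((h.at ht x).fderiv_right (m := ((⊤ : ℕ∞) : WithTop ℕ∞)) (by simp)).differentiableAt (by simp)
  have key : ∀ v w, fderiv ℝ (fun p => fderiv ℝ Φ p v) (t, x) w
      = fderiv ℝ (fderiv ℝ Φ) (t, x) w v := by
    intro v w
    rw [fderiv_clm_apply hd (differentiableAt_const v)]
    simp
  rw [(h.dx i).dt_eq ht, h.dt.pd_eq i ht]
  have nb := (isOpen_slab T).mem_nhds (mem_slab ht x)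
  have e1 : fderiv ℝ (fun p : ℝ × (Fin 2 → ℝ) => pd i (F p.1) p.2) (t, x)
      = fderiv ℝ (fun p => fderiv ℝ Φ p (0, Pi.single i 1)) (t, x) := by
    refine Filter.EventuallyEq.fderiv_eq ?_
    filter_upwards [nb] with p hp using h.pd_eq i hp.1 p.2
  have e2 : fderiv ℝ (fun p : ℝ × (Fin 2 → ℝ) => _root_.dt F p.1 p.2) (t, x)
      = fderiv ℝ (fun p => fderiv ℝ Φ p (1, 0)) (t, x) := by
    refine Filter.EventuallyEq.fderiv_eq ?_
    filter_upwards [nb] with p hp using h.dt_eq hp.1 p.2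
  rw [e1, e2, key, key]
  exact hs _ _

theorem JS.pdl (h : JS T F) (l : List (Fin 2)) : JS T (fun t => pdl l (F t)) := by
  induction l with
  | nil => exact h
  | cons i l ih => exact ih.dx i

theorem JS.dt_pdl (h : JS T F) (l : List (Fin 2)) {t : ℝ} (ht : t ∈ Set.Ioo 0 T) :
    _root_.dt (fun t => _root_.pdl l (F t)) t = _root_.pdl l (_root_.dt F t) := by
  induction l with
  | nil => rfl
  | cons i l ih =>
    have := (h.pdl l).comm i ht
    change _root_.dt (fun t => pd i (_root_.pdl l (F t))) t = pd i (_root_.pdl l (_root_.dt F t))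
    rw [this, ih]

theorem JS.cont (h : JS T F) :
    ContinuousOn (fun p : ℝ × (Fin 2 → ℝ) => F p.1 p.2) (Set.Ioo 0 T ×ˢ Set.univ) :=
  ContDiffOn.continuousOn h

/-- localized energy identity -/
theorem JS.ftc (h : JS T F) {χ : (Fin 2 → ℝ) → ℝ} (hχ : Continuous χ) (hc : HasCompactSupport χ) :
    (ContinuousOn (fun t => ∫ x, χ x ^ 2 * F t x ^ 2) (Set.Ioo 0 T)) ∧
    (ContinuousOn (fun t => ∫ x, χ x ^ 2 * (F t x * _root_.dt F t x)) (Set.Ioo 0 T)) ∧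
    ∀ t ∈ Set.Ioo 0 T, HasDerivAt (fun t => ∫ x, χ x ^ 2 * F t x ^ 2)
      (2 * ∫ x, χ x ^ 2 * (F t x * _root_.dt F t x)) t := by
  have hχ' : ContinuousOn (fun p : ℝ × (Fin 2 → ℝ) => χ p.2 ^ 2) (Set.Ioo 0 T ×ˢ Set.univ) :=
    ((hχ.comp continuous_snd).pow 2).continuousOn
  have c0 : ContinuousOn (fun p : ℝ × (Fin 2 → ℝ) => χ p.2 ^ 2 * F p.1 p.2 ^ 2)
      (Set.Ioo 0 T ×ˢ Set.univ) := hχ'.mul (h.cont.pow 2)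
  have c1 : ContinuousOn (fun p : ℝ × (Fin 2 → ℝ) => χ p.2 ^ 2 * (F p.1 p.2 * _root_.dt F p.1 p.2))
      (Set.Ioo 0 T ×ˢ Set.univ) := hχ'.mul (h.cont.mul h.dt.cont)
  have z : ∀ x, x ∉ tsupport χ → χ x = 0 := fun x hx => image_eq_zero_of_notMem_tsupport hx
  have hk : IsCompact (tsupport χ) := hc
  refine ⟨continuousOn_integral_of_compact_support hk c0 (fun t x _ hx => by simp [z x hx]),
    continuousOn_integral_of_compact_support hk c1 (fun t x _ hx => by simp [z x hx]), ?_⟩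
  intro t ht
  obtain ⟨δ, hδ, hball⟩ := Metric.isOpen_iff.1 (isOpen_Ioo (a := (0 : ℝ)) (b := T)) t ht
  have hsub : Metric.closedBall t (δ / 2) ⊆ Set.Ioo 0 T :=
    (Metric.closedBall_subset_ball (by linarith)).trans hball
  have hcomp : IsCompact (Metric.closedBall t (δ / 2) ×ˢ tsupport χ) :=
    (isCompact_closedBall t (δ / 2)).prod hk
  obtain ⟨M, hM⟩ := hcomp.exists_bound_of_continuousOn
    (c1.mono (Set.prod_mono hsub (Set.subset_univ _)))
  have sl : ∀ s ∈ Set.Ioo 0 T, Continuous (fun x => F s x) := fun s hs =>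
    continuousOn_univ.1 (h.cont.comp (f := fun x => (s, x)) (by fun_prop) fun x _ => mem_slab hs x)
  have sl1 : ∀ s ∈ Set.Ioo 0 T, Continuous (fun x => _root_.dt F s x) := fun s hs =>
    continuousOn_univ.1 (h.dt.cont.comp (f := fun x => (s, x)) (by fun_prop) fun x _ => mem_slab hs x)
  have main := hasDerivAt_integral_of_dominated_loc_of_deriv_le (μ := volume)
    (F := fun t x => χ x ^ 2 * F t x ^ 2)
    (F' := fun t x => 2 * (χ x ^ 2 * (F t x * _root_.dt F t x))) (x₀ := t)
    (s := Metric.closedBall t (δ / 2))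
    (bound := (tsupport χ).indicator fun _ => 2 * M)
    (Metric.closedBall_mem_nhds t (by linarith))
    (by
      filter_upwards [isOpen_Ioo.mem_nhds ht] with s hs
      exact ((hχ.pow 2).mul ((sl s hs).pow 2)).aestronglyMeasurable)
    (by
      refine Continuous.integrable_of_hasCompactSupport ((hχ.pow 2).mul ((sl t ht).pow 2)) ?_
      exact HasCompactSupport.intro hk fun x hx => by simp [z x hx])
    (((hχ.pow 2).mul ((sl t ht).mul (sl1 t ht))).const_mul 2).aestronglyMeasurable
    (by
      refine Filter.Eventually.of_forall fun x s hs => ?_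
      by_cases hx : x ∈ tsupport χ
      · rw [Set.indicator_of_mem hx, norm_mul, Real.norm_of_nonneg (by norm_num : (0:ℝ) ≤ 2)]
        have := hM (s, x) ⟨hs, hx⟩
        simp only at this ⊢
        linarith
      · simp [Set.indicator_of_notMem hx, z x hx])
    (by
      rw [integrable_indicator_iff hk.measurableSet]
      exact integrableOn_const hk.measure_lt_top.ne)
    (by
      refine Filter.Eventually.of_forall fun x s hs => ?_
      have := ((h.hasDerivAt (hsub hs) x).pow 2).const_mul (χ x ^ 2)
      have e : 2 * (χ x ^ 2 * (F s x * _root_.dt F s x))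
          = χ x ^ 2 * ((2 : ℕ) * F s x ^ (2 - 1) * _root_.dt F s x) := by push_cast; ring
      simp only [e]
      exact this)
  rw [← integral_const_mul]
  exact main.2

end
end

section
noncomputable section

open Filter Topology in
theorem limit_ineq {s t : ℝ} (hst : s ≤ t) {yn Qn : ℕ → ℝ → ℝ} {ys yt M : ℝ} {Q R : ℝ → ℝ}
    (hder : ∀ n, ∀ τ ∈ Set.Icc s t, HasDerivAt (yn n) (2 * Qn n τ) τ)
    (hcont : ∀ n, ContinuousOn (Qn n) (Set.Icc s t))
    (hle : ∀ n, ∀ τ ∈ Set.Icc s t, Qn n τ ≤ M)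
    (hlim : ∀ τ ∈ Set.Icc s t, Tendsto (fun n => Qn n τ) atTop (𝓝 (Q τ)))
    (hQ : ∀ τ ∈ Set.Icc s t, Q τ ≤ R τ) (hR : IntervalIntegrable R volume s t)
    (hys : Tendsto (fun n => yn n s) atTop (𝓝 ys)) (hyt : Tendsto (fun n => yn n t) atTop (𝓝 yt)) :
    yt - ys ≤ 2 * ∫ τ in s..t, R τ := by
  have hQi : ∀ n, IntervalIntegrable (Qn n) volume s t := fun n =>
    ContinuousOn.intervalIntegrable (by rw [Set.uIcc_of_le hst]; exact hcont n)
  have hftc : ∀ n, 2 * ∫ τ in s..t, Qn n τ = yn n t - yn n s := by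
    intro n
    rw [← intervalIntegral.integral_const_mul]
    refine intervalIntegral.integral_eq_sub_of_hasDerivAt ?_ ((hQi n).const_mul 2)
    rw [Set.uIcc_of_le hst]; exact hder n
  set μ := volume.restrict (Set.Ioc s t) with hμ
  have hsub : ∀ᵐ τ ∂μ, τ ∈ Set.Icc s t :=
    (ae_restrict_mem measurableSet_Ioc).mono fun τ h => Set.Ioc_subset_Icc_self h
  have hfm : IsFiniteMeasure μ := by rw [hμ]; infer_instance
  have iM : Integrable (fun _ : ℝ => M) μ := integrable_const M
  have iQ : ∀ n, Integrable (fun τ => M - Qn n τ) μ := fun n => iM.sub (hQi n).1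
  have iR : Integrable (fun τ => M - R τ) μ := iM.sub hR.1
  set L := fun n => ∫ τ, (M - Qn n τ) ∂μ with hL
  have hLn : ∀ n, L n = (∫ τ, M ∂μ) - (yn n t - yn n s) / 2 := by
    intro n
    simp only [hL]
    rw [integral_sub iM (hQi n).1, ← hftc n, intervalIntegral.integral_of_le hst]
    ring
  have hLlim : Tendsto L atTop (𝓝 ((∫ τ, M ∂μ) - (yt - ys) / 2)) := by
    have : L = fun n => (∫ τ, M ∂μ) - (yn n t - yn n s) / 2 := funext hLn
    rw [this]
    exact ((hyt.sub hys).div_const 2).const_sub _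
  have hL0 : ∀ n, 0 ≤ L n := fun n => integral_nonneg_of_ae
    (hsub.mono fun τ h => by simp only [Pi.zero_apply]; linarith [hle n τ h])
  have hlim0 : 0 ≤ (∫ τ, M ∂μ) - (yt - ys) / 2 := ge_of_tendsto' hLlim hL0
  have fatou := lintegral_liminf_le' (μ := μ) (u := atTop)
    (f := fun n τ => ENNReal.ofReal (M - Qn n τ))
    (fun n => (iQ n).aestronglyMeasurable.aemeasurable.ennreal_ofReal)
  have e1 : ∀ n, ∫⁻ τ, ENNReal.ofReal (M - Qn n τ) ∂μ = ENNReal.ofReal (L n) := fun n =>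
    (ofReal_integral_eq_lintegral_ofReal (iQ n)
      (hsub.mono fun τ h => by simp only [Pi.zero_apply]; linarith [hle n τ h])).symm
  simp only [e1] at fatou
  have hLL : Tendsto (fun n => ENNReal.ofReal (L n)) atTop
      (𝓝 (ENNReal.ofReal ((∫ τ, M ∂μ) - (yt - ys) / 2))) :=
    (ENNReal.continuous_ofReal.tendsto _).comp hLlim
  rw [hLL.liminf_eq] at fatou
  have e2 : ∫⁻ τ, ENNReal.ofReal (M - R τ) ∂μ ≤
      ∫⁻ τ, liminf (fun n => ENNReal.ofReal (M - Qn n τ)) atTop ∂μ := by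
    refine lintegral_mono_ae (hsub.mono fun τ h => ?_)
    have l : Tendsto (fun n => ENNReal.ofReal (M - Qn n τ)) atTop (𝓝 (ENNReal.ofReal (M - Q τ))) :=
      (ENNReal.continuous_ofReal.tendsto _).comp ((hlim τ h).const_sub M)
    rw [l.liminf_eq]
    exact ENNReal.ofReal_le_ofReal (by linarith [hQ τ h])
  have e3 := e2.trans fatou
  have e4 : ∫ τ, (M - R τ) ∂μ ≤ (∫ τ, M ∂μ) - (yt - ys) / 2 := by
    have h1 : ∫ τ, (M - R τ) ∂μ ≤ ∫ τ, max (M - R τ) 0 ∂μ :=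
      integral_mono iR iR.pos_part fun τ => le_max_left _ _
    refine h1.trans ?_
    have h2 := ofReal_integral_eq_lintegral_ofReal (μ := μ) iR.pos_part
      (ae_of_all _ fun τ => le_max_right _ _)
    have h3 : ∀ τ, ENNReal.ofReal (max (M - R τ) 0) = ENNReal.ofReal (M - R τ) := by
      intro τ; simp
    simp only [h3] at h2
    rw [← h2] at e3
    exact (ENNReal.ofReal_le_ofReal_iff hlim0).1 e3
  rw [integral_sub iM hR.1] at e4
  rw [intervalIntegral.integral_of_le hst]
  linarith

open Filter Topology in
theorem exists_cutoffs : ∃ (χ : ℕ → (Fin 2 → ℝ) → ℝ) (κ : ℕ → ℝ), Tendsto κ atTop (𝓝 0) ∧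
    (∀ n, Cut (χ n) (κ n)) ∧ (∀ n, Continuous (χ n)) ∧ (∀ n, HasCompactSupport (χ n)) ∧
    ∀ x, Tendsto (fun n => χ n x) atTop (𝓝 1) := by
  let f : ContDiffBump (0 : Fin 2 → ℝ) := ⟨1, 2, by norm_num, by norm_num⟩
  have fs : ContDiff ℝ (⊤ : ℕ∞) (f : (Fin 2 → ℝ) → ℝ) := f.contDiff
  have fc : HasCompactSupport (f : (Fin 2 → ℝ) → ℝ) := f.hasCompactSupport
  have hsch : Sch f := ⟨fc.toSchwartzMap fs, rfl⟩
  obtain ⟨C, hC⟩ := fc.fderiv (𝕜 := ℝ) |>.exists_bound_of_continuous (fs.continuous_fderiv (by simp))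
  have hC' : ∀ i x, |pd i f x| ≤ C := by
    intro i x
    have := (fderiv ℝ f x).le_opNorm (Pi.single i 1)
    rw [Pi.norm_single, norm_one, mul_one] at this
    exact this.trans (hC x)
  have hne : ∀ n : ℕ, ((n : ℝ) + 1)⁻¹ ≠ 0 := fun n => by positivity
  have cs : ∀ n : ℕ, HasCompactSupport (fun x => f (((n : ℝ) + 1)⁻¹ • x)) := fun n =>
    fc.comp_smul (hne n)
  have sm : ∀ n : ℕ, ContDiff ℝ (⊤ : ℕ∞) (fun x => f (((n : ℝ) + 1)⁻¹ • x)) := fun n =>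
    fs.comp (contDiff_const_smul _)
  refine ⟨fun n x => f (((n : ℝ) + 1)⁻¹ • x), fun n => ((n : ℝ) + 1)⁻¹ * C, ?_, ?_,
    fun n => (sm n).continuous, cs, ?_⟩
  · have := (tendsto_one_div_add_atTop_nhds_zero_nat (𝕜 := ℝ)).mul_const C
    simpa using this
  · intro n
    refine Cut.of_sch ⟨(cs n).toSchwartzMap (sm n), rfl⟩ (fun x => ?_) fun i x => ?_
    · have h0 : 0 ≤ f (((n : ℝ) + 1)⁻¹ • x) := f.nonneg
      have h1 : f (((n : ℝ) + 1)⁻¹ • x) ≤ 1 := f.le_one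
      nlinarith
    · unfold pd
      rw [fderiv_comp_smul (𝕜 := ℝ) (f := (f : (Fin 2 → ℝ) → ℝ))]
      simp only [_root_.smul_apply, smul_eq_mul, abs_mul]
      rw [abs_of_nonneg (by positivity : (0 : ℝ) ≤ ((n : ℝ) + 1)⁻¹)]
      exact mul_le_mul_of_nonneg_left (hC' i _) (by positivity)
  · intro x
    have h1 : Tendsto (fun n : ℕ => ((n : ℝ) + 1)⁻¹ • x) atTop (𝓝 0) := by
      have := (tendsto_one_div_add_atTop_nhds_zero_nat (𝕜 := ℝ)).smul_const x
      simpa using this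
    have h2 := (fs.continuous.tendsto 0).comp h1
    have : f 0 = 1 := f.one_of_mem_closedBall (by simp; exact f.rIn_pos.le)
    rw [this] at h2
    exact h2

open Filter Topology in
/-- localized integrals converge -/
theorem cut_tendsto {χ : ℕ → (Fin 2 → ℝ) → ℝ} {κ : ℕ → ℝ} (hc : ∀ n, Cut (χ n) (κ n))
    (hx : ∀ x, Tendsto (fun n => χ n x) atTop (𝓝 1)) {f : (Fin 2 → ℝ) → ℝ} (hf : Sch f) :
    Tendsto (fun n => ∫ x, χ n x ^ 2 * f x) atTop (𝓝 (∫ x, f x)) := by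
  refine tendsto_integral_of_dominated_convergence (fun x => |f x|)
    (fun n => ((hc n).mul2 hf).integrable.aestronglyMeasurable) hf.integrable.abs ?_ ?_
  · intro n
    refine ae_of_all _ fun x => ?_
    rw [norm_mul, Real.norm_of_nonneg (sq_nonneg _)]
    exact mul_le_of_le_one_left (abs_nonneg _) ((hc n).le x)
  · refine ae_of_all _ fun x => ?_
    have := ((hx x).pow 2).mul_const (f x)
    simpa using this

end
end

section
noncomputable section

theorem IsSchwartz.sch {f : (Fin 2 → ℝ) → ℝ} (h : IsSchwartz f) : Sch f := ⟨⟨f, h.1, h.2⟩, rfl⟩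

theorem IsSchwartz.comp {f : (Fin 2 → ℝ) → (Fin 3 → ℝ)} (h : IsSchwartz f) (i : Fin 3) :
    Sch (fun x => f x i) := by
  refine IsSchwartz.sch ⟨contDiff_pi.1 h.1 i, fun k n => ?_⟩
  obtain ⟨C, hC⟩ := h.2 k n
  refine ⟨‖(ContinuousLinearMap.proj i : (Fin 3 → ℝ) →L[ℝ] ℝ)‖ * C, fun x => ?_⟩
  have := (ContinuousLinearMap.proj i : (Fin 3 → ℝ) →L[ℝ] ℝ).norm_iteratedFDeriv_comp_left
    (f := f) (x := x) (N := ((⊤ : ℕ∞) : WithTop ℕ∞)) (n := n) h.1.contDiffAt (by exact_mod_cast le_top)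
  calc ‖x‖ ^ k * ‖iteratedFDeriv ℝ n (fun x => f x i) x‖
      ≤ ‖x‖ ^ k * (‖(ContinuousLinearMap.proj i : (Fin 3 → ℝ) →L[ℝ] ℝ)‖ * ‖iteratedFDeriv ℝ n f x‖) :=
        mul_le_mul_of_nonneg_left this (by positivity)
    _ = ‖(ContinuousLinearMap.proj i : (Fin 3 → ℝ) →L[ℝ] ℝ)‖ * (‖x‖ ^ k * ‖iteratedFDeriv ℝ n f x‖) := by ring
    _ ≤ _ := mul_le_mul_of_nonneg_left (hC x) (norm_nonneg _)

variable {ν η ε T : ℝ} {u b : ℝ → (Fin 2 → ℝ) → (Fin 3 → ℝ)} {π : ℝ → (Fin 2 → ℝ) → ℝ}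

theorem js_comp (h : ContDiffOn ℝ (⊤ : ℕ∞) (fun p : ℝ × (Fin 2 → ℝ) => u p.1 p.2)
    (Set.Ico 0 T ×ˢ Set.univ)) (i : Fin 3) : JS T (fun t x => u t x i) := by
  have := contDiffOn_pi.1 (h.mono (Set.prod_mono Set.Ioo_subset_Ico_self subset_rfl)) i
  exact this

theorem advect_flux {v w : Fin 3 → (Fin 2 → ℝ) → ℝ} (hv : ∀ i, Sch (v i)) (hw : ∀ i, Sch (w i))
    (d : ∀ x, pd 0 (v 0) x + pd 1 (v 1) x = 0) (i : Fin 3) (x : Fin 2 → ℝ) :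
    v 0 x * pd 0 (w i) x + v 1 x * pd 1 (w i) x
      = pd 0 (fun x => v 0 x * w i x) x + pd 1 (fun x => v 1 x * w i x) x := by
  rw [pd_mul (hv 0) (hw i), pd_mul (hv 1) (hw i)]
  linear_combination -(w i x) * d x

theorem snap_of_sol (hs : IsHallMHDSolution ν η ε (Set.Ico 0 T) u b π) {t : ℝ}
    (ht : t ∈ Set.Ioo 0 T) :
    Snap ν η ε (fun i x => u t x i) (fun i x => b t x i) (π t)
      (fun i => dt (fun t x => u t x i) t) (fun i => dt (fun t x => b t x i) t) := by
  have ht' : t ∈ Set.Ico 0 T := Set.Ioo_subset_Ico_self ht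
  have hu : ∀ i, Sch (fun x => u t x i) := (hs.schwartz_u t ht').comp
  have hb : ∀ i, Sch (fun x => b t x i) := (hs.schwartz_b t ht').comp
  have du := hs.div_u t ht'
  have db := hs.div_b t ht'
  refine ⟨hu, hb, (hs.schwartz_pi t ht').sch, du, db, ?_, ?_, ?_⟩
  · intro i
    funext x
    have m := hs.momentum t ht' x i
    have a1 := advect_flux (v := fun i x => u t x i) (w := fun i x => u t x i) hu hu du i x
    have a2 := advect_flux (v := fun i x => b t x i) (w := fun i x => b t x i) hb hb db i x
    have e1 : ![pd 0 (π t) x, pd 1 (π t) x, 0] i = gp (π t) i x := by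
      fin_cases i <;> rfl
    rw [e1] at m
    have p0 : ∀ j : Fin 2, ∀ k : Fin 3, pd j (Hu (fun i x => u t x i) (fun i x => b t x i) i k) x
        = pd j (fun x => u t x k * u t x i) x - pd j (fun x => b t x k * b t x i) x := by
      intro j k
      exact congrFun (pd_sub ((hu k).mul (hu i)) ((hb k).mul (hb i)) j) x
    rw [p0, p0]
    unfold advect at m
    beta_reduce at a1 a2
    unfold dt
    linarith
  · intro i
    funext x
    have m := hs.induction t ht' x i
    have a1 := advect_flux (v := fun i x => u t x i) (w := fun i x => b t x i) hu hb du i x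
    have a2 := advect_flux (v := fun i x => b t x i) (w := fun i x => u t x i) hb hu db i x
    have e1 : curl (fun y => crossProduct (curl (b t) y) (b t y)) x i
        = cu (cr (cu (fun i x => b t x i)) (fun i x => b t x i)) i x := by
      have e : ∀ k, (fun y => crossProduct (curl (b t) y) (b t y) k)
          = cr (cu (fun i x => b t x i)) (fun i x => b t x i) k := by
        intro k
        funext y
        fin_cases k <;> simp [cross_apply, cr, cu, curl]
      unfold curl
      simp only [e, curl] at *
      fin_cases i <;> simp [cu] <;> rfl
    rw [e1] at m
    have p0 : ∀ j : Fin 2, ∀ k : Fin 3, pd j (Hb (fun i x => u t x i) (fun i x => b t x i) i k) x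
        = pd j (fun x => u t x k * b t x i) x - pd j (fun x => b t x k * u t x i) x := by
      intro j k
      exact congrFun (pd_sub ((hu k).mul (hb i)) ((hb k).mul (hu i)) j) x
    rw [p0, p0]
    unfold advect at m
    beta_reduce at a1 a2
    unfold dt
    linarith
  · intro x
    have j0 := js_comp hs.smooth_u 0
    have j1 := js_comp hs.smooth_u 1
    rw [← j0.comm 0 ht, ← j1.comm 1 ht]
    have h0 := (j0.dx 0).hasDerivAt ht x
    have h1 := (j1.dx 1).hasDerivAt ht x
    have h2 := h0.add h1
    have h3 : HasDerivAt (fun _ : ℝ => (0 : ℝ)) 0 t := hasDerivAt_const t 0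
    refine h2.unique (h3.congr_of_eventuallyEq ?_)
    filter_upwards [isOpen_Ioo.mem_nhds ht] with s hs'
    exact hs.div_u s (Set.Ioo_subset_Ico_self hs') x

end
end

section
noncomputable section
variable {ν η ε T : ℝ} {u b : ℝ → (Fin 2 → ℝ) → (Fin 3 → ℝ)} {π : ℝ → (Fin 2 → ℝ) → ℝ}

/-- energy of order `k` at time `t` -/
def ET (u b : ℝ → (Fin 2 → ℝ) → (Fin 3 → ℝ)) (k : ℕ) (t : ℝ) : ℝ :=
  En (fun i x => u t x i) (fun i x => b t x i) k

/-- energy production of order `k` at time `t` -/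
def QT (χ : (Fin 2 → ℝ) → ℝ) (u b : ℝ → (Fin 2 → ℝ) → (Fin 3 → ℝ)) (k : ℕ) (t : ℝ) : ℝ :=
  QE χ (fun i x => u t x i) (fun i x => b t x i)
    (fun i => dt (fun t x => u t x i) t) (fun i => dt (fun t x => b t x i) t) k

/-- localized energy -/
def YT (χ : (Fin 2 → ℝ) → ℝ) (u b : ℝ → (Fin 2 → ℝ) → (Fin 3 → ℝ)) (k : ℕ) (t : ℝ) : ℝ :=
  ∑ α : Fin k → Fin 2, ∑ i : Fin 3,
    ((∫ x, χ x ^ 2 * pdl (List.ofFn α) (fun x => u t x i) x ^ 2) +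
      ∫ x, χ x ^ 2 * pdl (List.ofFn α) (fun x => b t x i) x ^ 2)

theorem QT_eq (hs : IsHallMHDSolution ν η ε (Set.Ico 0 T) u b π) (χ : (Fin 2 → ℝ) → ℝ) (k : ℕ)
    {t : ℝ} (ht : t ∈ Set.Ioo 0 T) :
    QT χ u b k t = ∑ α : Fin k → Fin 2, ∑ i : Fin 3,
    ((∫ x, χ x ^ 2 * (pdl (List.ofFn α) (fun x => u t x i) x *
        dt (fun t => pdl (List.ofFn α) (fun x => u t x i)) t x)) +
      ∫ x, χ x ^ 2 * (pdl (List.ofFn α) (fun x => b t x i) x *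
        dt (fun t => pdl (List.ofFn α) (fun x => b t x i)) t x)) := by
  unfold QT QE QQ
  refine Finset.sum_congr rfl fun α _ => ?_
  rw [← Finset.sum_add_distrib]
  refine Finset.sum_congr rfl fun i _ => ?_
  rw [(js_comp hs.smooth_u i).dt_pdl _ ht, (js_comp hs.smooth_b i).dt_pdl _ ht]

theorem YT_ftc (hs : IsHallMHDSolution ν η ε (Set.Ico 0 T) u b π) {χ : (Fin 2 → ℝ) → ℝ}
    (hχ : Continuous χ) (hc : HasCompactSupport χ) (k : ℕ) :
    ContinuousOn (YT χ u b k) (Set.Ioo 0 T) ∧ ContinuousOn (QT χ u b k) (Set.Ioo 0 T) ∧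
    ∀ t ∈ Set.Ioo 0 T, HasDerivAt (YT χ u b k) (2 * QT χ u b k t) t := by
  have fu := fun (l : List (Fin 2)) (i : Fin 3) => ((js_comp hs.smooth_u i).pdl l).ftc hχ hc
  have fb := fun (l : List (Fin 2)) (i : Fin 3) => ((js_comp hs.smooth_b i).pdl l).ftc hχ hc
  refine ⟨?_, ?_, ?_⟩
  · exact continuousOn_finsetSum _ fun α _ => continuousOn_finsetSum _ fun i _ =>
      (fu _ i).1.add (fb _ i).1
  · refine ContinuousOn.congr ?_ fun t ht => QT_eq hs χ k ht
    exact continuousOn_finsetSum _ fun α _ => continuousOn_finsetSum _ fun i _ =>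
      (fu _ i).2.1.add (fb _ i).2.1
  · intro t ht
    rw [QT_eq hs χ k ht]
    simp only [Finset.mul_sum, mul_add]
    exact HasDerivAt.fun_sum fun α _ => HasDerivAt.fun_sum fun i _ =>
      ((fu _ i).2.2 t ht).add ((fb _ i).2.2 t ht)

theorem Snap.schU {u b Ut Bt : Fin 3 → (Fin 2 → ℝ) → ℝ} {P : (Fin 2 → ℝ) → ℝ}
    (h : Snap ν η ε u b P Ut Bt) (i : Fin 3) : Sch (Ut i) := by
  rw [h.eqU i]
  have hg : Sch (gp P i) := by
    have := h.hP
    fin_cases i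
    · exact this.pd 0
    · exact this.pd 1
    · exact Sch.zero
  exact ((((h.hu i).lap.const_mul ν).sub ((Sch.Hu h.hu h.hb i 0).pd 0)).sub
    ((Sch.Hu h.hu h.hb i 1).pd 1)).sub hg

theorem Snap.schB {u b Ut Bt : Fin 3 → (Fin 2 → ℝ) → ℝ} {P : (Fin 2 → ℝ) → ℝ}
    (h : Snap ν η ε u b P Ut Bt) (i : Fin 3) : Sch (Bt i) := by
  rw [h.eqB i]
  have hcu : ∀ a : Fin 3 → (Fin 2 → ℝ) → ℝ, (∀ i, Sch (a i)) → ∀ i, Sch (cu a i) := by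
    intro a ha i
    fin_cases i
    · exact (ha 2).pd 1
    · exact ((ha 2).pd 0).neg
    · exact ((ha 1).pd 0).sub ((ha 0).pd 1)
  have hcr : ∀ i, Sch (cr (cu b) b i) := by
    intro i
    have h1 := hcu b h.hb
    have h2 := h.hb
    fin_cases i
    · exact ((h1 1).mul (h2 2)).sub ((h1 2).mul (h2 1))
    · exact ((h1 2).mul (h2 0)).sub ((h1 0).mul (h2 2))
    · exact ((h1 0).mul (h2 1)).sub ((h1 1).mul (h2 0))
  exact ((((h.hb i).lap.const_mul η).sub ((Sch.Hb h.hu h.hb i 0).pd 0)).sub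
    ((Sch.Hb h.hu h.hb i 1).pd 1)).sub ((hcu _ hcr i).const_mul ε)

open Filter Topology in
theorem YT_tendsto (hs : IsHallMHDSolution ν η ε (Set.Ico 0 T) u b π)
    {χ : ℕ → (Fin 2 → ℝ) → ℝ} {κ : ℕ → ℝ} (hc : ∀ n, Cut (χ n) (κ n))
    (hx : ∀ x, Tendsto (fun n => χ n x) atTop (𝓝 1)) (k : ℕ) {t : ℝ} (ht : t ∈ Set.Ioo 0 T) :
    Tendsto (fun n => YT (χ n) u b k t) atTop (𝓝 (ET u b k t)) := by
  have h := snap_of_sol hs ht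
  refine tendsto_finsetSum _ fun α _ => tendsto_finsetSum _ fun i _ => ?_
  exact (cut_tendsto hc hx ((h.hu i).pdl _).sq).add (cut_tendsto hc hx ((h.hb i).pdl _).sq)

open Filter Topology in
theorem QT_tendsto (hs : IsHallMHDSolution ν η ε (Set.Ico 0 T) u b π)
    {χ : ℕ → (Fin 2 → ℝ) → ℝ} {κ : ℕ → ℝ} (hc : ∀ n, Cut (χ n) (κ n))
    (hx : ∀ x, Tendsto (fun n => χ n x) atTop (𝓝 1)) (k : ℕ) {t : ℝ} (ht : t ∈ Set.Ioo 0 T) :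
    Tendsto (fun n => QT (χ n) u b k t) atTop (𝓝 (QT (fun _ => 1) u b k t)) := by
  have h := snap_of_sol hs ht
  refine tendsto_finsetSum _ fun α _ => ?_
  have e : ∀ f : (Fin 2 → ℝ) → ℝ, (∫ x, (1 : ℝ) ^ 2 * f x) = ∫ x, f x := by intro f; simp
  unfold QQ
  refine (tendsto_finsetSum _ fun i _ => ?_).add (tendsto_finsetSum _ fun i _ => ?_)
  · rw [e]
    exact cut_tendsto hc hx (((h.hu i).pdl _).mul ((h.schU i).pdl _))
  · rw [e]
    exact cut_tendsto hc hx (((h.hb i).pdl _).mul ((h.schB i).pdl _))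

theorem ET_nonneg (k : ℕ) (t : ℝ) : 0 ≤ ET u b k t := En_nonneg k

theorem ET_meas (hs : IsHallMHDSolution ν η ε (Set.Ico 0 T) u b π) (k : ℕ) :
    AEStronglyMeasurable (ET u b k) (volume.restrict (Set.Ioo 0 T)) := by
  obtain ⟨χ, κ, hκ, hc, hcont, hcs, hx⟩ := exists_cutoffs
  refine aestronglyMeasurable_of_tendsto_ae Filter.atTop (f := fun n => YT (χ n) u b k)
    (fun n => (YT_ftc hs (hcont n) (hcs n) k).1.aestronglyMeasurable measurableSet_Ioo) ?_
  filter_upwards [ae_restrict_mem measurableSet_Ioo] with t ht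
  exact YT_tendsto hs hc hx k ht

theorem energy_ineq (hs : IsHallMHDSolution ν η ε (Set.Ico 0 T) u b π) (hν : 0 < ν) (hη : 0 < η)
    {m : ℕ} (hm : 3 ≤ m) {s t : ℝ} (h0 : 0 < s) (hst : s ≤ t) (htT : t < T) {K : ℝ}
    (hK : ∀ τ ∈ Set.Icc s t, ∀ j ≤ m, ET u b j τ ≤ K) {k : ℕ} (hk : k ≤ m) {R : ℝ → ℝ}
    (hR : IntervalIntegrable R volume s t)
    (hQ : ∀ τ ∈ Set.Icc s t, QT (fun _ => 1) u b k τ ≤ R τ) :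
    ET u b k t - ET u b k s ≤ 2 * ∫ τ in s..t, R τ := by
  obtain ⟨χ, κ, hκ, hc, hcont, hcs, hx⟩ := exists_cutoffs
  obtain ⟨M, κ0, hκ0, hM⟩ := QE_crude (ε := ε) hν hη m hm (max 1 K) (le_max_left _ _)
  obtain ⟨N, hN⟩ := Filter.eventually_atTop.1 ((tendsto_order.1 hκ).2 κ0 hκ0)
  have hI : ∀ τ ∈ Set.Icc s t, τ ∈ Set.Ioo 0 T := fun τ h =>
    ⟨h0.trans_le h.1, h.2.trans_lt htT⟩
  have sh := Filter.tendsto_add_atTop_nat N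
  refine limit_ineq hst (yn := fun n => YT (χ (n + N)) u b k) (Qn := fun n => QT (χ (n + N)) u b k)
    (M := 2 ^ k * M) (Q := QT (fun _ => 1) u b k) ?_ ?_ ?_ ?_ hQ hR ?_ ?_
  · intro n τ h
    exact (YT_ftc hs (hcont _) (hcs _) k).2.2 τ (hI τ h)
  · intro n
    exact (YT_ftc hs (hcont _) (hcs _) k).2.1.mono hI
  · intro n τ h
    exact hM _ _ _ _ _ _ _ k hk (snap_of_sol hs (hI τ h))
      (fun j hj => (hK τ h j hj).trans (le_max_right _ _)) (hc _) (hN _ (by omega)).le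
  · intro τ h
    exact (QT_tendsto hs hc hx k (hI τ h)).comp sh
  · exact (YT_tendsto hs hc hx k (hI s ⟨le_rfl, hst⟩)).comp sh
  · exact (YT_tendsto hs hc hx k (hI t ⟨hst, le_rfl⟩)).comp sh

end
end

section
noncomputable section

theorem pdl_eq_iterated {f : (Fin 2 → ℝ) → (Fin 3 → ℝ)} (hf : ContDiff ℝ (⊤ : ℕ∞) f) (i : Fin 3)
    (k : ℕ) : ∀ (α : Fin k → Fin 2) (x : Fin 2 → ℝ), pdl (List.ofFn α) (fun x => f x i) x
      = iteratedFDeriv ℝ k f x (fun j => Pi.single (α j) 1) i := by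
  induction k with
  | zero => intro α x; simp [pdl]
  | succ k ih =>
    intro α x
    rw [List.ofFn_succ]
    change pd (α 0) (pdl (List.ofFn fun j => α j.succ) (fun x => f x i)) x = _
    rw [funext (ih fun j => α j.succ), iteratedFDeriv_succ_apply_left]
    have hd : DifferentiableAt ℝ (iteratedFDeriv ℝ k f) x :=
      (hf.differentiable_iteratedFDeriv (by exact_mod_cast WithTop.coe_lt_top k)) x
    have h1 := hd.hasFDerivAt
    have h2 := ((ContinuousMultilinearMap.apply ℝ (fun _ : Fin k => Fin 2 → ℝ) (Fin 3 → ℝ)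
      (fun j => Pi.single (α j.succ) 1)).hasFDerivAt (x := iteratedFDeriv ℝ k f x)).comp x h1
    have h3 := ((ContinuousLinearMap.proj i : (Fin 3 → ℝ) →L[ℝ] ℝ).hasFDerivAt).comp x h2
    unfold pd
    have e : fderiv ℝ (fun x => iteratedFDeriv ℝ k f x (fun j => Pi.single (α j.succ) 1) i) x = _ :=
      h3.fderiv
    rw [e]
    rfl

theorem multilin_bound (k : ℕ)
    (M : ContinuousMultilinearMap ℝ (fun _ : Fin k => Fin 2 → ℝ) (Fin 3 → ℝ)) :
    ‖M‖ ≤ ∑ α : Fin k → Fin 2, ∑ i : Fin 3, |M (fun j => Pi.single (α j) 1) i| := by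
  refine M.opNorm_le_bound (by positivity) fun v => ?_
  have e : M v = ∑ α : Fin k → Fin 2, (∏ j, v j (α j)) • M (fun j => Pi.single (α j) 1) := by
    have h1 : v = fun j => ∑ a : Fin 2, v j a • (Pi.single a 1 : Fin 2 → ℝ) := by
      funext j
      exact pi_eq_sum_univ' (v j)
    conv_lhs => rw [h1]
    rw [ContinuousMultilinearMap.map_sum]
    exact Finset.sum_congr rfl fun α _ => M.map_smul_univ _ _
  rw [e, Finset.sum_mul]
  refine (norm_sum_le _ _).trans (Finset.sum_le_sum fun α _ => ?_)
  rw [norm_smul, mul_comm]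
  refine mul_le_mul ?_ ?_ (norm_nonneg _) (Finset.sum_nonneg fun _ _ => abs_nonneg _)
  · rw [pi_norm_le_iff_of_nonneg (Finset.sum_nonneg fun _ _ => abs_nonneg _)]
    intro i
    exact Finset.single_le_sum (f := fun i => |M (fun j => Pi.single (α j) 1) i|)
      (fun _ _ => abs_nonneg _) (Finset.mem_univ i)
  · rw [norm_prod]
    exact Finset.prod_le_prod (fun _ _ => norm_nonneg _) fun j _ => norm_le_pi_norm (v j) (α j)

section
variable {f : (Fin 2 → ℝ) → (Fin 3 → ℝ)}

theorem D_pt (hf : IsSchwartz f) (k : ℕ) (x : Fin 2 → ℝ) : ‖iteratedFDeriv ℝ k f x‖ ^ 2 ≤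
    3 * 2 ^ k * ∑ α : Fin k → Fin 2, ∑ i : Fin 3, pdl (List.ofFn α) (fun x => f x i) x ^ 2 := by
  have h := multilin_bound k (iteratedFDeriv ℝ k f x)
  simp only [← pdl_eq_iterated hf.1] at h
  refine (pow_le_pow_left₀ (norm_nonneg _) h 2).trans ?_
  refine (sq_sum_le_card_mul_sum_sq (s := Finset.univ)).trans ?_
  have hc : ((Finset.univ : Finset (Fin k → Fin 2)).card : ℝ) = 2 ^ k := by simp
  rw [hc, mul_comm (3 : ℝ), mul_assoc, Finset.mul_sum (a := (3 : ℝ))]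
  refine mul_le_mul_of_nonneg_left (Finset.sum_le_sum fun α _ => ?_) (by positivity)
  have := sq_sum_le_card_mul_sum_sq (s := Finset.univ)
    (f := fun i => |pdl (List.ofFn α) (fun x => f x i) x|)
  simpa [sq_abs] using this

theorem D_sch (hf : IsSchwartz f) (k : ℕ) : Sch (fun x => 3 * 2 ^ k *
    ∑ α : Fin k → Fin 2, ∑ i : Fin 3, pdl (List.ofFn α) (fun x => f x i) x ^ 2) :=
  (Sch.sum _ fun α _ => Sch.sum _ fun i _ => ((hf.comp i).pdl _).sq).const_mul _

theorem D_int (hf : IsSchwartz f) (k : ℕ) :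
    Integrable (fun x => ‖iteratedFDeriv ℝ k f x‖ ^ 2) := by
  refine (D_sch hf k).integrable.mono' ?_ (ae_of_all _ fun x => ?_)
  · exact ((hf.1.continuous_iteratedFDeriv (by exact_mod_cast le_top)).norm.pow 2).aestronglyMeasurable
  · rw [Real.norm_of_nonneg (by positivity)]
    exact D_pt hf k x

theorem D_le (hf : IsSchwartz f) (k : ℕ) : ∫ x, ‖iteratedFDeriv ℝ k f x‖ ^ 2 ≤
    3 * 2 ^ k * ∑ α : Fin k → Fin 2, ∑ i : Fin 3, n2 (pdl (List.ofFn α) (fun x => f x i)) := by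
  refine (integral_mono (D_int hf k) (D_sch hf k).integrable (D_pt hf k)).trans (le_of_eq ?_)
  rw [integral_const_mul, integral_finsetSum]
  · congr 1
    refine Finset.sum_congr rfl fun α _ => ?_
    rw [integral_finsetSum]
    · rfl
    · exact fun i _ => ((hf.comp i).pdl _).sq.integrable
  · exact fun α _ => (Sch.sum _ fun i _ => ((hf.comp i).pdl _).sq).integrable

theorem D_ge (hf : IsSchwartz f) (k : ℕ) (α : Fin k → Fin 2) (i : Fin 3) :
    n2 (pdl (List.ofFn α) (fun x => f x i)) ≤ ∫ x, ‖iteratedFDeriv ℝ k f x‖ ^ 2 := by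
  refine integral_mono ((hf.comp i).pdl _).sq.integrable (D_int hf k) fun x => ?_
  simp only
  rw [pdl_eq_iterated hf.1, ← sq_abs]
  refine pow_le_pow_left₀ (abs_nonneg _) ?_ 2
  refine (norm_le_pi_norm (iteratedFDeriv ℝ k f x (fun j => Pi.single (α j) 1)) i).trans ?_
  refine ((iteratedFDeriv ℝ k f x).le_opNorm _).trans (le_of_eq ?_)
  simp [Pi.norm_single]

theorem hSob_ge (m : ℕ) {k : ℕ} (hk : k ≤ m) :
    ∫ x, ‖iteratedFDeriv ℝ k f x‖ ^ 2 ≤ hSobNorm m f ^ 2 := by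
  unfold hSobNorm
  have h0 : ∀ k, 0 ≤ ∫ x, ‖iteratedFDeriv ℝ k f x‖ ^ 2 := fun k =>
    integral_nonneg fun x => by positivity
  rw [Real.sq_sqrt (Finset.sum_nonneg fun k _ => h0 k)]
  exact Finset.single_le_sum (f := fun k => ∫ x, ‖iteratedFDeriv ℝ k f x‖ ^ 2) (fun k _ => h0 k)
    (Finset.mem_range.2 (by omega))

end

variable {ν η ε T : ℝ} {u b : ℝ → (Fin 2 → ℝ) → (Fin 3 → ℝ)} {π : ℝ → (Fin 2 → ℝ) → ℝ}

theorem ET_le {t : ℝ} (hu : IsSchwartz (u t)) (hb : IsSchwartz (b t)) (m : ℕ) {k : ℕ}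
    (hk : k ≤ m) : ET u b k t ≤ 2 ^ m * (3 * (hSobNorm m (u t) + hSobNorm m (b t)) ^ 2) := by
  have a0 : 0 ≤ hSobNorm m (u t) := Real.sqrt_nonneg _
  have b0 : 0 ≤ hSobNorm m (b t) := Real.sqrt_nonneg _
  have h1 : ET u b k t ≤ 2 ^ k * (3 * (hSobNorm m (u t) + hSobNorm m (b t)) ^ 2) := by
    unfold ET En
    rw [← sum_words_const]
    refine Finset.sum_le_sum fun α _ => ?_
    unfold eW
    have : ∀ i ∈ (Finset.univ : Finset (Fin 3)), n2 (pdl (List.ofFn α) (fun x => u t x i)) +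
        n2 (pdl (List.ofFn α) (fun x => b t x i)) ≤ (hSobNorm m (u t) + hSobNorm m (b t)) ^ 2 := by
      intro i _
      have h2 := (D_ge hu k α i).trans (hSob_ge m hk)
      have h3 := (D_ge hb k α i).trans (hSob_ge m hk)
      nlinarith
    refine (Finset.sum_le_card_nsmul _ _ _ this).trans (le_of_eq ?_)
    simp
  refine h1.trans (mul_le_mul_of_nonneg_right ?_ (by positivity))
  exact pow_le_pow_right₀ (by norm_num) hk

theorem hSob_le {t : ℝ} (hu : IsSchwartz (u t)) (hb : IsSchwartz (b t)) (m : ℕ) {K : ℝ}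
    (hK : ∀ k ≤ m, ET u b k t ≤ K) :
    hSobNorm m (u t) + hSobNorm m (b t) ≤ 2 * √(∑ k ∈ Finset.range (m + 1), 3 * 2 ^ k * K) := by
  have key : ∀ f : (Fin 2 → ℝ) → (Fin 3 → ℝ), IsSchwartz f →
      (∀ k, ∑ α : Fin k → Fin 2, ∑ i : Fin 3, n2 (pdl (List.ofFn α) (fun x => f x i)) ≤ ET u b k t) →
      hSobNorm m f ≤ √(∑ k ∈ Finset.range (m + 1), 3 * 2 ^ k * K) := by
    intro f hf h
    unfold hSobNorm
    refine Real.sqrt_le_sqrt (Finset.sum_le_sum fun k hk => ?_)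
    refine (D_le hf k).trans (mul_le_mul_of_nonneg_left ((h k).trans (hK k ?_)) (by positivity))
    have := Finset.mem_range.1 hk
    omega
  have h1 := key (u t) hu (fun k => by
    refine Finset.sum_le_sum fun α _ => Finset.sum_le_sum fun i _ => ?_
    exact le_add_of_nonneg_right (n2_nonneg _))
  have h2 := key (b t) hb (fun k => by
    refine Finset.sum_le_sum fun α _ => Finset.sum_le_sum fun i _ => ?_
    exact le_add_of_nonneg_left (n2_nonneg _))
  linarith

end
end

section
noncomputable section

open Filter Topology in
theorem gron {T0 T c : ℝ} (hT : T0 < T) (hc : 0 ≤ c) {y z a : ℝ → ℝ}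
    (hy0 : ∀ t ∈ Set.Ico T0 T, 0 ≤ y t)
    (hyb : ∀ t ∈ Set.Ico T0 T, ∃ B, ∀ τ ∈ Set.Icc T0 t, y τ ≤ B)
    (ha0 : ∀ t ∈ Set.Ico T0 T, 0 ≤ a t) (ha : IntegrableOn a (Set.Ioo T0 T))
    (hz0 : ∀ t ∈ Set.Ico T0 T, 0 ≤ z t)
    (hzi : ∀ t ∈ Set.Ico T0 T, IntegrableOn z (Set.Ioc T0 t))
    (hineq : ∀ s ∈ Set.Ico T0 T, ∀ t ∈ Set.Ico T0 T, s ≤ t →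
      y t + c * (∫ τ in s..t, z τ) ≤ y s + ∫ τ in s..t, a τ * (1 + y τ)) :
    (∃ Y, ∀ t ∈ Set.Ico T0 T, y t ≤ Y) ∧ (0 < c → IntegrableOn z (Set.Ioo T0 T)) := by
  have haI : IntegrableOn a (Set.Icc T0 T) := (integrableOn_Icc_iff_integrableOn_Ioo).2 ha
  have haII : ∀ s ∈ Set.Icc T0 T, ∀ t ∈ Set.Icc T0 T, s ≤ t → IntervalIntegrable a volume s t := by
    intro s hs t ht hst
    rw [intervalIntegrable_iff_integrableOn_Icc_of_le hst]
    exact haI.mono_set (Set.Icc_subset_Icc hs.1 ht.2)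
  have hmono : ∀ s ∈ Set.Ico T0 T, ∀ t ∈ Set.Ico T0 T, s ≤ t →
      ∫ τ in s..t, a τ ≤ ∫ τ in s..T, a τ := by
    intro s hs t ht hst
    have h1 := haII s ⟨hs.1, hs.2.le⟩ t ⟨ht.1, ht.2.le⟩ hst
    have h2 := haII t ⟨ht.1, ht.2.le⟩ T ⟨hT.le, le_rfl⟩ ht.2.le
    rw [← intervalIntegral.integral_add_adjacent_intervals h1 h2]
    have : 0 ≤ ∫ τ in t..T, a τ := by
      rw [intervalIntegral.integral_of_le ht.2.le, integral_Ioc_eq_integral_Ioo]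
      exact setIntegral_nonneg measurableSet_Ioo fun τ hτ => ha0 τ ⟨ht.1.trans hτ.1.le, hτ.2⟩
    linarith
  have hintg : ∀ s ∈ Set.Ico T0 T, ∀ t ∈ Set.Ico T0 T, s ≤ t → ∀ S, 0 ≤ S →
      (∀ τ ∈ Set.Icc s t, y τ ≤ S) →
      ∫ τ in s..t, a τ * (1 + y τ) ≤ (1 + S) * ∫ τ in s..T, a τ := by
    intro s hs t ht hst S hS hyS
    refine le_trans ?_ (mul_le_mul_of_nonneg_left (hmono s hs t ht hst) (by linarith))
    rw [← intervalIntegral.integral_const_mul, intervalIntegral.integral_of_le hst,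
      intervalIntegral.integral_of_le hst]
    have hm : ∀ τ ∈ Set.Ioc s t, τ ∈ Set.Ico T0 T := fun τ h =>
      ⟨hs.1.trans h.1.le, h.2.trans_lt ht.2⟩
    refine integral_mono_of_nonneg ?_
      (((haII s ⟨hs.1, hs.2.le⟩ t ⟨ht.1, ht.2.le⟩ hst).1).const_mul _) ?_
    · filter_upwards [ae_restrict_mem measurableSet_Ioc] with τ hτ
      exact mul_nonneg (ha0 τ (hm τ hτ)) (by linarith [hy0 τ (hm τ hτ)])
    · filter_upwards [ae_restrict_mem measurableSet_Ioc] with τ hτ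
      have := mul_le_mul_of_nonneg_left (hyS τ (Set.Ioc_subset_Icc_self hτ)) (ha0 τ (hm τ hτ))
      linarith
  have hzn : ∀ s ∈ Set.Ico T0 T, ∀ t ∈ Set.Ico T0 T, s ≤ t → 0 ≤ ∫ τ in s..t, z τ := by
    intro s hs t ht hst
    exact intervalIntegral.integral_nonneg hst fun τ hτ =>
      hz0 τ ⟨hs.1.trans hτ.1, hτ.2.trans_lt ht.2⟩
  obtain ⟨T1, hT1, hT1a⟩ : ∃ T1 ∈ Set.Ico T0 T, ∫ τ in T1..T, a τ ≤ 1 / 2 := by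
    have hcn := intervalIntegral.continuousOn_primitive_interval_left (f := a) (μ := volume)
      (a := T0) (b := T) (by rw [Set.uIcc_of_le hT.le]; exact haI)
    rw [Set.uIcc_of_le hT.le] at hcn
    have h1 := (hcn T ⟨hT.le, le_rfl⟩).mono Set.Ico_subset_Icc_self
    have h2 : Tendsto (fun x => ∫ τ in x..T, a τ) (𝓝[Set.Ico T0 T] T) (𝓝 0) := by
      have := h1.tendsto
      simpa using this
    have hnb : (𝓝[Set.Ico T0 T] T).NeBot := by
      rw [← mem_closure_iff_nhdsWithin_neBot, closure_Ico hT.ne]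
      exact ⟨hT.le, le_rfl⟩
    have h3 := ((tendsto_order.1 h2).2 (1 / 2) (by norm_num)).and self_mem_nhdsWithin
    obtain ⟨T1, h4, h5⟩ := h3.exists
    exact ⟨T1, h5, h4.le⟩
  have hY : ∃ Y, ∀ t ∈ Set.Ico T0 T, y t ≤ Y := by
    obtain ⟨B1, hB1⟩ := hyb T1 hT1
    refine ⟨max B1 (2 * y T1 + 1), fun t ht => ?_⟩
    rcases le_total t T1 with h | h
    · exact (hB1 t ⟨ht.1, h⟩).trans (le_max_left _ _)
    refine le_trans ?_ (le_max_right _ _)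
    obtain ⟨B, hB⟩ := hyb t ht
    have hmem : ∀ τ ∈ Set.Icc T1 t, τ ∈ Set.Ico T0 T := fun τ hτ =>
      ⟨hT1.1.trans hτ.1, hτ.2.trans_lt ht.2⟩
    have bdd : BddAbove (y '' Set.Icc T1 t) := ⟨B, by
      rintro _ ⟨τ, hτ, rfl⟩
      exact hB τ ⟨hT1.1.trans hτ.1, hτ.2⟩⟩
    set S := sSup (y '' Set.Icc T1 t) with hS
    have hle : ∀ τ ∈ Set.Icc T1 t, y τ ≤ S := fun τ hτ => le_csSup bdd ⟨τ, hτ, rfl⟩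
    have hS0 : 0 ≤ S := (hy0 t ht).trans (hle t ⟨h, le_rfl⟩)
    have hSle : S ≤ y T1 + (1 + S) * (1 / 2) := by
      refine csSup_le ⟨_, t, ⟨h, le_rfl⟩, rfl⟩ ?_
      rintro _ ⟨τ, hτ, rfl⟩
      have e1 := hineq T1 hT1 τ (hmem τ hτ) hτ.1
      have e2 := hintg T1 hT1 τ (hmem τ hτ) hτ.1 S hS0 fun σ hσ => hle σ ⟨hσ.1, hσ.2.trans hτ.2⟩
      have e3 := mul_nonneg hc (hzn T1 hT1 τ (hmem τ hτ) hτ.1)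
      have e4 := mul_le_mul_of_nonneg_left hT1a (by linarith : 0 ≤ 1 + S)
      linarith
    linarith [hle t ⟨h, le_rfl⟩]
  refine ⟨hY, fun hc0 => ?_⟩
  obtain ⟨Y, hY⟩ := hY
  have hT0 : T0 ∈ Set.Ico T0 T := ⟨le_rfl, hT⟩
  have hY0 : 0 ≤ Y := (hy0 T0 hT0).trans (hY T0 hT0)
  have key : ∀ t ∈ Set.Ico T0 T, ∫ τ in T0..t, ‖z τ‖ ≤ (y T0 + (1 + Y) * ∫ τ in T0..T, a τ) / c := by
    intro t ht
    have e : ∫ τ in T0..t, ‖z τ‖ = ∫ τ in T0..t, z τ := by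
      refine intervalIntegral.integral_congr fun τ hτ => ?_
      rw [Set.uIcc_of_le ht.1] at hτ
      exact Real.norm_of_nonneg (hz0 τ ⟨hτ.1, hτ.2.trans_lt ht.2⟩)
    rw [e, le_div_iff₀ hc0]
    have e1 := hineq T0 hT0 t ht ht.1
    have e2 := hintg T0 hT0 t ht ht.1 Y hY0 fun σ hσ => hY σ ⟨hσ.1, hσ.2.trans_lt ht.2⟩
    have := hy0 t ht
    linarith
  have hmem : ∀ n : ℕ, T - (T - T0) / ((n : ℝ) + 1) ∈ Set.Ico T0 T := by
    intro n
    have h1 : (0 : ℝ) < (n : ℝ) + 1 := by positivity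
    have h2 : 0 < (T - T0) / ((n : ℝ) + 1) := div_pos (by linarith) h1
    have h3 : (T - T0) / ((n : ℝ) + 1) ≤ T - T0 :=
      div_le_self (by linarith) (by linarith [(Nat.cast_nonneg n : (0 : ℝ) ≤ n)])
    exact ⟨by linarith, by linarith⟩
  have hlim : Tendsto (fun n : ℕ => T - (T - T0) / ((n : ℝ) + 1)) atTop (𝓝 T) := by
    have h1 := (tendsto_one_div_add_atTop_nhds_zero_nat (𝕜 := ℝ)).const_mul (T - T0)
    have h2 := h1.const_sub T
    simp only [mul_zero, sub_zero, mul_one_div] at h2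
    exact h2
  have := integrableOn_Ioc_of_intervalIntegral_norm_bounded_right (l := atTop) (a := T0)
    (b := fun n : ℕ => T - (T - T0) / ((n : ℝ) + 1)) (b₀ := T) (f := z)
    (I := (y T0 + (1 + Y) * ∫ τ in T0..T, a τ) / c)
    (fun n => hzi _ (hmem n)) hlim (Eventually.of_forall fun n => by
      have := key _ (hmem n)
      rwa [intervalIntegral.integral_of_le (hmem n).1] at this)
  exact this.mono_set Set.Ioo_subset_Ioc_self

end
end

section
noncomputable section
section
variable {ν η ε T : ℝ} {u b : ℝ → (Fin 2 → ℝ) → (Fin 3 → ℝ)} {π : ℝ → (Fin 2 → ℝ) → ℝ}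

/-- the modulus of `∇b₃` at time `t` -/
def Wg (b : ℝ → (Fin 2 → ℝ) → (Fin 3 → ℝ)) (t : ℝ) (x : Fin 2 → ℝ) : ℝ :=
  Real.sqrt ((pd 0 (fun y => b t y 2) x) ^ 2 + (pd 1 (fun y => b t y 2) x) ^ 2)

theorem Wg_sch (hs : IsHallMHDSolution ν η ε (Set.Ico 0 T) u b π) {t : ℝ}
    (ht : t ∈ Set.Ico 0 T) (i : Fin 2) : Sch (pd i (fun y => b t y 2)) := by
  have := (hs.schwartz_b t ht).comp 2
  fun_prop

theorem Wg_cont (hs : IsHallMHDSolution ν η ε (Set.Ico 0 T) u b π) {t : ℝ}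
    (ht : t ∈ Set.Ico 0 T) : Continuous (Wg b t) := by
  have h0 := (Wg_sch hs ht 0).continuous
  have h1 := (Wg_sch hs ht 1).continuous
  unfold Wg
  fun_prop

theorem Wg_fin (hs : IsHallMHDSolution ν η ε (Set.Ico 0 T) u b π) {t : ℝ}
    (ht : t ∈ Set.Ico 0 T) (p : ℝ≥0∞) : eLpNorm (Wg b t) p volume < ⊤ := by
  have hm : ∀ i, MemLp (pd i (fun y => b t y 2)) p volume := by
    intro i
    obtain ⟨s, hs'⟩ := Wg_sch hs ht i
    rw [← hs']
    exact s.memLp p volume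
  have h2 : MemLp (fun x => ‖pd 0 (fun y => b t y 2) x‖ + ‖pd 1 (fun y => b t y 2) x‖) p volume :=
    (hm 0).norm.add (hm 1).norm
  refine (h2.mono (Wg_cont hs ht).aestronglyMeasurable (Filter.Eventually.of_forall fun x => ?_)).2
  unfold Wg
  rw [Real.norm_of_nonneg (Real.sqrt_nonneg _), Real.norm_of_nonneg (by positivity)]
  refine Real.sqrt_le_iff.2 ⟨by positivity, ?_⟩
  simp only [Real.norm_eq_abs]
  have := mul_nonneg (abs_nonneg (pd 0 (fun y => b t y 2) x)) (abs_nonneg (pd 1 (fun y => b t y 2) x))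
  nlinarith [sq_abs (pd 0 (fun y => b t y 2) x), sq_abs (pd 1 (fun y => b t y 2) x)]

open Filter Topology in
theorem Wg_meas (hs : IsHallMHDSolution ν η ε (Set.Ico 0 T) u b π) (p : ℝ≥0∞) :
    AEMeasurable (fun t => eLpNorm (Wg b t) p volume) (volume.restrict (Set.Ioo 0 T)) := by
  refine aemeasurable_restrict_of_measurable_subtype measurableSet_Ioo ?_
  refine LowerSemicontinuous.measurable fun x y hy => ?_
  by_contra hcon
  rw [not_eventually] at hcon
  obtain ⟨ns, hns, hle⟩ := exists_seq_forall_of_frequently hcon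
  have hlim : ∀ z, Tendsto (fun n => Wg b (ns n : ℝ) z) atTop (𝓝 (Wg b (x : ℝ) z)) := by
    intro z
    have hd : ∀ i : Fin 2, Tendsto (fun n => pd i (fun y => b (ns n : ℝ) y 2) z) atTop
        (𝓝 (pd i (fun y => b (x : ℝ) y 2) z)) := by
      intro i
      have h1 := ((js_comp hs.smooth_b 2).dx i).cont
      have h2 : ContinuousOn (fun t : ℝ => pd i (fun y => b t y 2) z) (Set.Ioo 0 T) :=
        h1.comp (f := fun t : ℝ => (t, z)) (by fun_prop) fun t ht => ⟨ht, Set.mem_univ _⟩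
      have h3 := (continuousOn_iff_continuous_domRestrict.1 h2).tendsto x
      exact h3.comp hns
    exact (Real.continuous_sqrt.tendsto _).comp (((hd 0).pow 2).add ((hd 1).pow 2))
  have h1 := Lp.eLpNorm_lim_le_liminf_eLpNorm (p := p) (μ := volume)
    (f := fun n => Wg b (ns n : ℝ))
    (fun n => (Wg_cont hs (Set.Ioo_subset_Ico_self (ns n).2)).aestronglyMeasurable)
    (Wg b (x : ℝ)) (Eventually.of_forall hlim)
  have h2 : (atTop.liminf fun n => eLpNorm (Wg b (ns n : ℝ)) p volume) ≤ y := by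
    refine liminf_le_of_frequently_le' (Frequently.of_forall fun n => ?_)
    exact not_lt.1 (hle n)
  exact absurd (h1.trans h2) (not_le.2 hy)

theorem Wg_int (hs : IsHallMHDSolution ν η ε (Set.Ico 0 T) u b π) {p : ℝ≥0∞} {r : ℝ}
    (hcrit : ∫⁻ t in Set.Ico (0 : ℝ) T, (eLpNorm (Wg b t) p volume) ^ r < ⊤) :
    IntegrableOn (fun t => (eLpNorm (Wg b t) p volume).toReal ^ r) (Set.Ioo 0 T) := by
  simp_rw [ENNReal.toReal_rpow]
  refine integrable_toReal_of_lintegral_ne_top ((Wg_meas hs p).pow_const r) (ne_of_lt ?_)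
  exact (lintegral_mono_set Set.Ioo_subset_Ico_self).trans_lt hcrit
end

end
end

section
noncomputable section
section
variable {ν η ε T T0 : ℝ} {u b : ℝ → (Fin 2 → ℝ) → (Fin 3 → ℝ)} {π : ℝ → (Fin 2 → ℝ) → ℝ} {m : ℕ}

theorem ET_intOn (hs : IsHallMHDSolution ν η ε (Set.Ico 0 T) u b π) (h0 : 0 < T0)
    (hB : ∀ t ∈ Set.Ico T0 T, ∃ B, ∀ τ ∈ Set.Icc T0 t, ∀ j ≤ m, ET u b j τ ≤ B) {k : ℕ} (hk : k ≤ m)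
    {t : ℝ} (ht : t ∈ Set.Ico T0 T) : IntegrableOn (ET u b k) (Set.Ioc T0 t) := by
  obtain ⟨B, hB⟩ := hB t ht
  have hsub : Set.Ioc T0 t ⊆ Set.Ioo 0 T := fun τ h => ⟨h0.trans h.1, h.2.trans_lt ht.2⟩
  refine Integrable.mono' (g := fun _ => B) (by simp)
    ((ET_meas hs k).mono_measure (Measure.restrict_mono hsub le_rfl)) ?_
  filter_upwards [ae_restrict_mem measurableSet_Ioc] with τ hτ
  rw [Real.norm_of_nonneg (ET_nonneg k τ)]
  exact hB τ (Set.Ioc_subset_Icc_self hτ) k hk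

theorem step (hs : IsHallMHDSolution ν η ε (Set.Ico 0 T) u b π) (hν : 0 < ν) (hη : 0 < η)
    (hm : 3 ≤ m) (h0 : 0 < T0) (hT : T0 < T)
    (hB : ∀ t ∈ Set.Ico T0 T, ∃ B, ∀ τ ∈ Set.Icc T0 t, ∀ j ≤ m, ET u b j τ ≤ B) {k : ℕ} (hk : k ≤ m)
    {c : ℝ} (hc : 0 ≤ c) {z a : ℝ → ℝ}
    (ha0 : ∀ t ∈ Set.Ico T0 T, 0 ≤ a t) (ha : IntegrableOn a (Set.Ioo T0 T))
    (hz0 : ∀ t ∈ Set.Ico T0 T, 0 ≤ z t)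
    (hzi : ∀ t ∈ Set.Ico T0 T, IntegrableOn z (Set.Ioc T0 t))
    (hQ : ∀ τ ∈ Set.Ico T0 T, QT (fun _ => 1) u b k τ ≤ -c * z τ + a τ * (1 + ET u b k τ)) :
    (∃ Y, ∀ t ∈ Set.Ico T0 T, ET u b k t ≤ Y) ∧ (0 < c → IntegrableOn z (Set.Ioo T0 T)) := by
  have main := gron (y := ET u b k) (z := z) (a := fun t => 2 * a t) (c := 2 * c) hT (by linarith)
    (fun t _ => ET_nonneg k t) (fun t ht => by
      obtain ⟨B, h⟩ := hB t ht
      exact ⟨B, fun τ hτ => h τ hτ k hk⟩)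
    (fun t ht => by linarith [ha0 t ht]) (ha.const_mul 2) hz0 hzi ?_
  · exact ⟨main.1, fun h => main.2 (by linarith)⟩
  intro s hs' t ht hst
  obtain ⟨B, hBt⟩ := hB t ht
  have hzst : IntervalIntegrable z volume s t := by
    rw [intervalIntegrable_iff_integrableOn_Ioc_of_le hst]
    exact (hzi t ht).mono_set (Set.Ioc_subset_Ioc_left hs'.1)
  have hast : IntervalIntegrable (fun τ => a τ * (1 + ET u b k τ)) volume s t := by
    rw [intervalIntegrable_iff_integrableOn_Ioc_of_le hst]
    have h1 : IntegrableOn a (Set.Ioc s t) := by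
      refine ((integrableOn_Icc_iff_integrableOn_Ioo).2 ha).mono_set fun τ hτ =>
        ⟨hs'.1.trans hτ.1.le, hτ.2.trans ht.2.le⟩
    have hsub : Set.Ioc s t ⊆ Set.Ioo 0 T := fun τ h =>
      ⟨(h0.trans_le hs'.1).trans h.1, h.2.trans_lt ht.2⟩
    have h2 := ((ET_meas hs k).mono_measure (Measure.restrict_mono hsub le_rfl))
    have h3 : AEStronglyMeasurable (fun τ => 1 + ET u b k τ) (volume.restrict (Set.Ioc s t)) :=
      aestronglyMeasurable_const.add h2
    refine Integrable.mono' (h1.norm.mul_const (1 + B)) (h1.aestronglyMeasurable.mul h3) ?_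
    filter_upwards [ae_restrict_mem measurableSet_Ioc] with τ hτ
    have e0 := ET_nonneg (u := u) (b := b) k τ
    rw [norm_mul, Real.norm_of_nonneg (by linarith : 0 ≤ 1 + ET u b k τ)]
    have := hBt τ ⟨hs'.1.trans hτ.1.le, hτ.2⟩ k hk
    exact mul_le_mul_of_nonneg_left (by linarith) (norm_nonneg _)
  have e := energy_ineq hs hν hη hm (h0.trans_le hs'.1) hst ht.2 (K := B)
    (fun τ hτ j hj => hBt τ ⟨hs'.1.trans hτ.1, hτ.2⟩ j hj) hk
    (R := fun τ => -c * z τ + a τ * (1 + ET u b k τ)) ((hzst.const_mul (-c)).add hast)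
    (fun τ hτ => hQ τ ⟨hs'.1.trans hτ.1, hτ.2.trans_lt ht.2⟩)
  rw [intervalIntegral.integral_add (hzst.const_mul (-c)) hast,
    intervalIntegral.integral_const_mul] at e
  have e2 : ∫ τ in s..t, 2 * a τ * (1 + ET u b k τ) = 2 * ∫ τ in s..t, a τ * (1 + ET u b k τ) := by
    rw [← intervalIntegral.integral_const_mul]
    congr 1
    ext τ
    ring
  rw [e2]
  linarith

theorem all_bdd (hs : IsHallMHDSolution ν η ε (Set.Ico 0 T) u b π) (hν : 0 < ν) (hη : 0 < η)
    (hm : 3 ≤ m) (h0 : 0 < T0) (hT : T0 < T)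
    (hB : ∀ t ∈ Set.Ico T0 T, ∃ B, ∀ τ ∈ Set.Icc T0 t, ∀ j ≤ m, ET u b j τ ≤ B)
    (p : ℝ≥0∞) (r : ℝ) (hp : 2 < p) (hr : 2 ≤ r) (hpr : 2 / p + 2 / ENNReal.ofReal r ≤ 1)
    (hcrit : ∫⁻ t in Set.Ico (0 : ℝ) T, (eLpNorm (Wg b t) p volume) ^ r < ⊤) :
    ∀ k ≤ m, ∃ Y, ∀ t ∈ Set.Ico T0 T, ET u b k t ≤ Y := by
  set c : ℝ := min (ν / 2) (η / 4) with hc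
  have hc0 : 0 < c := by positivity
  have hc1 : c ≤ ν / 2 := min_le_left _ _
  have hc2 : c ≤ η / 4 := min_le_right _ _
  have hI : ∀ τ ∈ Set.Ico T0 T, τ ∈ Set.Ioo 0 T := fun τ h => ⟨h0.trans_le h.1, h.2⟩
  have one : IntegrableOn (fun _ : ℝ => (1 : ℝ)) (Set.Ioo T0 T) := by simp
  have nn : ∀ k t, 0 ≤ ET u b k t := fun k t => ET_nonneg k t
  -- order zero
  obtain ⟨⟨Y0, hY0⟩, i1⟩ := step hs hν hη hm h0 hT hB (k := 0) (by omega) hc0.le (z := ET u b 1)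
    (a := fun _ => 0) (fun _ _ => le_rfl) integrableOn_zero (fun t _ => nn 1 t)
    (fun t ht => ET_intOn hs h0 hB (by omega) ht) (fun τ hτ => by
      have := QE_zero (snap_of_sol hs (hI τ hτ)) (c := c) (by linarith) (by linarith)
      simpa [QT, ET] using this)
  have i1 := i1 hc0
  -- order one
  obtain ⟨C1, hC1, hQ1⟩ := QE_one (ε := ε) hν hη hc0 hc1 hc2 p r hp hr hpr (max 1 Y0)
    (le_max_of_le_left zero_le_one)
  have iW : IntegrableOn (fun t => (eLpNorm (Wg b t) p volume).toReal ^ r) (Set.Ioo T0 T) :=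
    (Wg_int hs hcrit).mono_set (Set.Ioo_subset_Ioo_left h0.le)
  obtain ⟨⟨Y1, hY1⟩, i2⟩ := step hs hν hη hm h0 hT hB (k := 1) (by omega) (c := c / 2)
    (by linarith) (z := ET u b 2)
    (a := fun t => C1 * (1 + (eLpNorm (Wg b t) p volume).toReal ^ r + ET u b 1 t))
    (fun t _ => by have := nn 1 t; positivity) (((one.add iW).add i1).const_mul C1)
    (fun t _ => nn 2 t) (fun t ht => ET_intOn hs h0 hB (by omega) ht) (fun τ hτ => by
      have h1 := hQ1 _ _ _ _ _ (snap_of_sol hs (hI τ hτ)) ((hY0 τ hτ).trans (le_max_right _ _))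
        (Wg_fin hs (Set.Ioo_subset_Ico_self (hI τ hτ)) p)
      have h2 : 0 ≤ C1 * (1 + (eLpNorm (Wg b τ) p volume).toReal ^ r + ET u b 1 τ) := by
        have := nn 1 τ; positivity
      refine h1.trans ?_
      change -(c / 2) * ET u b 2 τ
        + C1 * (1 + (eLpNorm (Wg b τ) p volume).toReal ^ r + ET u b 1 τ) * ET u b 1 τ ≤ _
      linarith)
  have i2 := i2 (by linarith)
  -- order two
  obtain ⟨C2, hC2, hQ2⟩ := QE_two (ε := ε) hν hη hc0 hc1 hc2 (max 1 (max Y0 Y1)) (le_max_left _ _)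
  obtain ⟨⟨Y2, hY2⟩, i3⟩ := step hs hν hη hm h0 hT hB (k := 2) (by omega) (c := c / 2)
    (by linarith) (z := ET u b 3) (a := fun t => C2 * (1 + ET u b 2 t))
    (fun t _ => by have := nn 2 t; positivity) ((one.add i2).const_mul C2)
    (fun t _ => nn 3 t) (fun t ht => ET_intOn hs h0 hB hm ht) (fun τ hτ => by
      have h1 := hQ2 _ _ _ _ _ (snap_of_sol hs (hI τ hτ))
        ((hY0 τ hτ).trans ((le_max_left _ _).trans (le_max_right _ _)))
        ((hY1 τ hτ).trans ((le_max_right _ _).trans (le_max_right _ _)))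
      have h2 : 0 ≤ C2 * (1 + ET u b 2 τ) := by
        have := nn 2 τ; positivity
      refine h1.trans ?_
      change -(c / 2) * ET u b 3 τ + C2 * (1 + ET u b 2 τ) * ET u b 2 τ ≤ _
      linarith)
  have i3 := i3 (by linarith)
  -- higher orders
  intro k
  induction k using Nat.strong_induction_on with
  | _ k ih =>
    intro hk
    rcases Nat.lt_or_ge k 3 with h3 | h3
    · interval_cases k
      exacts [⟨Y0, hY0⟩, ⟨Y1, hY1⟩, ⟨Y2, hY2⟩]
    have hY : ∀ j : ℕ, ∃ Y, j < k → ∀ t ∈ Set.Ico T0 T, ET u b j t ≤ Y := by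
      intro j
      by_cases hj : j < k
      · obtain ⟨Y, hY⟩ := ih j hj (by omega)
        exact ⟨Y, fun _ => hY⟩
      · exact ⟨0, fun h => absurd h hj⟩
    choose Y hY using hY
    obtain ⟨C, hC, hQ⟩ := QE_high (ε := ε) hν hη k h3 (1 + ∑ j ∈ Finset.range k, |Y j|)
      (by linarith [Finset.sum_nonneg fun j (_ : j ∈ Finset.range k) => abs_nonneg (Y j)])
    refine (step hs hν hη hm h0 hT hB (k := k) hk (c := 0) le_rfl (z := fun _ => 0)
      (a := fun t => C * (1 + ET u b 3 t)) (fun t _ => by have := nn 3 t; positivity)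
      ((one.add i3).const_mul C) (fun _ _ => le_rfl) (fun _ _ => integrableOn_zero)
      (fun τ hτ => ?_)).1
    have h1 := hQ _ _ _ _ _ (snap_of_sol hs (hI τ hτ)) (fun j hj => by
      have e1 : ET u b j τ ≤ Y j := hY j hj τ hτ
      have e2 := Finset.single_le_sum (f := fun j => |Y j|) (fun i _ => abs_nonneg _)
        (Finset.mem_range.2 hj)
      have e3 := le_abs_self (Y j)
      change ET u b j τ ≤ _
      linarith)
    rw [mul_zero, zero_add]
    exact h1

end

end
end

/-- Theorem 2.1: regularity criterion for the 2½-dimensional Hall-MHD system in terms of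
`∇b₃` (equivalently, in terms of the first two components `(j₁, j₂)` of the current
density): if `∫₀ᵀ ‖∇b₃‖_{Lᵖ}^r dt < ∞` with `2/p + 2/r ≤ 1`, `p ∈ (2,∞]`, then the `Hᵐ`
norms of `(u, b)` remain bounded up to time `T`. -/
theorem regularity_criterion_grad_b3 (m : ℕ) (hm : 2 < m)
    (ν η ε T : ℝ) (hν : 0 < ν) (hη : 0 < η) (hε : 0 < ε) (hT : 0 < T)
    (u b : ℝ → (Fin 2 → ℝ) → (Fin 3 → ℝ)) (π : ℝ → (Fin 2 → ℝ) → ℝ)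
    (hsol : IsHallMHDSolution ν η ε (Set.Ico 0 T) u b π)
    (hloc : ∀ T' ∈ Set.Ico (0 : ℝ) T, ∃ C : ℝ, ∀ t ∈ Set.Icc (0 : ℝ) T',
      hSobNorm m (u t) + hSobNorm m (b t) ≤ C)
    (p : ℝ≥0∞) (r : ℝ) (hp : 2 < p) (hr : 2 ≤ r)
    (hpr : 2 / p + 2 / ENNReal.ofReal r ≤ 1)
    (hcrit : ∫⁻ t in Set.Ico (0 : ℝ) T,
        (eLpNorm (fun x => Real.sqrt ((pd 0 (fun y => b t y 2) x) ^ 2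
          + (pd 1 (fun y => b t y 2) x) ^ 2)) p volume) ^ r < ⊤) :
    ∃ C : ℝ, ∀ t ∈ Set.Ico (0 : ℝ) T,
      hSobNorm m (u t) + hSobNorm m (b t) ≤ C := by
  have hm3 : 3 ≤ m := hm
  have h0 : 0 < T / 2 := by linarith
  have hT2 : T / 2 < T := by linarith
  have hB : ∀ t ∈ Set.Ico (T / 2) T, ∃ B, ∀ τ ∈ Set.Icc (T / 2) t, ∀ j ≤ m, ET u b j τ ≤ B := by
    intro t ht
    obtain ⟨C, hC⟩ := hloc t ⟨h0.le.trans ht.1, ht.2⟩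
    refine ⟨2 ^ m * (3 * C ^ 2), fun τ hτ j hj => ?_⟩
    have hτ0 : τ ∈ Set.Ico 0 T := ⟨h0.le.trans hτ.1, hτ.2.trans_lt ht.2⟩
    refine (ET_le (hsol.schwartz_u τ hτ0) (hsol.schwartz_b τ hτ0) m hj).trans ?_
    have e1 : 0 ≤ hSobNorm m (u τ) + hSobNorm m (b τ) :=
      add_nonneg (Real.sqrt_nonneg _) (Real.sqrt_nonneg _)
    have e2 := pow_le_pow_left₀ e1 (hC τ ⟨hτ0.1, hτ.2⟩) 2
    gcongr
  have hall := all_bdd hsol hν hη hm3 h0 hT2 hB p r hp hr hpr hcrit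
  have hY : ∀ k : ℕ, ∃ Y, k ≤ m → ∀ t ∈ Set.Ico (T / 2) T, ET u b k t ≤ Y := by
    intro k
    by_cases hk : k ≤ m
    · obtain ⟨Y, hY⟩ := hall k hk
      exact ⟨Y, fun _ => hY⟩
    · exact ⟨0, fun h => absurd h hk⟩
  choose Y hY using hY
  obtain ⟨C0, hC0⟩ := hloc (T / 2) ⟨h0.le, hT2⟩
  refine ⟨max C0 (2 * √(∑ k ∈ Finset.range (m + 1), 3 * 2 ^ k *
    (∑ j ∈ Finset.range (m + 1), |Y j|))), fun t ht => ?_⟩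
  rcases le_total t (T / 2) with h | h
  · exact (hC0 t ⟨ht.1, h⟩).trans (le_max_left _ _)
  refine le_trans (hSob_le (hsol.schwartz_u t ht) (hsol.schwartz_b t ht) m fun k hk => ?_)
    (le_max_right _ _)
  have e1 := hY k hk t ⟨h, ht.2⟩
  have e2 := Finset.single_le_sum (f := fun j => |Y j|) (fun i _ => abs_nonneg _)
    (Finset.mem_range.2 (by omega : k < m + 1))
  exact e1.trans ((le_abs_self _).trans e2)
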